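/- Fix a prime p. Let K be a p-adic differential field whose field of constants k is p-adically closed, let A ∈ Mat_n(K), and let L₁, L₂ be two p-adic Picard–Vessiot fields for y′ = Ay over K. Suppose L₁⁺ and L₂⁺ are p-adic closures of L₁ and L₂ whose p-adic valuations induce the same p-adic valuation on K and such that K ∩ (L₁⁺)ⁿ = K ∩ (L₂⁺)ⁿ for every integer n ≥ 2. For j = 1, 2 let K_j be the relative algebraic closure of K in L_j⁺. Then: (a) each K_j is a p-adic closure of K; (b) there is a K-linear field isomorphism K₁ → K₂, and, identifying K₁ and K₂ via such an isomorphism and denoting this field by K̃ (with its unique derivation extending that of K), the composita L̃_j := K̃ · L_j inside L_j⁺ are p-adic Picard–Vessiot fields for y′ = Ay over K̃; and (c) L̃₁ and L̃₂ are isomorphic as differential field extensions of K̃ if and only if L₁ and L₂ are isomorphic as differential field extensions of K. -/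

import Mathlib

/-- A derivation on a field `F`. -/
structure FieldDeriv (F : Type) [Field F] : Type where
  d : F → F
  map_add : ∀ a b : F, d (a + b) = d a + d b
  leibniz : ∀ a b : F, d (a * b) = a * d b + d a * b

/-- A valuation subring `O` of `F` witnesses that `F` is a p-adic field if `pO` is the
maximal ideal of `O` and `O/pO ≅ 𝔽_p`. -/
def PAdicWitness (p : ℕ) {F : Type} [Field F] (O : ValuationSubring F) : Prop :=
  (Ideal.span {(p : O)}).IsMaximal ∧
    Nonempty ((O ⧸ (Ideal.span {(p : O)} : Ideal O)) ≃+* ZMod p)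

/-- A field is p-adic if it admits a valuation subring witnessing this. -/
def IsPAdicField (p : ℕ) (F : Type) [Field F] : Prop :=
  ∃ O : ValuationSubring F, PAdicWitness p O

/-- A field is p-adically closed if it is p-adic and no proper algebraic extension of it
is p-adic. -/
def IsPAdicallyClosed (p : ℕ) (F : Type) [Field F] : Prop :=
  IsPAdicField p F ∧
    ∀ (E : Type) [Field E] [Algebra F E], Algebra.IsAlgebraic F E →
      IsPAdicField p E → Function.Surjective (algebraMap F E)

/-- `L/K`, with derivations `dL` extending `dK`, is a Picard--Vessiot field for `y' = A y`. -/
def IsPicardVessiot {K L : Type} [Field K] [Field L] [Algebra K L]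
    (dK : FieldDeriv K) (dL : FieldDeriv L) {n : ℕ}
    (A : Matrix (Fin n) (Fin n) K) : Prop :=
  (∀ a : K, dL.d (algebraMap K L a) = algebraMap K L (dK.d a)) ∧
  ∃ F : Matrix (Fin n) (Fin n) L, IsUnit F.det ∧
    (∀ i j, dL.d (F i j) = (A.map (algebraMap K L) * F) i j) ∧
    IntermediateField.adjoin K (Set.range fun q : Fin n × Fin n => F q.1 q.2) = ⊤ ∧
    ∀ x : L, dL.d x = 0 → ∃ a : K, dK.d a = 0 ∧ algebraMap K L a = x

section
open Polynomial
open scoped IntermediateField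

theorem isIntegral_of_forall_mem_valuationSubring {F Z : Type} [Field F] [Field Z] [Algebra F Z]
    (O : ValuationSubring F) {b : Z}
    (h : ∀ W : ValuationSubring Z, (∀ a ∈ O, algebraMap F Z a ∈ W) → b ∈ W) : IsIntegral O b := by
  by_contra hb
  have hb' : b ∉ (integralClosure O Z).toSubring := fun h => hb h
  have : IsIntegrallyClosedIn (integralClosure O Z).toSubring Z :=
    inferInstanceAs (IsIntegrallyClosedIn (integralClosure O Z) Z)
  obtain ⟨V, hV, hbV⟩ := Subring.exists_le_valuationSubring_of_isIntegrallyClosedIn hb'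
  refine hbV (h V fun a ha => hV ?_)
  exact (isIntegral_algebraMap (R := O) (A := Z) (x := ⟨a, ha⟩) : IsIntegral O _)

theorem mem_valuationSubring_of_isIntegral {F Z : Type} [Field F] [Field Z] [Algebra F Z]
    {O : ValuationSubring F} {b : Z} (hb : IsIntegral O b)
    {W : ValuationSubring Z} (hW : ∀ a ∈ O, algebraMap F Z a ∈ W) : b ∈ W := by
  let f : O →+* W := ((algebraMap F Z).comp O.subtype).codRestrict W.toSubring fun a => hW a a.2
  have hb' : IsIntegral W b := by
    obtain ⟨P, hP, hPb⟩ := hb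
    exact ⟨P.map f, hP.map f, by rw [eval₂_map]; exact hPb⟩
  obtain ⟨y, rfl⟩ := IsIntegrallyClosed.isIntegral_iff.mp hb'
  exact y.2

/-- An algebraic element of a valuation ring is a quotient of integral elements whose
denominator is a unit. -/
theorem exists_isIntegral_mul_isIntegral {F Z : Type} [Field F] [Field Z] [Algebra F Z]
    {O : ValuationSubring F} {V : ValuationSubring Z} (hV : ∀ a, algebraMap F Z a ∈ V ↔ a ∈ O)
    {x : Z} (hx : x ∈ V) (hxa : IsAlgebraic F x) :
    ∃ b : Z, IsIntegral O b ∧ IsIntegral O (b * x) ∧ V.valuation b = 1 := by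
  obtain ⟨P, hP0, hPx⟩ := hxa
  obtain ⟨i₀, hi₀, hmax⟩ := Finset.exists_max_image P.support (fun i => O.valuation (P.coeff i))
    (support_nonempty.mpr hP0)
  have hc0 : P.coeff i₀ ≠ 0 := mem_support_iff.mp hi₀
  set Q : F[X] := C (P.coeff i₀)⁻¹ * P with hQ
  have hQ1 : Q.coeff i₀ = 1 := by simp [hQ, hc0]
  have hQx : aeval x Q = 0 := by simp [hQ, hPx]
  have hQO : ∀ i, Q.coeff i ∈ O := by
    intro i
    rw [← ValuationSubring.valuation_le_one_iff, hQ, coeff_C_mul, map_mul, map_inv₀]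
    by_cases hi : i ∈ P.support
    · exact inv_mul_le_one_of_le₀ (hmax i hi) zero_le
    · simp [notMem_support_iff.mp hi]
  let b : ℕ → Z := fun k => aeval x (divX^[k] Q)
  have hcoeff : ∀ k i, (divX^[k] Q).coeff i = Q.coeff (i + k) := by
    intro k
    induction k with
    | zero => simp
    | succ k ih => intro i; rw [Function.iterate_succ_apply', coeff_divX, ih]; congr 1; ring
  have hb0 : b 0 = 0 := hQx
  have hrec : ∀ k, b k = x * b (k + 1) + algebraMap F Z (Q.coeff k) := by
    intro k
    have : divX^[k] Q = X * divX^[k+1] Q + C (Q.coeff k) := by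
      conv_lhs => rw [← X_mul_divX_add (divX^[k] Q)]
      rw [Function.iterate_succ_apply', hcoeff, zero_add]
    simp only [b]
    rw [this]; simp
  have key : ∀ W : ValuationSubring Z, (∀ a ∈ O, algebraMap F Z a ∈ W) →
      ∀ k, b k ∈ W ∧ b k * x ∈ W := by
    intro W hW k
    by_cases hxW : x ∈ W
    · have : b k ∈ W := by
        simp only [b]
        rw [aeval_eq_sum_range]
        refine sum_mem fun i _ => ?_
        rw [Algebra.smul_def, hcoeff]
        exact mul_mem (hW _ (hQO _)) (pow_mem hxW _)
      exact ⟨this, mul_mem this hxW⟩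
    · have hx' := (W.mem_or_inv_mem x).resolve_left hxW
      have hx0 : x ≠ 0 := by rintro rfl; exact hxW (zero_mem _)
      have h2 : ∀ k, b k * x ∈ W → b k ∈ W := fun k h => by
        have := mul_mem h hx'
        rwa [mul_assoc, mul_inv_cancel₀ hx0, mul_one] at this
      have : ∀ k, b k * x ∈ W := by
        intro k
        induction k with
        | zero => rw [hb0, zero_mul]; exact zero_mem _
        | succ k ih =>
          have := sub_mem (h2 k ih) (hW _ (hQO k))
          rw [hrec k] at this
          rwa [add_sub_cancel_right, mul_comm] at this
      exact ⟨h2 k (this k), this k⟩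
  have hint : ∀ k, IsIntegral O (b k) ∧ IsIntegral O (b k * x) := fun k =>
    ⟨isIntegral_of_forall_mem_valuationSubring O fun W hW => (key W hW k).1,
      isIntegral_of_forall_mem_valuationSubring O fun W hW => (key W hW k).2⟩
  have hle : ∀ k, V.valuation (b k) ≤ 1 := fun k =>
    (V.valuation_le_one_iff _).mpr (key V (fun a ha => (hV a).mpr ha) k).1
  by_contra! hcon
  have hlt : ∀ k, V.valuation (b k) < 1 := fun k =>
    lt_of_le_of_ne (hle k) (hcon _ (hint k).1 (hint k).2)
  have h1 : (1 : Z) = b i₀ - x * b (i₀ + 1) := by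
    rw [hrec i₀, hQ1]; simp
  have h2 : V.valuation (1 : Z) < 1 := by
    rw [h1]
    refine lt_of_le_of_lt (V.valuation.map_sub _ _) (max_lt (hlt _) ?_)
    rw [map_mul]
    exact mul_lt_one_of_nonneg_of_lt_one_right ((V.valuation_le_one_iff _).mpr hx) zero_le (hlt _)
  simp at h2

theorem valuationSubring_le_of_lt_one {F Z : Type} [Field F] [Field Z] [Algebra F Z]
    [Algebra.IsAlgebraic F Z]
    {O : ValuationSubring F} {V W : ValuationSubring Z} (hV : ∀ a, algebraMap F Z a ∈ V ↔ a ∈ O)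
    (hW : ∀ a, algebraMap F Z a ∈ W ↔ a ∈ O)
    (h : ∀ b, IsIntegral O b → W.valuation b < 1 → V.valuation b < 1) : V ≤ W := by
  intro x hx
  obtain ⟨b, hb, hbx, hb1⟩ := exists_isIntegral_mul_isIntegral hV hx (Algebra.IsAlgebraic.isAlgebraic x)
  have hbW := mem_valuationSubring_of_isIntegral hb (W := W) fun a ha => (hW a).mpr ha
  have hbxW := mem_valuationSubring_of_isIntegral hbx (W := W) fun a ha => (hW a).mpr ha
  have hb1' : W.valuation b = 1 := by
    refine le_antisymm ((W.valuation_le_one_iff _).mpr hbW) (not_lt.mp fun hlt => ?_)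
    exact (h b hb hlt).ne hb1
  rw [← W.valuation_le_one_iff] at hbxW ⊢
  rwa [map_mul, hb1', one_mul] at hbxW

theorem valuation_comap_lt_one {F Z : Type} [Field F] [Field Z] [Algebra F Z]
    {O : ValuationSubring F} {V : ValuationSubring Z} (hV : ∀ a, algebraMap F Z a ∈ V ↔ a ∈ O)
    (a : F) : V.valuation (algebraMap F Z a) < 1 ↔ O.valuation a < 1 := by
  rw [← ValuationSubring.mem_nonunits_iff, ← ValuationSubring.mem_nonunits_iff, ValuationSubring.mem_nonunits_iff_or, ValuationSubring.mem_nonunits_iff_or,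
    ← map_inv₀, hV, map_eq_zero]


theorem valuation_comap_le_iff {F Z : Type} [Field F] [Field Z] [Algebra F Z]
    {O : ValuationSubring F} {V : ValuationSubring Z} (hV : ∀ a, algebraMap F Z a ∈ V ↔ a ∈ O)
    (a b : F) : V.valuation (algebraMap F Z a) ≤ V.valuation (algebraMap F Z b) ↔
      O.valuation a ≤ O.valuation b := by
  rcases eq_or_ne b 0 with rfl | hb
  · simp
  · have h1 : O.valuation b ≠ 0 := (_root_.map_ne_zero _).mpr hb
    have h2 : V.valuation (algebraMap F Z b) ≠ 0 := (_root_.map_ne_zero _).mpr (by simpa using hb)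
    rw [← div_le_one₀ (zero_lt_iff.mpr h1), ← div_le_one₀ (zero_lt_iff.mpr h2), ← map_div₀,
      ← map_div₀, ← map_div₀, ValuationSubring.valuation_le_one_iff,
      ValuationSubring.valuation_le_one_iff, hV]

theorem valuation_comap_lt_iff {F Z : Type} [Field F] [Field Z] [Algebra F Z]
    {O : ValuationSubring F} {V : ValuationSubring Z} (hV : ∀ a, algebraMap F Z a ∈ V ↔ a ∈ O)
    (a b : F) : V.valuation (algebraMap F Z a) < V.valuation (algebraMap F Z b) ↔
      O.valuation a < O.valuation b := by
  rw [← not_le, ← not_le, valuation_comap_le_iff hV]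

theorem continuousSMul_galois {F Z : Type} [Field F] [Field Z] [Algebra F Z]
    [Algebra.IsAlgebraic F Z] {O : ValuationSubring F} [TopologicalSpace (integralClosure O Z)]
    [DiscreteTopology (integralClosure O Z)] : ContinuousSMul Gal(Z/F) (integralClosure O Z) := by
  rw [continuousSMul_iff_stabilizer_isOpen]
  intro x
  have : FiniteDimensional F (IntermediateField.adjoin F {(x : Z)}) :=
    IntermediateField.adjoin.finiteDimensional (Algebra.IsIntegral.isIntegral _)
  refine Subgroup.isOpen_mono (H₁ := (IntermediateField.adjoin F {(x : Z)}).fixingSubgroup) ?_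
    (IntermediateField.fixingSubgroup_isOpen _)
  intro g hg
  rw [MulAction.mem_stabilizer_iff]
  ext
  exact hg ⟨x, IntermediateField.mem_adjoin_simple_self F _⟩

/-- The centre of a valuation on an integral closure. -/
def centre {F Z : Type} [Field F] [Field Z] [Algebra F Z] (O : ValuationSubring F)
    (V : ValuationSubring Z) (hV : ∀ a, algebraMap F Z a ∈ V ↔ a ∈ O) :
    Ideal (integralClosure O Z) where
  carrier := {x | V.valuation (x : Z) < 1}
  zero_mem' := by simp
  add_mem' {x y} hx hy := lt_of_le_of_lt (V.valuation.map_add _ _) (max_lt hx hy)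
  smul_mem' c x hx := by
    have hc : V.valuation (c : Z) ≤ 1 := (V.valuation_le_one_iff _).mpr
      (mem_valuationSubring_of_isIntegral c.2 fun b hb => (hV b).mpr hb)
    change V.valuation ((c : Z) * (x : Z)) < 1
    rw [map_mul]
    exact mul_lt_one_of_nonneg_of_lt_one_right hc zero_le hx

theorem mem_centre {F Z : Type} [Field F] [Field Z] [Algebra F Z] {O : ValuationSubring F}
    {V : ValuationSubring Z} {hV : ∀ a, algebraMap F Z a ∈ V ↔ a ∈ O}
    {x : integralClosure O Z} : x ∈ centre O V hV ↔ V.valuation (x : Z) < 1 :=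
  Iff.rfl

instance {F Z : Type} [Field F] [Field Z] [Algebra F Z] (O : ValuationSubring F)
    (V : ValuationSubring Z) (hV : ∀ a, algebraMap F Z a ∈ V ↔ a ∈ O) :
    (centre O V hV).IsPrime where
  ne_top' h := by
    have := (Ideal.eq_top_iff_one _).mp h
    rw [mem_centre] at this
    simp at this
  mem_or_mem' {x y} hxy := by
    by_contra! h
    simp only [mem_centre, not_lt] at h hxy
    have : V.valuation ((x : Z) * (y : Z)) < 1 := hxy
    rw [map_mul] at this
    exact this.not_ge (one_le_mul_of_one_le_of_one_le h.1 h.2)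

theorem centre_under {F Z : Type} [Field F] [Field Z] [Algebra F Z] {O : ValuationSubring F}
    {V : ValuationSubring Z} (hV : ∀ a, algebraMap F Z a ∈ V ↔ a ∈ O) :
    (centre O V hV).under O = IsLocalRing.maximalIdeal O := by
  ext x
  rw [Ideal.under, Ideal.mem_comap, mem_centre, ValuationSubring.valuation_lt_one_iff,
    ← valuation_comap_lt_one hV]
  rfl

instance {F Z : Type} [Field F] [Field Z] [Algebra F Z] (O : ValuationSubring F)
    (V : ValuationSubring Z) (hV : ∀ a, algebraMap F Z a ∈ V ↔ a ∈ O) :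
    (centre O V hV).IsMaximal := by
  refine Ideal.isMaximal_of_isIntegral_of_isMaximal_comap (R := O) _ ?_
  have := centre_under hV
  rw [Ideal.under] at this
  rw [this]
  infer_instance

theorem eq_of_centre_eq {F Z : Type} [Field F] [Field Z] [Algebra F Z] [Algebra.IsAlgebraic F Z]
    {O : ValuationSubring F} {V W : ValuationSubring Z}
    {hV : ∀ a, algebraMap F Z a ∈ V ↔ a ∈ O} {hW : ∀ a, algebraMap F Z a ∈ W ↔ a ∈ O}
    (h : centre O V hV = centre O W hW) : V = W := by
  refine le_antisymm (valuationSubring_le_of_lt_one hV hW fun b hb => ?_)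
    (valuationSubring_le_of_lt_one hW hV fun b hb => ?_)
  · rw [← mem_centre (hV := hV) (x := ⟨b, hb⟩), ← mem_centre (hV := hW) (x := ⟨b, hb⟩), h]
    exact id
  · rw [← mem_centre (hV := hV) (x := ⟨b, hb⟩), ← mem_centre (hV := hW) (x := ⟨b, hb⟩), h]
    exact id

/-- Extensions of a valuation ring to a Galois extension are conjugate. -/
theorem exists_algEquiv_comap_eq {F Ω : Type} [Field F] [Field Ω] [Algebra F Ω] [IsGalois F Ω]
    {O : ValuationSubring F} {V W : ValuationSubring Ω}
    (hV : ∀ a, algebraMap F Ω a ∈ V ↔ a ∈ O) (hW : ∀ a, algebraMap F Ω a ∈ W ↔ a ∈ O) :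
    ∃ σ : Ω ≃ₐ[F] Ω, ∀ x, σ x ∈ V ↔ x ∈ W := by
  let _ : TopologicalSpace (integralClosure O Ω) := ⊥
  have : DiscreteTopology (integralClosure O Ω) := ⟨rfl⟩
  have := continuousSMul_galois (F := F) (Z := Ω) (O := O)
  have : Algebra.IsInvariant O (integralClosure O Ω) Gal(Ω/F) := by
    refine ⟨fun b hb => ?_⟩
    obtain ⟨y, hy⟩ := (InfiniteGalois.mem_range_algebraMap_iff_fixed (k := F) (K := Ω) b.1).mpr
      fun g => congrArg Subtype.val (hb g)
    have : IsIntegral O y := by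
      have h1 : IsIntegral O (algebraMap F Ω y) := hy ▸ b.2
      exact (isIntegral_algebraMap_iff (algebraMap F Ω).injective).mp h1
    obtain ⟨z, hz⟩ := IsIntegrallyClosed.isIntegral_iff.mp this
    refine ⟨z, Subtype.ext ?_⟩
    rw [← hy, ← hz]; rfl
  obtain ⟨g, hg⟩ := Algebra.IsInvariant.exists_smul_of_under_eq_of_profinite (A := O)
    (G := Gal(Ω/F)) (centre O V hV) (centre O W hW) (by rw [centre_under, centre_under])
  let V' : ValuationSubring Ω := V.comap ((g⁻¹ : Ω ≃ₐ[F] Ω) : Ω →+* Ω)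
  have hVV' : ∀ x, x ∈ V' ↔ (g⁻¹ : Ω ≃ₐ[F] Ω) x ∈ V := fun x => Iff.rfl
  have hV' : ∀ a, algebraMap F Ω a ∈ V' ↔ a ∈ O := by
    intro a
    rw [hVV', ← hV]
    simp
  have : V' = W := by
    refine eq_of_centre_eq (hV := hV') (hW := hW) ?_
    ext x
    rw [hg, Ideal.mem_pointwise_smul_iff_inv_smul_mem, mem_centre, mem_centre]
    simp only [← ValuationSubring.mem_nonunits_iff, ValuationSubring.mem_nonunits_iff_or, hVV']
    have : ((g⁻¹ • x : integralClosure O Ω) : Ω) = g⁻¹ (x : Ω) := rfl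
    rw [this, map_inv₀, map_eq_zero]
  refine ⟨g⁻¹, fun x => ?_⟩
  rw [← hVV', this]

theorem isGalois_of_isAlgClosed (F Ω : Type) [Field F] [Field Ω] [CharZero F] [Algebra F Ω]
    [Algebra.IsAlgebraic F Ω] [IsAlgClosed Ω] : IsGalois F Ω := by
  have : IsAlgClosure F Ω := ⟨inferInstance, inferInstance⟩
  have : Normal F Ω := IsAlgClosure.normal F Ω
  exact ⟨⟩

open Classical in
theorem exists_mem_adjoin_separating {F Ω : Type} [Field F] [Field Ω] [CharZero F] [Algebra F Ω]
    [Algebra.IsAlgebraic F Ω] [IsAlgClosed Ω] (V : ValuationSubring Ω) (a : Ω)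
    (ha : ∀ σ : Ω ≃ₐ[F] Ω, (∀ x, σ x ∈ V ↔ x ∈ V) → σ a = a) :
    ∃ b : F⟮a⟯, V.valuation ((b : Ω) - 1) < 1 ∧
      ∀ τ : F⟮a⟯ →ₐ[F] Ω, τ ≠ F⟮a⟯.val → V.valuation (τ b) < 1 := by
  have hfin : FiniteDimensional F F⟮a⟯ :=
    IntermediateField.adjoin.finiteDimensional (Algebra.IsIntegral.isIntegral _)
  let O : ValuationSubring F := V.comap (algebraMap F Ω)
  let W : (F⟮a⟯ →ₐ[F] Ω) → ValuationSubring F⟮a⟯ := fun τ => V.comap (τ : F⟮a⟯ →+* Ω)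
  have hW : ∀ τ, ∀ c, algebraMap F F⟮a⟯ c ∈ W τ ↔ c ∈ O := by
    intro τ c
    change τ (algebraMap F F⟮a⟯ c) ∈ V ↔ algebraMap F Ω c ∈ V
    rw [AlgHom.commutes]
  have hval : ∀ (τ : F⟮a⟯ →ₐ[F] Ω) (x : F⟮a⟯), (W τ).valuation x < 1 ↔ V.valuation (τ x) < 1 := by
    intro τ x
    rw [← ValuationSubring.mem_nonunits_iff, ← ValuationSubring.mem_nonunits_iff,
      ValuationSubring.mem_nonunits_iff_or, ValuationSubring.mem_nonunits_iff_or, ← map_inv₀,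
      _root_.map_eq_zero]
    rfl
  let M : (F⟮a⟯ →ₐ[F] Ω) → Ideal (integralClosure O F⟮a⟯) := fun τ => centre O (W τ) (hW τ)
  have hne : ∀ τ, τ ≠ F⟮a⟯.val → M F⟮a⟯.val ≠ M τ := by
    intro τ hτ heq
    have hWW := eq_of_centre_eq heq
    apply hτ
    have : Algebra.IsAlgebraic F⟮a⟯ Ω := Algebra.IsAlgebraic.tower_top (K := F) _
    have := isGalois_of_isAlgClosed F⟮a⟯ Ω
    obtain ⟨σ, hσ⟩ := IsAlgClosed.surjective_domRestrict_of_isAlgebraic (K := F)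
      (L := F⟮a⟯) (M := Ω) (E := Ω) τ
    have hσb := Algebra.IsAlgebraic.algHom_bijective σ
    let σ' : Ω ≃ₐ[F] Ω := AlgEquiv.ofBijective σ hσb
    have hσz : ∀ z : F⟮a⟯, σ' z = τ z := fun z => by rw [← hσ]; rfl
    let V' : ValuationSubring Ω := V.comap (σ' : Ω →+* Ω)
    have h1 : ∀ z : F⟮a⟯, algebraMap F⟮a⟯ Ω z ∈ V' ↔ z ∈ W F⟮a⟯.val := by
      intro z
      rw [hWW]
      change σ' z ∈ V ↔ τ z ∈ V
      rw [hσz]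
    obtain ⟨ρ, hρ⟩ := exists_algEquiv_comap_eq (F := F⟮a⟯) (O := W F⟮a⟯.val) (V := V) (W := V')
      (fun z => Iff.rfl) h1
    have h2 := ha (σ'.symm.trans (ρ.restrictScalars F)) fun x => by
      change ρ (σ'.symm x) ∈ V ↔ _
      rw [hρ]
      change σ' (σ'.symm x) ∈ V ↔ _
      rw [AlgEquiv.apply_symm_apply]
    have h3 : ρ (σ'.symm a) = a := h2
    have h4 : ρ a = a := ρ.commutes ⟨a, IntermediateField.mem_adjoin_simple_self F a⟩
    have h5 : σ'.symm a = a := ρ.injective (h3.trans h4.symm)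
    have h6 : σ' a = a := by rw [AlgEquiv.symm_apply_eq] at h5; exact h5.symm
    refine IntermediateField.algHom_ext_of_eq_adjoin F (S := F⟮a⟯) (s := {a}) rfl ?_
    intro x hx
    obtain rfl : x = a := hx
    exact (hσz _).symm.trans h6
  have hcop : M F⟮a⟯.val ⊔ ⨅ τ ∈ Finset.univ.erase F⟮a⟯.val, M τ = ⊤ := by
    refine Ideal.sup_iInf_eq_top fun τ hτ => ?_
    have : (M F⟮a⟯.val).IsMaximal := inferInstanceAs (centre _ _ _).IsMaximal
    have : (M τ).IsMaximal := inferInstanceAs (centre _ _ _).IsMaximal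
    exact Ideal.IsMaximal.coprime_of_ne ‹_› ‹_› (hne τ (Finset.ne_of_mem_erase hτ))
  obtain ⟨x, hx, y, hy, hxy⟩ := Submodule.mem_sup.mp ((Ideal.eq_top_iff_one _).mp hcop)
  refine ⟨y, ?_, fun τ hτ => ?_⟩
  · have h1 : ((y : F⟮a⟯) : Ω) - 1 = -F⟮a⟯.val (x : F⟮a⟯) := by
      have : (x : F⟮a⟯) + (y : F⟮a⟯) = 1 := congrArg Subtype.val hxy
      have h2 : (((x : F⟮a⟯) + (y : F⟮a⟯) : F⟮a⟯) : Ω) = 1 := by rw [this]; rfl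
      rw [IntermediateField.coe_add] at h2
      rw [← h2]
      simp
    rw [h1, Valuation.map_neg, ← hval]
    exact hx
  · simp only [Finset.mem_erase, Finset.mem_univ, and_true, Submodule.mem_iInf] at hy
    rw [← hval]
    exact hy τ hτ

section NearOne

variable {Ω Γ : Type} [Field Ω] [LinearOrderedCommGroupWithZero Γ] {v : Valuation Ω Γ} {γ : Γ}

theorem Valuation.eq_one_of_sub_one_lt {u : Ω} (hu : v (u - 1) < 1) : v u = 1 := by
  have := v.map_add_eq_of_lt_right (x := u - 1) (y := 1) (by simpa using hu)
  simpa using this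

theorem Valuation.mul_sub_one_lt (hγ : γ ≤ 1) {u w : Ω} (hu : v (u - 1) < γ) (hw : v (w - 1) < γ) :
    v (u * w - 1) < γ := by
  have : u * w - 1 = u * (w - 1) + (u - 1) := by ring
  rw [this]
  refine lt_of_le_of_lt (v.map_add _ _) (max_lt ?_ hu)
  rwa [map_mul, Valuation.eq_one_of_sub_one_lt (hu.trans_le hγ), one_mul]

theorem Valuation.inv_sub_one_lt (hγ : γ ≤ 1) {u : Ω} (hu : v (u - 1) < γ) :
    v (u⁻¹ - 1) < γ := by
  have h1 := Valuation.eq_one_of_sub_one_lt (hu.trans_le hγ)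
  have h0 : u ≠ 0 := by rintro rfl; simp at h1
  have : u⁻¹ - 1 = - (u⁻¹ * (u - 1)) := by field_simp; ring
  rwa [this, Valuation.map_neg, map_mul, map_inv₀, h1, inv_one, one_mul]

theorem Valuation.div_sub_one_lt (hγ : γ ≤ 1) {u w : Ω} (hu : v (u - 1) < γ)
    (hw : v (w - 1) < γ) : v (u / w - 1) < γ := by
  rw [div_eq_mul_inv]
  exact Valuation.mul_sub_one_lt hγ hu (Valuation.inv_sub_one_lt hγ hw)

theorem Valuation.pow_sub_one_lt (hγ : γ ≤ 1) {u : Ω} (hu : v (u - 1) < γ) (n : ℕ) :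
    v (u ^ n - 1) < γ := by
  induction n with
  | zero => simpa using lt_of_le_of_lt zero_le hu
  | succ n ih => rw [pow_succ]; exact Valuation.mul_sub_one_lt hγ ih hu

theorem Valuation.div_sub_one_lt_iff {x y : Ω} (hy : y ≠ 0) :
    v (x / y - 1) < γ ↔ v (x - y) < γ * v y := by
  have : x - y = (x / y - 1) * y := by field_simp
  rw [this, map_mul, mul_lt_mul_iff_left₀ (zero_lt_iff.mpr ((_root_.map_ne_zero v).mpr hy))]

end NearOne

section Dominant

variable {Ω Γ ι : Type} [Field Ω] [LinearOrderedCommGroupWithZero Γ] (v : Valuation Ω Γ)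

theorem pow_card_lt_prod (s : Finset ι) (hs : s.Nonempty) (f : ι → Γ) (m : Γ)
    (h : ∀ i ∈ s, m < f i) : m ^ s.card < ∏ i ∈ s, f i := by
  induction hs using Finset.Nonempty.cons_induction with
  | singleton a => simpa using h
  | cons a s ha hs ih =>
    rw [Finset.card_cons, Finset.prod_cons, pow_succ, mul_comm]
    exact mul_lt_mul'' (h _ (by simp)) (ih fun i hi => h i (by simp [hi])) zero_le zero_le

theorem prod_lt_prod_of_dominant [DecidableEq ι] (c : ι → Γ) {B S : Finset ι}
    (hB : ∀ x ∈ B, ∀ y ∉ B, c y < c x) (hcard : S.card = B.card) (hne : S ≠ B) :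
    ∏ i ∈ S, c i < ∏ i ∈ B, c i := by
  have hsd : (S \ B).card = (B \ S).card := Finset.card_sdiff_comm hcard
  have hSB : (S \ B).Nonempty := by
    rw [Finset.sdiff_nonempty]
    exact fun h => hne (Finset.eq_of_subset_of_card_le h hcard.ge)
  have hBS : (B \ S).Nonempty := by rw [← Finset.card_pos, ← hsd]; exact Finset.card_pos.mpr hSB
  obtain ⟨y, hy, hmax⟩ := Finset.exists_max_image (S \ B) c hSB
  have h1 : ∏ i ∈ S \ B, c i ≤ c y ^ (S \ B).card := Finset.prod_le_pow_card _ _ _ hmax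
  have h2 : c y ^ (B \ S).card < ∏ i ∈ B \ S, c i := pow_card_lt_prod _ hBS _ _ fun i hi =>
    hB i (Finset.mem_sdiff.mp hi).1 y (Finset.mem_sdiff.mp hy).2
  rw [hsd] at h1
  have h3 : ∏ i ∈ B ∩ S, c i ≠ 0 := Finset.prod_ne_zero_iff.mpr fun i hi =>
    (lt_of_le_of_lt zero_le (hB i (Finset.mem_inter.mp hi).1 y (Finset.mem_sdiff.mp hy).2)).ne'
  rw [← Finset.prod_inter_mul_prod_sdiff S B, ← Finset.prod_inter_mul_prod_sdiff B S,
    Finset.inter_comm S B]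
  exact mul_lt_mul_of_pos_left (h1.trans_lt h2) (zero_lt_iff.mpr h3)

theorem esymm_sub_prod_lt [Fintype ι] [DecidableEq ι] (c : ι → Ω) {B : Finset ι}
    (hB : ∀ x ∈ B, ∀ y ∉ B, v (c y) < v (c x)) (hB0 : ∀ x ∈ B, c x ≠ 0) :
    v (∑ S ∈ Finset.powersetCard B.card Finset.univ, ∏ i ∈ S, c i - ∏ i ∈ B, c i) <
      v (∏ i ∈ B, c i) := by
  have hmem : B ∈ Finset.powersetCard B.card (Finset.univ : Finset ι) := by simp
  rw [← Finset.add_sum_erase _ _ hmem, add_sub_cancel_left]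
  refine v.map_sum_lt ?_ fun S hS => ?_
  · exact (_root_.map_ne_zero v).mpr (Finset.prod_ne_zero_iff.mpr hB0)
  · rw [Finset.mem_erase, Finset.mem_powersetCard] at hS
    rw [map_prod, map_prod]
    exact prod_lt_prod_of_dominant (fun i => v (c i)) hB hS.2.2 hS.1

end Dominant

theorem esymm_mem_range {F Ω ι : Type} [Field F] [Field Ω] [Algebra F Ω] [IsGalois F Ω]
    [Fintype ι] (c : ι → Ω) (hc : ∀ σ : Ω ≃ₐ[F] Ω, ∃ e : ι ≃ ι, ∀ i, σ (c i) = c (e i)) (k : ℕ) :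
    ∃ a : F, algebraMap F Ω a = ∑ S ∈ Finset.powersetCard k Finset.univ, ∏ i ∈ S, c i := by
  refine (InfiniteGalois.mem_range_algebraMap_iff_fixed _).mpr fun σ => ?_
  obtain ⟨e, he⟩ := hc σ
  have h := congrArg (MvPolynomial.aeval c) (MvPolynomial.rename_esymm ι ℤ k e)
  rw [MvPolynomial.aeval_rename] at h
  simp only [MvPolynomial.esymm, map_sum, map_prod, MvPolynomial.aeval_X, Function.comp] at h
  rw [map_sum, ← h]
  exact Finset.sum_congr rfl fun S _ => by rw [map_prod]; exact Finset.prod_congr rfl fun i _ => he i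

/-- The decomposition field of a valuation is an immediate extension. -/
theorem exists_sub_lt_of_fixed {F Ω : Type} [Field F] [Field Ω] [CharZero F] [Algebra F Ω]
    [Algebra.IsAlgebraic F Ω] [IsAlgClosed Ω] (V : ValuationSubring Ω) {a : Ω} (ha0 : a ≠ 0)
    (ha : ∀ σ : Ω ≃ₐ[F] Ω, (∀ x, σ x ∈ V ↔ x ∈ V) → σ a = a) :
    ∃ c : F, V.valuation (algebraMap F Ω c - a) < V.valuation a := by
  classical
  have hfin : FiniteDimensional F F⟮a⟯ :=
    IntermediateField.adjoin.finiteDimensional (Algebra.IsIntegral.isIntegral _)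
  have := isGalois_of_isAlgClosed F Ω
  obtain ⟨b, hb1, hb⟩ := exists_mem_adjoin_separating V a ha
  set v := V.valuation
  let z : F⟮a⟯ := ⟨a, IntermediateField.mem_adjoin_simple_self F a⟩
  obtain ⟨t, ht⟩ : ∃ t : ℕ, ∀ τ : F⟮a⟯ →ₐ[F] Ω, τ ≠ F⟮a⟯.val → v (τ (z * b ^ t)) ≠ v a := by
    let bad : (F⟮a⟯ →ₐ[F] Ω) → Set ℕ := fun τ => {t | 0 < t ∧ τ ≠ F⟮a⟯.val ∧ v (τ (z * b ^ t)) = v a}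
    have hbad : (⋃ τ, bad τ).Finite := by
      refine Set.finite_iUnion fun τ => Set.Subsingleton.finite ?_
      rintro s ⟨hs0, hτ, hs⟩ t ⟨ht0, -, ht⟩
      rw [map_mul, map_mul, map_pow, map_pow] at hs ht
      have hva : v a ≠ 0 := (_root_.map_ne_zero v).mpr ha0
      have h0 : v (τ z) ≠ 0 := fun h => by rw [h, zero_mul] at hs; exact hva hs.symm
      have hb0 : v (τ b) ≠ 0 := fun h => by
        rw [h, zero_pow hs0.ne', mul_zero] at hs; exact hva hs.symm
      have h2 := mul_left_cancel₀ h0 (hs.trans ht.symm)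
      exact pow_right_injective₀ (zero_lt_iff.mpr hb0) (hb τ hτ).ne h2
    obtain ⟨t, ht⟩ := (hbad.union (Set.finite_singleton 0)).exists_notMem
    rw [Set.mem_union, not_or, Set.mem_iUnion, not_exists] at ht
    exact ⟨t, fun τ hτ h => ht.1 τ ⟨Nat.pos_of_ne_zero ht.2, hτ, h⟩⟩
  let c : (F⟮a⟯ →ₐ[F] Ω) → Ω := fun τ => τ (z * b ^ t)
  let i₁ : F⟮a⟯ →ₐ[F] Ω := F⟮a⟯.val
  have hc1 : c i₁ = a * (b : Ω) ^ t := by simp [c, i₁, z]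
  have hbt : v ((b : Ω) ^ t - 1) < 1 := Valuation.pow_sub_one_lt le_rfl hb1 t
  have hvc1 : v (c i₁) = v a := by
    rw [hc1, map_mul, Valuation.eq_one_of_sub_one_lt hbt, mul_one]
  have hc10 : c i₁ ≠ 0 := fun h => by
    rw [h, map_zero] at hvc1; exact ha0 ((_root_.map_eq_zero v).mp hvc1.symm)
  let B : Finset (F⟮a⟯ →ₐ[F] Ω) := Finset.univ.filter fun τ => v a < v (c τ)
  have hi₁ : i₁ ∉ B := by simp [B, hvc1]
  have hB0 : ∀ x ∈ insert i₁ B, c x ≠ 0 := by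
    intro x hx
    rcases Finset.mem_insert.mp hx with rfl | hx
    · exact hc10
    · intro h
      simp [B, h] at hx
  have h1 := esymm_sub_prod_lt v c (B := B) (fun x hx y hy => by
    simp only [B, Finset.mem_filter, Finset.mem_univ, true_and, not_lt] at hx hy
    exact hy.trans_lt hx) fun x hx => hB0 x (Finset.mem_insert_of_mem hx)
  have h2 := esymm_sub_prod_lt v c (B := insert i₁ B) (fun x hx y hy => by
    rw [Finset.mem_insert, not_or] at hy
    have hy' : v (c y) < v a := lt_of_le_of_ne (by simpa [B] using hy.2) (ht y hy.1)
    rcases Finset.mem_insert.mp hx with rfl | hx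
    · rwa [hvc1]
    · exact hy'.trans (by simpa [B] using hx)) hB0
  rw [Finset.card_insert_of_notMem hi₁, Finset.prod_insert hi₁] at h2
  have hperm : ∀ σ : Ω ≃ₐ[F] Ω, ∃ e : (F⟮a⟯ →ₐ[F] Ω) ≃ (F⟮a⟯ →ₐ[F] Ω), ∀ i, σ (c i) = c (e i) :=
    fun σ => ⟨⟨fun τ => σ.toAlgHom.comp τ, fun τ => σ.symm.toAlgHom.comp τ,
      fun τ => by ext; simp, fun τ => by ext; simp⟩, fun τ => rfl⟩
  obtain ⟨e, he⟩ := esymm_mem_range (F := F) c hperm B.card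
  obtain ⟨e', he'⟩ := esymm_mem_range (F := F) c hperm (B.card + 1)
  rw [← he] at h1
  rw [← he'] at h2
  have hP : ∏ i ∈ B, c i ≠ 0 := Finset.prod_ne_zero_iff.mpr fun x hx =>
    hB0 x (Finset.mem_insert_of_mem hx)
  rw [← one_mul (v (∏ i ∈ B, c i)), ← Valuation.div_sub_one_lt_iff hP] at h1
  rw [← one_mul (v (c i₁ * ∏ i ∈ B, c i)), ← Valuation.div_sub_one_lt_iff (mul_ne_zero hc10 hP)] at h2
  refine ⟨e' / e, ?_⟩
  rw [← one_mul (v a), ← Valuation.div_sub_one_lt_iff ha0]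
  have h3 := Valuation.mul_sub_one_lt le_rfl (Valuation.div_sub_one_lt le_rfl h2 h1) hbt
  have he0 : algebraMap F Ω e ≠ 0 := by
    intro h
    rw [h, zero_div, zero_sub, Valuation.map_neg, map_one] at h1
    exact h1.false
  convert h3 using 3
  rw [map_div₀]
  have hbt0 : (b : Ω) ^ t ≠ 0 := fun h => by rw [hc1, h, mul_zero] at hc10; exact hc10 rfl
  rw [hc1]
  field_simp

/-- Polynomials with residue `X ^ (d + 1) - X ^ d` have a root. -/
def HenselRoot {F : Type} [Field F] (O : ValuationSubring F) : Prop :=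
  ∀ (d : ℕ) (g : F[X]), g.natDegree ≤ d + 1 → (∀ i, O.valuation (g.coeff i) < 1) →
    ∃ x, eval x (X ^ (d + 1) - X ^ d + g) = 0

/-- The valuation ring is stable under all automorphisms over `F`. -/
def GaloisStable (F : Type) {Ω : Type} [Field F] [Field Ω] [Algebra F Ω]
    (V : ValuationSubring Ω) : Prop :=
  ∀ (σ : Ω ≃ₐ[F] Ω) (x : Ω), σ x ∈ V ↔ x ∈ V

theorem GaloisStable.valuation_le {F Ω : Type} [Field F] [Field Ω] [Algebra F Ω]
    {V : ValuationSubring Ω} (h : GaloisStable F V) (σ : Ω ≃ₐ[F] Ω) (x y : Ω) :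
    V.valuation (σ x) ≤ V.valuation (σ y) ↔ V.valuation x ≤ V.valuation y := by
  rcases eq_or_ne y 0 with rfl | hy
  · simp
  · have h1 : V.valuation y ≠ 0 := (_root_.map_ne_zero _).mpr hy
    have h2 : V.valuation (σ y) ≠ 0 := (_root_.map_ne_zero _).mpr (by simpa using hy)
    rw [← div_le_one₀ (zero_lt_iff.mpr h1), ← div_le_one₀ (zero_lt_iff.mpr h2), ← map_div₀,
      ← map_div₀, ← map_div₀, ValuationSubring.valuation_le_one_iff,
      ValuationSubring.valuation_le_one_iff, h σ]

theorem GaloisStable.valuation_lt {F Ω : Type} [Field F] [Field Ω] [Algebra F Ω]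
    {V : ValuationSubring Ω} (h : GaloisStable F V) (σ : Ω ≃ₐ[F] Ω) (x y : Ω) :
    V.valuation (σ x) < V.valuation (σ y) ↔ V.valuation x < V.valuation y := by
  rw [← not_le, ← not_le, h.valuation_le]

open Classical in
theorem GaloisStable.valuation_eq {F Ω : Type} [Field F] [Field Ω]
    [Algebra F Ω] [Algebra.IsAlgebraic F Ω]
    {V : ValuationSubring Ω} (h : GaloisStable F V) (σ : Ω ≃ₐ[F] Ω) (x : Ω) :
    V.valuation (σ x) = V.valuation x := by
  have key : ∀ (σ : Ω ≃ₐ[F] Ω), ∀ x, V.valuation (σ x) ≤ V.valuation x := by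
    intro σ x
    by_contra! hlt
    have hmono : ∀ n : ℕ, V.valuation x < V.valuation ((σ ^ (n + 1)) x) := by
      intro n
      induction n with
      | zero => simpa using hlt
      | succ n ih =>
        refine hlt.trans ?_
        rw [pow_succ' σ (n + 1), AlgEquiv.mul_apply]
        exact (h.valuation_lt σ _ _).mpr ih
    obtain ⟨n, hn0, hn⟩ : ∃ n : ℕ, n ≠ 0 ∧ (σ ^ n) x = x := by
      have hfin : (Set.range fun n : ℕ => (σ ^ n) x).Finite := by
        refine Set.Finite.subset (((minpoly F x).aroots Ω).toFinset.finite_toSet) ?_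
        rintro _ ⟨n, rfl⟩
        simp only [Multiset.mem_toFinset, Finset.mem_coe]
        rw [mem_aroots]
        refine ⟨minpoly.ne_zero (Algebra.IsIntegral.isIntegral x), ?_⟩
        rw [Polynomial.aeval_algHom_apply (σ ^ n) x, minpoly.aeval, map_zero]
      obtain ⟨m, n, hmn, hne⟩ : ∃ m n : ℕ, m < n ∧ (σ ^ m) x = (σ ^ n) x := by
        by_contra! hcon
        refine Set.infinite_range_of_injective (f := fun n : ℕ => (σ ^ n) x) ?_ hfin
        intro m n hmn
        rcases lt_trichotomy m n with h | h | h
        · exact (hcon m n h hmn).elim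
        · exact h
        · exact (hcon n m h hmn.symm).elim
      refine ⟨n - m, by omega, ?_⟩
      apply (σ ^ m).injective
      rw [← AlgEquiv.mul_apply, ← pow_add, Nat.add_sub_cancel' hmn.le, hne]
    obtain ⟨n, rfl⟩ := Nat.exists_eq_succ_of_ne_zero hn0
    have := hmono n
    rw [hn] at this
    exact this.false
  refine le_antisymm (key σ x) ?_
  have := key σ.symm (σ x)
  rwa [AlgEquiv.symm_apply_apply] at this

theorem continuousSMul_of_discrete (F Z : Type) [Field F] [Field Z] [Algebra F Z]
    [Algebra.IsAlgebraic F Z] [TopologicalSpace Z]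
    [DiscreteTopology Z] : ContinuousSMul Gal(Z/F) Z := by
  rw [continuousSMul_iff_stabilizer_isOpen]
  intro x
  have : FiniteDimensional F F⟮x⟯ :=
    IntermediateField.adjoin.finiteDimensional (Algebra.IsIntegral.isIntegral _)
  refine Subgroup.isOpen_mono (H₁ := F⟮x⟯.fixingSubgroup) ?_
    (IntermediateField.fixingSubgroup_isOpen _)
  intro g hg
  exact hg ⟨x, IntermediateField.mem_adjoin_simple_self F _⟩

theorem valuation_pow_sub_pow_le {Ω : Type} [Field Ω] {V : ValuationSubring Ω} {r s : Ω}
    (hr : r ∈ V) (hs : s ∈ V) (n : ℕ) : V.valuation (r ^ n - s ^ n) ≤ V.valuation (r - s) := by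
  obtain ⟨c, hc⟩ := sub_dvd_pow_sub_pow (⟨r, hr⟩ : V) ⟨s, hs⟩ n
  have hc' : r ^ n - s ^ n = (r - s) * c := congrArg Subtype.val hc
  rw [hc', map_mul]
  exact mul_le_of_le_one_right zero_le (V.valuation_le_one c)

theorem natDegree_X_pow_succ_sub_X_pow_le {F : Type} [Field F] (d : ℕ) :
    (X ^ (d + 1) - X ^ d : F[X]).natDegree ≤ d + 1 :=
  (natDegree_sub_le _ _).trans (max_le (natDegree_X_pow_le _)
    ((natDegree_X_pow_le _).trans (Nat.le_succ d)))

theorem henselRoot_of_galoisStable {F Ω : Type} [Field F] [Field Ω] [CharZero F] [Algebra F Ω]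
    [Algebra.IsAlgebraic F Ω] [IsAlgClosed Ω] {V : ValuationSubring Ω} {O : ValuationSubring F}
    (hV : ∀ a, algebraMap F Ω a ∈ V ↔ a ∈ O)
    (h : GaloisStable F V) : HenselRoot O := by
  intro d g hgd hg
  have := isGalois_of_isAlgClosed F Ω
  set v := V.valuation with hv
  set f : F[X] := X ^ (d + 1) - X ^ d + g with hf
  have hgv : ∀ i, v (algebraMap F Ω (g.coeff i)) < 1 := fun i =>
    (valuation_comap_lt_one hV _).mpr (hg i)
  have haev : ∀ x : Ω, aeval x f = x ^ (d + 1) - x ^ d + aeval x g := fun x => by simp [hf]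
  have hlead : v (algebraMap F Ω (f.coeff (d + 1)) - 1) < 1 := by
    have : f.coeff (d + 1) = 1 + g.coeff (d + 1) := by
      simp [hf, coeff_X_pow]
    rw [this, map_add, map_one, add_sub_cancel_left]
    exact hgv _
  have hdeg : f.natDegree = d + 1 := by
    refine natDegree_eq_of_le_of_coeff_ne_zero ?_ fun h0 => ?_
    · exact natDegree_add_le_of_degree_le (natDegree_X_pow_succ_sub_X_pow_le d) hgd
    · rw [h0, map_zero, zero_sub, Valuation.map_neg, map_one] at hlead
      exact hlead.false
  -- a root close to `1`
  obtain ⟨r, hr, hr1⟩ : ∃ r : Ω, aeval r f = 0 ∧ v (r - 1) < 1 := by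
    have hsplit := IsAlgClosed.splits (f.map (algebraMap F Ω))
    have hprod := hsplit.eval_eq_prod_roots 1
    have hone : v (eval 1 (f.map (algebraMap F Ω))) < 1 := by
      rw [eval_map_algebraMap, haev, one_pow, one_pow, sub_self, zero_add, aeval_eq_sum_range]
      refine v.map_sum_lt one_ne_zero fun i _ => ?_
      rw [one_pow, Algebra.smul_def, mul_one]
      exact hgv i
    by_contra! hcon
    have hge : 1 ≤ v (((f.map (algebraMap F Ω)).roots.map fun a => 1 - a).prod) := by
      rw [map_multiset_prod, Multiset.map_map]
      refine Multiset.one_le_prod fun x hx => ?_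
      obtain ⟨r, hr, rfl⟩ := Multiset.mem_map.mp hx
      have hr0 : aeval r f = 0 := by
        rw [← eval_map_algebraMap]; exact (mem_roots'.mp hr).2
      simp only [Function.comp]
      rw [Valuation.map_sub_swap]
      exact hcon r hr0
    rw [hprod, map_mul, leadingCoeff_map, leadingCoeff, hdeg,
      Valuation.eq_one_of_sub_one_lt hlead, one_mul] at hone
    exact hone.not_ge hge
  have hmem : ∀ x : Ω, v (x - 1) < 1 → x ∈ V := fun x hx => by
    rw [← V.valuation_le_one_iff, ← hv, Valuation.eq_one_of_sub_one_lt hx]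
  have huniq : ∀ s : Ω, aeval s f = 0 → v (s - 1) < 1 → s = r := by
    intro s hs hs1
    by_contra hne
    have h0 : (s - r) = -(s ^ d - 1) * (s - r) - (s ^ d - r ^ d) * (r - 1)
        - (aeval s g - aeval r g) := by
      have h1 := haev s
      have h2 := haev r
      rw [hs] at h1
      rw [hr] at h2
      linear_combination h2 - h1
    have hpos : v (s - r) ≠ 0 := (_root_.map_ne_zero v).mpr (sub_ne_zero.mpr hne)
    have hpos' := zero_lt_iff.mpr hpos
    have hlt : v (s - r) < v (s - r) := by
      conv_lhs => rw [h0]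
      refine lt_of_le_of_lt (v.map_sub _ _) (max_lt (lt_of_le_of_lt (v.map_sub _ _) (max_lt ?_ ?_)) ?_)
      · rw [map_mul, Valuation.map_neg]
        exact mul_lt_of_lt_one_left hpos' (Valuation.pow_sub_one_lt le_rfl hs1 d)
      · rw [map_mul]
        refine lt_of_le_of_lt (mul_le_mul_left (valuation_pow_sub_pow_le (hmem s hs1) (hmem r hr1) d) _) ?_
        exact mul_lt_of_lt_one_right hpos' hr1
      · rw [aeval_eq_sum_range, aeval_eq_sum_range, ← Finset.sum_sub_distrib]
        refine v.map_sum_lt hpos fun i _ => ?_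
        rw [← smul_sub, Algebra.smul_def, map_mul]
        refine lt_of_le_of_lt (mul_le_mul_right (valuation_pow_sub_pow_le (hmem s hs1) (hmem r hr1) i) _) ?_
        exact mul_lt_of_lt_one_left hpos' (hgv i)
    exact hlt.false
  obtain ⟨x, rfl⟩ := (InfiniteGalois.mem_range_algebraMap_iff_fixed (k := F) r).mpr fun σ => by
    refine huniq _ ?_ ?_
    · rw [Polynomial.aeval_algHom_apply σ r, hr, map_zero]
    · have : σ r - 1 = σ (r - 1) := by simp
      rw [this, ← map_one v, ← map_one σ]
      exact (h.valuation_lt σ _ _).mpr (by simpa using hr1)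
  refine ⟨x, ?_⟩
  rw [aeval_algebraMap_apply, ← map_zero (algebraMap F Ω)] at hr
  exact (algebraMap F Ω).injective hr

theorem galoisStable_of_fixed {F Ω : Type} [Field F] [Field Ω] [CharZero F] [Algebra F Ω]
    [Algebra.IsAlgebraic F Ω] [IsAlgClosed Ω] {V : ValuationSubring Ω}
    (h : ∀ a : Ω, (∀ σ : Ω ≃ₐ[F] Ω, (∀ x, σ x ∈ V ↔ x ∈ V) → σ a = a) →
      a ∈ Set.range (algebraMap F Ω)) : GaloisStable F V := by
  have := isGalois_of_isAlgClosed F Ω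
  let _ : TopologicalSpace Ω := ⊥
  have : DiscreteTopology Ω := ⟨rfl⟩
  have := continuousSMul_of_discrete F Ω
  let D : ClosedSubgroup Gal(Ω/F) :=
    { carrier := {σ | ∀ x, σ x ∈ V ↔ x ∈ V}
      mul_mem' := fun {a b} ha hb x => by rw [AlgEquiv.mul_apply, ha, hb]
      one_mem' := fun x => Iff.rfl
      inv_mem' := fun {a} ha x => by
        rw [← ha, ← AlgEquiv.mul_apply, mul_inv_cancel]; rfl
      isClosed' := by
        rw [Set.ofPred_forall]
        refine isClosed_iInter fun x => ?_
        exact (isClosed_discrete {y : Ω | y ∈ V ↔ x ∈ V}).preimage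
          (continuous_id.smul continuous_const) }
  have hbot : IntermediateField.fixedField D.1 = ⊥ := by
    rw [eq_bot_iff]
    intro a ha
    rw [IntermediateField.mem_bot]
    exact h a fun σ hσ => ha ⟨σ, hσ⟩
  have htop : D.1 = ⊤ := by
    have := InfiniteGalois.fixingSubgroup_fixedField D
    rw [hbot, IntermediateField.fixingSubgroup_bot] at this
    exact this.symm
  intro σ
  have : σ ∈ D.1 := htop ▸ Subgroup.mem_top σ
  exact this

theorem galoisStable_of_henselRoot {F Ω : Type} [Field F] [Field Ω] [CharZero F] [Algebra F Ω]
    [Algebra.IsAlgebraic F Ω] [IsAlgClosed Ω] {V : ValuationSubring Ω} {O : ValuationSubring F}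
    (hV : ∀ a, algebraMap F Ω a ∈ V ↔ a ∈ O)
    (h : HenselRoot O) : GaloisStable F V := by
  classical
  have := isGalois_of_isAlgClosed F Ω
  refine galoisStable_of_fixed fun a ha => ?_
  have hfin : FiniteDimensional F F⟮a⟯ :=
    IntermediateField.adjoin.finiteDimensional (Algebra.IsIntegral.isIntegral _)
  obtain ⟨b, hb1, hb⟩ := exists_mem_adjoin_separating V a ha
  set v := V.valuation with hv
  let i₁ : F⟮a⟯ →ₐ[F] Ω := F⟮a⟯.val
  have hbV : ∀ τ : F⟮a⟯ →ₐ[F] Ω, τ b ∈ V := by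
    intro τ
    rw [← V.valuation_le_one_iff]
    by_cases hτ : τ = F⟮a⟯.val
    · rw [hτ]; exact (Valuation.eq_one_of_sub_one_lt hb1).le
    · exact (hb τ hτ).le
  let f : V[X] := ∏ τ : F⟮a⟯ →ₐ[F] Ω, (X - C ⟨τ b, hbV τ⟩)
  set d := (Finset.univ.erase i₁).card with hd
  have hcard : (Finset.univ : Finset (F⟮a⟯ →ₐ[F] Ω)).card = d + 1 := by
    rw [hd, Finset.card_erase_add_one (Finset.mem_univ _)]
  have hres : f.map (IsLocalRing.residue V) = X ^ (d + 1) - X ^ d := by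
    simp only [f, Polynomial.map_prod, Polynomial.map_sub, map_X, map_C]
    rw [← Finset.mul_prod_erase _ _ (Finset.mem_univ i₁)]
    have h1 : IsLocalRing.residue V ⟨i₁ b, hbV i₁⟩ = 1 := by
      rw [← map_one (IsLocalRing.residue V), ← sub_eq_zero, ← map_sub, IsLocalRing.residue_eq_zero_iff,
        ValuationSubring.valuation_lt_one_iff]
      exact hb1
    rw [h1, Finset.prod_congr rfl (g := fun _ => X)]
    · rw [Finset.prod_const, ← hd, map_one]; ring
    · intro τ hτ
      have : IsLocalRing.residue V ⟨τ b, hbV τ⟩ = 0 := by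
        rw [IsLocalRing.residue_eq_zero_iff, ValuationSubring.valuation_lt_one_iff]
        exact hb τ (Finset.ne_of_mem_erase hτ)
      rw [this, map_zero, sub_zero]
  obtain ⟨P, hP⟩ : ∃ P : F[X], P.map (algebraMap F Ω) = f.map V.subtype := by
    rw [← Polynomial.mem_lifts, Polynomial.lifts_iff_coeff_lifts]
    intro n
    rw [InfiniteGalois.mem_range_algebraMap_iff_fixed]
    intro σ
    have h1 : (f.map V.subtype).map (σ : Ω →+* Ω) = f.map V.subtype := by
      simp only [f, Polynomial.map_prod, Polynomial.map_sub, map_X, map_C]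
      let e : (F⟮a⟯ →ₐ[F] Ω) ≃ (F⟮a⟯ →ₐ[F] Ω) :=
        ⟨fun τ => σ.toAlgHom.comp τ, fun τ => σ.symm.toAlgHom.comp τ,
          fun τ => by ext; simp, fun τ => by ext; simp⟩
      exact Fintype.prod_equiv e _ _ fun τ => rfl
    conv_rhs => rw [← h1, coeff_map]
    rfl
  let g : F[X] := P - (X ^ (d + 1) - X ^ d)
  have hPd : P.natDegree = d + 1 := by
    rw [← natDegree_map (algebraMap F Ω), hP, natDegree_map_eq_of_injective Subtype.val_injective]
    simp only [f]
    rw [natDegree_finsetProd_X_sub_C_eq_card, hcard]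
  obtain ⟨x, hx⟩ := h d g (by
    exact (natDegree_sub_le _ _).trans (max_le hPd.le (natDegree_X_pow_succ_sub_X_pow_le d))) (fun i => by
    rw [← valuation_comap_lt_one hV]
    have h1 : algebraMap F Ω (g.coeff i) = ((f - (X ^ (d + 1) - X ^ d)).coeff i : V) := by
      rw [← coeff_map]
      have : g.map (algebraMap F Ω) = (f - (X ^ (d + 1) - X ^ d)).map V.subtype := by
        simp [g, hP]
      rw [this, coeff_map]
      rfl
    rw [h1, ← ValuationSubring.valuation_lt_one_iff, ← IsLocalRing.residue_eq_zero_iff, ← coeff_map]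
    simp [hres])
  have hx' : eval x P = 0 := by
    rw [← hx]; congr 1; simp [g]
  have hprod : ∏ τ : F⟮a⟯ →ₐ[F] Ω, (algebraMap F Ω x - τ b) = 0 := by
    have : eval (algebraMap F Ω x) (f.map V.subtype) = 0 := by
      rw [← hP, eval_map_algebraMap, aeval_algebraMap_apply, coe_aeval_eq_eval, hx', map_zero]
    simp only [f, Polynomial.map_prod, Polynomial.map_sub, map_X, map_C, eval_prod] at this
    simpa using this
  obtain ⟨τ, -, hτ⟩ := Finset.prod_eq_zero_iff.mp hprod
  have hbx : b = algebraMap F F⟮a⟯ x := by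
    refine τ.injective ((sub_eq_zero.mp hτ).symm.trans ?_)
    exact (τ.commutes x).symm
  rw [InfiniteGalois.mem_range_algebraMap_iff_fixed]
  intro σ
  let τ' : F⟮a⟯ →ₐ[F] Ω := σ.toAlgHom.comp F⟮a⟯.val
  have h1 : τ' = F⟮a⟯.val := by
    by_contra hne
    have h2 := hb τ' hne
    have h3 := Valuation.eq_one_of_sub_one_lt hb1
    rw [hbx, AlgHom.commutes] at h2
    rw [hbx] at h3
    exact h2.ne h3
  exact congrArg (fun τ => τ ⟨a, IntermediateField.mem_adjoin_simple_self F a⟩) h1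

/-- The valuation theoretic form of `PAdicWitness`. -/
structure PVal (p : ℕ) {F : Type} [Field F] (O : ValuationSubring F) : Prop where
  lt : O.valuation (p : F) < 1
  le : ∀ x : F, O.valuation x < 1 → O.valuation x ≤ O.valuation (p : F)
  res : ∀ x ∈ O, ∃ r : ℕ, O.valuation (x - r) < 1

theorem PAdicWitness.pval {p : ℕ} (hp : p.Prime) {F : Type} [Field F] [CharZero F]
    {O : ValuationSubring F} (h : PAdicWitness p O) : PVal p O := by
  obtain ⟨hmax, ⟨e⟩⟩ := h
  have : NeZero p := ⟨hp.ne_zero⟩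
  have hm := IsLocalRing.eq_maximalIdeal hmax
  have hlt : ∀ x : O, O.valuation (x : F) < 1 ↔ x ∈ Ideal.span {(p : O)} := fun x => by
    rw [hm, ValuationSubring.valuation_lt_one_iff]
  refine ⟨?_, fun x hx => ?_, fun x hx => ?_⟩
  · exact (hlt (p : O)).mpr (Ideal.mem_span_singleton_self _)
  · have hxO : x ∈ O := (O.valuation_le_one_iff _).mp hx.le
    obtain ⟨y, hy⟩ := Ideal.mem_span_singleton.mp ((hlt ⟨x, hxO⟩).mp hx)
    have hy' : x = p * y := by simpa using congrArg Subtype.val hy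
    rw [hy', map_mul]
    exact mul_le_of_le_one_right zero_le (O.valuation_le_one y)
  · refine ⟨(e (Ideal.Quotient.mk _ ⟨x, hx⟩)).val, ?_⟩
    have := (hlt (⟨x, hx⟩ - ((e (Ideal.Quotient.mk _ ⟨x, hx⟩)).val : O))).mpr (by
      rw [← Ideal.Quotient.eq, map_natCast]
      apply e.injective
      rw [map_natCast, ZMod.natCast_zmod_val])
    exact this

theorem PVal.witness {p : ℕ} (hp : p.Prime) {F : Type} [Field F] [CharZero F]
    {O : ValuationSubring F} (h : PVal p O) : PAdicWitness p O := by
  have : Fact p.Prime := ⟨hp⟩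
  have hp0 : (p : F) ≠ 0 := Nat.cast_ne_zero.mpr hp.ne_zero
  have hm : Ideal.span {(p : O)} = IsLocalRing.maximalIdeal O := by
    ext x
    rw [ValuationSubring.valuation_lt_one_iff, Ideal.mem_span_singleton]
    refine ⟨?_, fun hx => ?_⟩
    · rintro ⟨y, rfl⟩
      push_cast
      rw [map_mul]
      exact mul_lt_one_of_lt_of_le h.lt (O.valuation_le_one y)
    · have hle := h.le _ hx
      have : (x : F) / p ∈ O := by
        rw [← O.valuation_le_one_iff, map_div₀]
        exact div_le_one_of_le₀ hle zero_le
      refine ⟨⟨_, this⟩, Subtype.ext ?_⟩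
      push_cast
      field_simp
  have hmax : (Ideal.span {(p : O)}).IsMaximal := hm ▸ inferInstance
  refine ⟨hmax, ?_⟩
  have : Nontrivial (O ⧸ Ideal.span {(p : O)}) := Ideal.Quotient.nontrivial_iff.mpr hmax.ne_top
  have hchar : CharP (O ⧸ Ideal.span {(p : O)}) p := by
    rw [CharP.charP_iff_prime_eq_zero hp, ← map_natCast (Ideal.Quotient.mk _),
      Ideal.Quotient.eq_zero_iff_mem]
    exact Ideal.mem_span_singleton_self _
  refine ⟨(RingEquiv.ofBijective (ZMod.castHom (dvd_refl p) (O ⧸ Ideal.span {(p : O)}))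
    ⟨RingHom.injective _, fun y => ?_⟩).symm⟩
  obtain ⟨x, rfl⟩ := Ideal.Quotient.mk_surjective y
  obtain ⟨r, hr⟩ := h.res x x.2
  refine ⟨r, ?_⟩
  rw [map_natCast, ← map_natCast (Ideal.Quotient.mk _), Eq.comm, Ideal.Quotient.eq, hm,
    ValuationSubring.valuation_lt_one_iff]
  simpa using hr

theorem PVal.comap {p : ℕ} {F Z : Type} [Field F] [Field Z] [Algebra F Z] {O : ValuationSubring F}
    {V : ValuationSubring Z} (hV : ∀ a, algebraMap F Z a ∈ V ↔ a ∈ O) (h : PVal p V) : PVal p O := by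
  refine ⟨?_, fun x hx => ?_, fun x hx => ?_⟩
  · rw [← valuation_comap_lt_one hV, map_natCast]
    exact h.lt
  · rw [← valuation_comap_lt_one hV] at hx
    rw [← valuation_comap_le_iff hV, map_natCast]
    exact h.le _ hx
  · obtain ⟨r, hr⟩ := h.res _ ((hV x).mpr hx)
    refine ⟨r, ?_⟩
    rwa [← valuation_comap_lt_one hV, map_sub, map_natCast]

theorem PVal.of_immediate {p : ℕ} {F Z : Type} [Field F] [Field Z] [Algebra F Z]
    {O : ValuationSubring F} {V : ValuationSubring Z} (hV : ∀ a, algebraMap F Z a ∈ V ↔ a ∈ O)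
    (h : PVal p O) (himm : ∀ a : Z, V.valuation p < V.valuation a → V.valuation a ≤ 1 →
      ∃ c : F, V.valuation (algebraMap F Z c - a) < V.valuation a) : PVal p V := by
  have hp : V.valuation (p : Z) < 1 := by
    rw [← map_natCast (algebraMap F Z), valuation_comap_lt_one hV]
    exact h.lt
  have heq : ∀ (a : Z) (c : F), V.valuation (algebraMap F Z c - a) < V.valuation a →
      V.valuation (algebraMap F Z c) = V.valuation a := fun a c hc => by
    have := V.valuation.map_add_eq_of_lt_right hc
    rwa [sub_add_cancel] at this
  refine ⟨hp, fun x hx => ?_, fun x hx => ?_⟩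
  · by_contra! hlt
    obtain ⟨c, hc⟩ := himm x hlt hx.le
    have := h.le c (by rwa [← valuation_comap_lt_one hV, heq x c hc])
    rw [← valuation_comap_le_iff hV, heq x c hc, map_natCast] at this
    exact hlt.not_ge this
  · by_cases hx1 : V.valuation x < 1
    · exact ⟨0, by simpa using hx1⟩
    · have hx2 : V.valuation x = 1 := le_antisymm ((V.valuation_le_one_iff _).mpr hx) (not_lt.mp hx1)
      obtain ⟨c, hc⟩ := himm x (by rwa [hx2]) hx2.le
      have hcO : c ∈ O := by
        rw [← hV, ← V.valuation_le_one_iff, heq x c hc, hx2]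
      obtain ⟨r, hr⟩ := h.res c hcO
      refine ⟨r, ?_⟩
      rw [← valuation_comap_lt_one hV, map_sub, map_natCast] at hr
      have : x - r = (algebraMap F Z c - r) - (algebraMap F Z c - x) := by ring
      rw [this]
      refine lt_of_le_of_lt (V.valuation.map_sub _ _) (max_lt hr ?_)
      rwa [hx2] at hc

theorem exists_valuationSubring_extension {F Ω : Type} [Field F] [Field Ω] [Algebra F Ω]
    (O : ValuationSubring F) : ∃ V : ValuationSubring Ω, ∀ a, algebraMap F Ω a ∈ V ↔ a ∈ O := by
  obtain ⟨V, h, hloc⟩ := IsLocalRing.exists_factor_valuationRing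
    ((algebraMap F Ω).comp O.subtype)
  refine ⟨V, fun a => ⟨fun ha => ?_, fun ha => h ⟨a, ha⟩⟩⟩
  rcases O.mem_or_inv_mem a with hO | hO
  · exact hO
  · by_cases ha0 : a = 0
    · rw [ha0]; exact zero_mem _
    have hu : IsUnit (((algebraMap F Ω).comp O.subtype).codRestrict V.toSubring h ⟨a⁻¹, hO⟩) := by
      refine IsUnit.of_mul_eq_one (⟨algebraMap F Ω a, ha⟩ : V.toSubring) (Subtype.ext ?_)
      change algebraMap F Ω a⁻¹ * algebraMap F Ω a = 1
      rw [← map_mul, inv_mul_cancel₀ ha0, map_one]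
    obtain ⟨w, hw⟩ := (hloc.map_nonunit _ hu).exists_right_inv
    have h2 : a⁻¹ * (w : F) = 1 := congrArg Subtype.val hw
    have : a = w := by field_simp at h2; exact h2.symm
    rw [this]; exact w.2

theorem IsPAdicallyClosed.galoisStable {p : ℕ} (hp : p.Prime) {L Ω : Type} [Field L] [CharZero L]
    (hL : IsPAdicallyClosed p L) [Field Ω] [Algebra L Ω] [Algebra.IsAlgebraic L Ω] [IsAlgClosed Ω]
    {O : ValuationSubring L} (hO : PVal p O)
    {V : ValuationSubring Ω} (hV : ∀ a, algebraMap L Ω a ∈ V ↔ a ∈ O) : GaloisStable L V := by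
  refine galoisStable_of_fixed fun a ha => ?_
  let D : Subgroup Gal(Ω/L) :=
    { carrier := {σ | ∀ x, σ x ∈ V ↔ x ∈ V}
      mul_mem' := fun {a b} ha hb x => by rw [AlgEquiv.mul_apply, ha, hb]
      one_mem' := fun x => Iff.rfl
      inv_mem' := fun {a} ha x => by
        rw [← ha, ← AlgEquiv.mul_apply, mul_inv_cancel]; rfl }
  let E : IntermediateField L Ω := IntermediateField.fixedField D
  let VE : ValuationSubring E := V.comap (algebraMap E Ω)
  have hVE : ∀ a, algebraMap E Ω a ∈ V ↔ a ∈ VE := fun a => Iff.rfl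
  have : CharZero E := charZero_of_injective_algebraMap (algebraMap L E).injective
  have hE : PVal p VE := by
    refine hO.of_immediate (fun a => hV a) fun x hx _ => ?_
    have hx0 : (x : Ω) ≠ 0 := fun h => by
      rw [ZeroMemClass.coe_eq_zero.mp h, map_zero] at hx
      exact not_lt_zero hx
    obtain ⟨c, hc⟩ := exists_sub_lt_of_fixed (F := L) V hx0 fun σ hσ => x.2 ⟨σ, hσ⟩
    refine ⟨c, ?_⟩
    rwa [← valuation_comap_lt_iff hVE]
  obtain ⟨c, hc⟩ := hL.2 E inferInstance ⟨VE, hE.witness hp⟩ ⟨a, fun σ => ha σ.1 σ.2⟩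
  exact ⟨c, congrArg Subtype.val hc⟩

theorem ValuationSubring.valuation_natCast_le_one {F : Type} [Field F] (O : ValuationSubring F)
    (n : ℕ) : O.valuation (n : F) ≤ 1 :=
  (O.valuation_le_one_iff _).mpr (natCast_mem O n)

theorem Valuation.natCast_ne_zero {F Γ : Type} [Field F] [CharZero F]
    [LinearOrderedCommGroupWithZero Γ] (v : Valuation F Γ) {n : ℕ} (hn : n ≠ 0) : v (n : F) ≠ 0 :=
  (_root_.map_ne_zero v).mpr (Nat.cast_ne_zero.mpr hn)

theorem Valuation.eq_of_sub_lt {F Γ : Type} [Field F] [LinearOrderedCommGroupWithZero Γ]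
    {v : Valuation F Γ} {a b : F} (h : v (a - b) < v b) : v a = v b := by
  have := v.map_add_eq_of_lt_right h
  rwa [sub_add_cancel] at this

section PVal

variable {p : ℕ} {F : Type} [Field F] {O : ValuationSubring F}

theorem PVal.valuation_natCast_eq_one (hp : p.Prime) (h : PVal p O) {m : ℕ} (hm : ¬ p ∣ m) :
    O.valuation (m : F) = 1 := by
  refine le_antisymm (O.valuation_natCast_le_one m) (not_lt.mp fun hlt => ?_)
  have hcop : IsCoprime (m : ℤ) (p : ℤ) :=
    Nat.isCoprime_iff_coprime.mpr ((hp.coprime_iff_not_dvd.mpr hm).symm)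
  obtain ⟨a, b, hab⟩ := hcop
  have h1 : (1 : F) = a * m + b * p := by
    have := congrArg (Int.cast (R := F)) hab
    push_cast at this
    exact this.symm
  have hle : ∀ c : ℤ, O.valuation (c : F) ≤ 1 := fun c =>
    (O.valuation_le_one_iff _).mpr (intCast_mem O c)
  have : O.valuation (1 : F) < 1 := by
    rw [h1]
    refine lt_of_le_of_lt (O.valuation.map_add _ _) (max_lt ?_ ?_) <;> rw [map_mul]
    · exact mul_lt_one_of_nonneg_of_lt_one_right (hle a) zero_le hlt
    · exact mul_lt_one_of_nonneg_of_lt_one_right (hle b) zero_le h.lt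
  simp at this

theorem PVal.exists_valuation_natCast_eq (hp : p.Prime) (h : PVal p O) {n : ℕ} (hn : n ≠ 0) :
    ∃ k, O.valuation (n : F) = O.valuation (p : F) ^ k := by
  obtain ⟨k, m, hm, rfl⟩ := Nat.exists_eq_pow_mul_and_not_dvd hn p hp.ne_one
  refine ⟨k, ?_⟩
  rw [Nat.cast_mul, map_mul, Nat.cast_pow, map_pow, h.valuation_natCast_eq_one hp hm, mul_one]

theorem PVal.exists_pow_lt [CharZero F] (hp : p.Prime) (h : PVal p O) {n : ℕ} (hn : n ≠ 0) :
    ∃ k, O.valuation (p : F) ^ k < O.valuation (n : F) := by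
  obtain ⟨k, hk⟩ := h.exists_valuation_natCast_eq hp hn
  refine ⟨k + 1, ?_⟩
  rw [hk]
  exact pow_lt_pow_right_of_lt_one₀ (zero_lt_iff.mpr (O.valuation.natCast_ne_zero hp.ne_zero)) h.lt
    (Nat.lt_succ_self k)

theorem PVal.exists_natCast_sub_le [CharZero F] (hp : p.Prime) (h : PVal p O) (M : ℕ) :
    ∀ x ∈ O, ∃ r < p ^ M, O.valuation (x - (r : ℕ)) ≤ O.valuation (p : F) ^ M := by
  have key : ∀ x ∈ O, ∃ r : ℕ, O.valuation (x - r) ≤ O.valuation (p : F) ^ M := by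
    have hp0 : (p : F) ≠ 0 := Nat.cast_ne_zero.mpr hp.ne_zero
    induction M with
    | zero =>
      intro x hx
      exact ⟨0, by simpa [O.valuation_le_one_iff] using hx⟩
    | succ M ih =>
      intro x hx
      obtain ⟨r, hr⟩ := h.res x hx
      have hy : (x - r) / p ∈ O := by
        rw [← O.valuation_le_one_iff, map_div₀]
        exact div_le_one_of_le₀ (h.le _ hr) zero_le
      obtain ⟨s, hs⟩ := ih _ hy
      refine ⟨r + p * s, ?_⟩
      have : x - (r + p * s : ℕ) = p * ((x - r) / p - s) := by push_cast; field_simp; ring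
      rw [this, map_mul, pow_succ']
      exact mul_le_mul_right hs _
  intro x hx
  obtain ⟨r, hr⟩ := key x hx
  refine ⟨r % p ^ M, Nat.mod_lt _ (pow_pos hp.pos M), ?_⟩
  have : x - (r % p ^ M : ℕ) = (x - r) + p ^ M * (r / p ^ M : ℕ) := by
    have h1 := congrArg (Nat.cast (R := F)) (Nat.mod_add_div r (p ^ M))
    push_cast at h1 ⊢
    linear_combination -h1
  rw [this]
  refine (O.valuation.map_add _ _).trans (max_le hr ?_)
  rw [map_mul, map_pow]
  exact mul_le_of_le_one_right zero_le (O.valuation_natCast_le_one _)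

theorem PVal.exists_eq_pow [CharZero F] (hp : p.Prime) (h : PVal p O) (N : ℕ) :
    ∀ x, O.valuation (p : F) ^ N ≤ O.valuation x → O.valuation x ≤ 1 →
      ∃ j, O.valuation x = O.valuation (p : F) ^ j := by
  induction N with
  | zero => exact fun x h1 h2 => ⟨0, le_antisymm (by simpa using h2) (by simpa using h1)⟩
  | succ N ih =>
    intro x h1 h2
    have hp0 : O.valuation (p : F) ≠ 0 := O.valuation.natCast_ne_zero hp.ne_zero
    rcases h2.lt_or_eq with h2 | h2
    · obtain ⟨j, hj⟩ := ih (x / p) (by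
        rw [map_div₀, le_div_iff₀ (zero_lt_iff.mpr hp0), ← pow_succ]; exact h1) (by
        rw [map_div₀]; exact div_le_one_of_le₀ (h.le _ h2) zero_le)
      refine ⟨j + 1, ?_⟩
      rw [pow_succ, ← hj, map_div₀, div_mul_cancel₀ _ hp0]
    · exact ⟨0, by simpa using h2⟩

end PVal

theorem eq_one_of_pow_eq_one_of_sub_lt {Ω : Type} [Field Ω] {V : ValuationSubring Ω} {ζ : Ω} {e : ℕ}
    (hζ : ζ ^ e = 1) (h : V.valuation (ζ - 1) < V.valuation (e : Ω)) : ζ = 1 := by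
  by_contra hne
  have hζV : ζ ∈ V := by
    rw [← V.valuation_le_one_iff,
      Valuation.eq_one_of_sub_one_lt (h.trans_le (V.valuation_natCast_le_one e))]
  have hsum : ∑ i ∈ Finset.range e, ζ ^ i = 0 := by
    have := geom_sum_mul ζ e
    rw [hζ, sub_self] at this
    exact (mul_eq_zero.mp this).resolve_right (sub_ne_zero.mpr hne)
  have h1 : (e : Ω) = ∑ i ∈ Finset.range e, (1 - ζ ^ i) := by
    rw [Finset.sum_sub_distrib, hsum]; simp
  have h2 : V.valuation (e : Ω) ≤ V.valuation (ζ - 1) := by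
    conv_lhs => rw [h1]
    refine V.valuation.map_sum_le fun i _ => ?_
    rw [Valuation.map_sub_swap]
    simpa using valuation_pow_sub_pow_le hζV (one_mem V) i
  exact h.not_ge h2

theorem GaloisStable.mem_range_of_pow {F Ω : Type} [Field F] [Field Ω] [CharZero F] [Algebra F Ω]
    [Algebra.IsAlgebraic F Ω] [IsAlgClosed Ω] {V : ValuationSubring Ω} (h : GaloisStable F V)
    {s : Ω} {e : ℕ} (hs : s ^ e ∈ Set.range (algebraMap F Ω))
    (hs1 : V.valuation (s - 1) < V.valuation (e : Ω)) : s ∈ Set.range (algebraMap F Ω) := by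
  have := isGalois_of_isAlgClosed F Ω
  rw [InfiniteGalois.mem_range_algebraMap_iff_fixed] at hs ⊢
  intro σ
  have he := V.valuation_natCast_le_one e
  have hs0 : s ≠ 0 := by
    have := Valuation.eq_one_of_sub_one_lt (hs1.trans_le he)
    rintro rfl
    simp at this
  have h1 : V.valuation (σ s - 1) < V.valuation (e : Ω) := by
    have : σ s - 1 = σ (s - 1) := by simp
    rwa [this, h.valuation_eq]
  have h2 : σ s / s = 1 := by
    refine eq_one_of_pow_eq_one_of_sub_lt (e := e) ?_ (Valuation.div_sub_one_lt he h1 hs1)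
    rw [div_pow, ← map_pow, hs σ, div_self (pow_ne_zero _ hs0)]
  rwa [div_eq_one_iff_eq hs0] at h2

theorem GaloisStable.exists_root {F Ω : Type} [Field F] [Field Ω] [CharZero F] [Algebra F Ω]
    [Algebra.IsAlgebraic F Ω] [IsAlgClosed Ω] {V : ValuationSubring Ω} (h : GaloisStable F V)
    {u : F} {n : ℕ} (hn : n ≠ 0)
    (hu : V.valuation (algebraMap F Ω u - 1) < V.valuation (n : Ω) ^ n) :
    ∃ y, y ^ n = u ∧ V.valuation (algebraMap F Ω y - 1) < V.valuation (n : Ω) := by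
  obtain ⟨s, hs, hs1⟩ : ∃ s : Ω, s ^ n = algebraMap F Ω u ∧
      V.valuation (s - 1) < V.valuation (n : Ω) := by
    let f : Polynomial Ω := X ^ n - C (algebraMap F Ω u)
    have hmonic : f.Monic := monic_X_pow_sub_C _ hn
    have hsplit := IsAlgClosed.splits f
    have hprod := hsplit.eval_eq_prod_roots 1
    rw [hmonic.leadingCoeff, one_mul] at hprod
    have hcard : f.roots.card = n := by
      rw [← hsplit.natDegree_eq_card_roots, natDegree_X_pow_sub_C]
    by_contra! hcon
    have hge : V.valuation (n : Ω) ^ n ≤ V.valuation (eval 1 f) := by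
      rw [hprod, map_multiset_prod, Multiset.map_map]
      have hc : (f.roots.map (V.valuation ∘ fun a => 1 - a)).card = n := by
        rw [Multiset.card_map, hcard]
      have key := Multiset.pow_card_le_prod (s := f.roots.map (V.valuation ∘ fun a => 1 - a))
        (a := V.valuation (n : Ω)) ?_
      · rwa [hc] at key
      intro x hx
      obtain ⟨r, hr, rfl⟩ := Multiset.mem_map.mp hx
      simp only [Function.comp]
      rw [Valuation.map_sub_swap]
      refine hcon r ?_
      have : eval r f = 0 := (mem_roots'.mp hr).2
      simpa [f, sub_eq_zero] using this
    have : eval 1 f = -(algebraMap F Ω u - 1) := by simp [f]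
    rw [this, Valuation.map_neg] at hge
    exact hu.not_ge hge
  obtain ⟨y, rfl⟩ := h.mem_range_of_pow ⟨u, hs.symm⟩ hs1
  exact ⟨y, (algebraMap F Ω).injective (by rw [map_pow, hs]), hs1⟩

theorem HenselRoot.exists_root {F : Type} [Field F] [CharZero F] {O : ValuationSubring F}
    (h : HenselRoot O) {u : F} {n : ℕ} (hn : n ≠ 0)
    (hu : O.valuation (u - 1) < O.valuation (n : F) ^ n) :
    ∃ y, y ^ n = u ∧ O.valuation (y - 1) < O.valuation (n : F) := by
  obtain ⟨V, hV⟩ := exists_valuationSubring_extension (Ω := AlgebraicClosure F) O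
  obtain ⟨y, hy, hy1⟩ := (galoisStable_of_henselRoot hV h).exists_root hn (u := u) (by
    rw [← map_pow, ← Nat.cast_pow, ← map_one (algebraMap F _), ← map_sub,
      ← map_natCast (algebraMap F _), valuation_comap_lt_iff hV]
    simpa using hu)
  refine ⟨y, hy, ?_⟩
  rwa [← map_one (algebraMap F _), ← map_sub,
      ← map_natCast (algebraMap F _), valuation_comap_lt_iff hV] at hy1

theorem PVal.exists_unit_decomposition {p : ℕ} (hp : p.Prime) {F : Type} [Field F] [CharZero F]
    {O : ValuationSubring F} (hO : PVal p O) (h : HenselRoot O) {n : ℕ} (hn : n ≠ 0) :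
    ∃ N, ∀ u, O.valuation u = 1 → ∃ r : ℕ, r ≠ 0 ∧ r < N ∧ O.valuation (r : F) = 1 ∧
      ∃ w, u = r * w ^ n := by
  obtain ⟨M, hM⟩ := hO.exists_pow_lt hp (pow_ne_zero n hn)
  refine ⟨p ^ M, fun u hu => ?_⟩
  obtain ⟨r, hrM, hr⟩ := hO.exists_natCast_sub_le hp M u ((O.valuation_le_one_iff _).mp hu.le)
  have hlt := hr.trans_lt hM
  have hr1 : O.valuation (r : F) = 1 := by
    rw [← hu]
    refine Valuation.eq_of_sub_lt ?_
    rw [Valuation.map_sub_swap, hu]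
    exact hlt.trans_le (O.valuation_natCast_le_one _)
  have hr0 : r ≠ 0 := by rintro rfl; simp at hr1
  have hr0' : (r : F) ≠ 0 := Nat.cast_ne_zero.mpr hr0
  obtain ⟨w, hw, -⟩ := h.exists_root hn (u := u / r) (by
    rw [Valuation.div_sub_one_lt_iff hr0', hr1, mul_one]
    simpa using hlt)
  exact ⟨r, hr0, hrM, hr1, w, by rw [hw]; field_simp⟩

theorem Valuation.exists_dominant {F Γ ι : Type} [Field F] [LinearOrderedCommGroupWithZero Γ]
    (v : Valuation F Γ) {s : Finset ι} (hs : s.Nonempty) {f : ι → F} (hf : ∀ i ∈ s, f i ≠ 0)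
    (hinj : ∀ i ∈ s, ∀ j ∈ s, v (f i) = v (f j) → i = j) :
    ∃ i ∈ s, v (∑ j ∈ s, f j - f i) < v (f i) := by
  classical
  obtain ⟨i, hi, hmax⟩ := Finset.exists_max_image s (fun i => v (f i)) hs
  refine ⟨i, hi, ?_⟩
  rw [← Finset.add_sum_erase _ _ hi, add_sub_cancel_left]
  refine v.map_sum_lt ((_root_.map_ne_zero v).mpr (hf i hi)) fun j hj => ?_
  have hj' := Finset.mem_of_mem_erase hj
  exact lt_of_le_of_ne (hmax j hj') fun h => Finset.ne_of_mem_erase hj (hinj j hj' i hi h)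

theorem IntermediateField.exists_natDegree_lt_of_mem_adjoin {F Ω : Type} [Field F] [Field Ω]
    [Algebra F Ω] {y : Ω} {g : F[X]} (hg : g.Monic) (hg0 : 0 < g.natDegree) (hy : aeval y g = 0)
    {x : Ω} (hx : x ∈ F⟮y⟯) : ∃ f : F[X], f.natDegree < g.natDegree ∧ aeval y f = x := by
  have hint : IsIntegral F y := ⟨g, hg, hy⟩
  rw [← IntermediateField.mem_toSubalgebra,
    IntermediateField.adjoin_simple_toSubalgebra_of_isAlgebraic hint.isAlgebraic,
    Algebra.adjoin_singleton_eq_range_aeval] at hx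
  obtain ⟨f, rfl⟩ := hx
  refine ⟨f %ₘ g, natDegree_modByMonic_lt f hg (by rintro rfl; simp at hg0), ?_⟩
  exact aeval_modByMonic_eq_self_of_root hy

theorem IsPAdicallyClosed.exists_valuation_eq_pow {p : ℕ} (hp : p.Prime) {L : Type} [Field L]
    [CharZero L] (hL : IsPAdicallyClosed p L) {O : ValuationSubring L} (hO : PVal p O) {ℓ : ℕ}
    (hℓ : ℓ.Prime) {a : L} (ha : a ≠ 0) :
    ∃ (i : ℕ) (z : L), z ≠ 0 ∧ O.valuation (a * p ^ i) = O.valuation (z ^ ℓ) := by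
  classical
  by_contra! hcon
  have hp0 : (p : L) ≠ 0 := Nat.cast_ne_zero.mpr hp.ne_zero
  have hℓ0 : ℓ ≠ 0 := hℓ.ne_zero
  have key : ∀ (c : L) (i j : ℕ), c ≠ 0 → 0 < i → i < ℓ →
      O.valuation (c ^ ℓ * a ^ i) ≠ O.valuation (p : L) ^ j := by
    intro c i j hc hi hiℓ h
    have hcop : i.Coprime ℓ := (hℓ.coprime_iff_not_dvd.mpr (Nat.not_dvd_of_pos_of_lt hi hiℓ)).symm
    obtain ⟨s, hs⟩ := Nat.exists_mul_mod_eq_one_of_coprime hcop hℓ.one_lt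
    have hst : i * s = 1 + ℓ * (i * s / ℓ) := by
      have := Nat.mod_add_div (i * s) ℓ
      omega
    set t := i * s / ℓ
    refine hcon ((ℓ - 1) * (j * s)) (p ^ (j * s) / (c ^ s * a ^ t)) (by positivity) ?_
    have h1 : O.valuation ((c ^ s * a ^ t) ^ ℓ * a) = O.valuation (p ^ (j * s)) := by
      have : (c ^ s * a ^ t) ^ ℓ * a = (c ^ ℓ * a ^ i) ^ s := by
        rw [mul_pow, mul_pow, ← pow_mul, ← pow_mul, ← pow_mul, ← pow_mul, hst]
        ring
      rw [this, map_pow, h, map_pow, pow_mul]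
    have h2 : O.valuation (c ^ s * a ^ t) ≠ 0 := (_root_.map_ne_zero _).mpr (by positivity)
    obtain ⟨m, rfl⟩ : ∃ m, ℓ = m + 1 := ⟨ℓ - 1, by omega⟩
    rw [div_pow, map_div₀, eq_div_iff (by rw [map_pow]; exact pow_ne_zero _ h2), ← map_mul]
    have : a * p ^ ((m + 1 - 1) * (j * s)) * (c ^ s * a ^ t) ^ (m + 1) =
      ((c ^ s * a ^ t) ^ (m + 1) * a) * p ^ (m * (j * s)) := by simp; ring
    rw [this, map_mul, h1, ← map_mul]
    congr 1
    ring
  obtain ⟨V, hV⟩ := exists_valuationSubring_extension (Ω := AlgebraicClosure L) O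
  set v := V.valuation
  set ι := algebraMap L (AlgebraicClosure L)
  obtain ⟨y, hy⟩ := IsAlgClosed.exists_pow_nat_eq (ι a) hℓ.pos
  have hy0 : y ≠ 0 := by
    rintro rfl
    rw [zero_pow hℓ0] at hy
    exact ha (by simpa using hy.symm)
  have hιv : ∀ x z : L, v (ι x) = v (ι z) ↔ O.valuation x = O.valuation z := fun x z => by
    rw [le_antisymm_iff, le_antisymm_iff, valuation_comap_le_iff hV, valuation_comap_le_iff hV]
  have hmono : ∀ (c : L) (i : ℕ), (ι c * y ^ i) ^ ℓ = ι (c ^ ℓ * a ^ i) := fun c i => by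
    rw [mul_pow, ← pow_mul, mul_comm i, pow_mul, hy, map_mul, map_pow, map_pow]
  have himm : ∀ f : L[X], f.natDegree < ℓ → v (p : AlgebraicClosure L) < v (aeval y f) →
      v (aeval y f) ≤ 1 → ∃ c : L, v (ι c - aeval y f) < v (aeval y f) := by
    intro f hf hx1 hx2
    have hxsum : aeval y f = ∑ i ∈ f.support, ι (f.coeff i) * y ^ i := by
      rw [aeval_eq_sum_range, ← Finset.sum_subset (s₁ := f.support)]
      · exact Finset.sum_congr rfl fun i _ => by rw [Algebra.smul_def]
      · exact supp_subset_range_natDegree_succ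
      · intro i _ hi
        rw [notMem_support_iff.mp hi, zero_smul]
    have hne : f.support.Nonempty := by
      rw [Finset.nonempty_iff_ne_empty]
      intro h
      rw [hxsum, h] at hx1
      simp at hx1
    have hlt : ∀ i ∈ f.support, i < ℓ := fun i hi => (le_natDegree_of_mem_supp i hi).trans_lt hf
    have hinj : ∀ i ∈ f.support, ∀ j ∈ f.support, i < j →
        v (ι (f.coeff i) * y ^ i) ≠ v (ι (f.coeff j) * y ^ j) := by
      intro i hi j hj hij h
      have hci := mem_support_iff.mp hi
      have hcj := mem_support_iff.mp hj
      refine key (f.coeff j / f.coeff i) (j - i) 0 (div_ne_zero hcj hci) (by omega)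
        (by have := hlt j hj; omega) ?_
      have h1 := congrArg (· ^ ℓ) h
      simp only [← map_pow, hmono] at h1
      rw [hιv] at h1
      obtain ⟨k, rfl⟩ := Nat.exists_eq_add_of_lt hij
      have h3 : O.valuation (f.coeff i ^ ℓ * a ^ i) ≠ 0 :=
        (_root_.map_ne_zero _).mpr (by positivity)
      have h4 : (f.coeff (i + k + 1) / f.coeff i) ^ ℓ * a ^ (i + k + 1 - i) =
          (f.coeff (i + k + 1) ^ ℓ * a ^ (i + k + 1)) / (f.coeff i ^ ℓ * a ^ i) := by
        rw [show i + k + 1 - i = k + 1 by omega, div_pow, add_assoc, pow_add]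
        field_simp
        ring
      rw [h4, map_div₀, ← h1, div_self h3, pow_zero]
    obtain ⟨i, hi, hdom⟩ := v.exists_dominant hne (f := fun i => ι (f.coeff i) * y ^ i)
      (fun i hi => mul_ne_zero (by simpa [ι] using hi) (pow_ne_zero _ hy0))
      (fun i hi j hj h => by
        rcases lt_trichotomy i j with hij | hij | hij
        · exact absurd h (hinj i hi j hj hij)
        · exact hij
        · exact absurd h.symm (hinj j hj i hi hij))
    rw [← hxsum] at hdom
    have heq := Valuation.eq_of_sub_lt hdom
    have hi0 : i = 0 := by
      by_contra hi0
      obtain ⟨j, hj⟩ := hO.exists_eq_pow hp ℓ (f.coeff i ^ ℓ * a ^ i) (by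
        rw [← map_pow, ← valuation_comap_le_iff hV]
        change v (ι _) ≤ v (ι _)
        rw [← hmono, map_pow, map_pow, map_pow, ← heq, map_natCast]
        exact pow_le_pow_left₀ zero_le hx1.le _) (by
        rw [← map_one O.valuation, ← valuation_comap_le_iff hV]
        change v (ι _) ≤ v (ι _)
        rw [← hmono, map_pow, ← heq, map_one, map_one]
        exact pow_le_one₀ zero_le hx2)
      exact key _ i j (mem_support_iff.mp hi) (Nat.pos_of_ne_zero hi0) (hlt i hi) hj
    subst hi0
    refine ⟨f.coeff 0, ?_⟩
    rw [heq, Valuation.map_sub_swap]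
    simpa using hdom
  let E : IntermediateField L (AlgebraicClosure L) := L⟮y⟯
  let VE : ValuationSubring E := V.comap (algebraMap E _)
  have hVE : ∀ a, algebraMap E (AlgebraicClosure L) a ∈ V ↔ a ∈ VE := fun a => Iff.rfl
  have : CharZero E := charZero_of_injective_algebraMap (algebraMap L E).injective
  have hE : PVal p VE := by
    refine hO.of_immediate (fun a => hV a) fun x hx hx' => ?_
    obtain ⟨f, hf, hfx⟩ := IntermediateField.exists_natDegree_lt_of_mem_adjoin
      (monic_X_pow_sub_C a hℓ0) (by rw [natDegree_X_pow_sub_C]; exact hℓ.pos)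
      (by simp [hy, ι]) x.2
    rw [natDegree_X_pow_sub_C] at hf
    obtain ⟨c, hc⟩ := himm f hf (by
      rw [hfx]
      have := (valuation_comap_lt_iff hVE _ _).mpr hx
      rwa [map_natCast] at this) (by
      rw [hfx]
      have := (valuation_comap_le_iff hVE x 1).mpr (by simpa using hx')
      rwa [map_one, map_one] at this)
    refine ⟨c, ?_⟩
    rw [hfx] at hc
    rwa [← valuation_comap_lt_iff hVE]
  obtain ⟨z, hz⟩ := hL.2 E inferInstance ⟨VE, hE.witness hp⟩
    ⟨y, IntermediateField.mem_adjoin_simple_self L y⟩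
  have hz' : ι z = y := congrArg Subtype.val hz
  have hza : z ^ ℓ = a := ι.injective (by rw [map_pow, hz', hy])
  refine hcon 0 z (by rintro rfl; simp at hz'; exact hy0 hz'.symm) ?_
  rw [hza]; simp

/-- The first order properties of p-adically closed fields that are used below. -/
structure PC (p : ℕ) {F : Type} [Field F] (O : ValuationSubring F) : Prop where
  pval : PVal p O
  hensel : HenselRoot O
  decomp : ∀ n : ℕ, n ≠ 0 → ∃ Q : ℕ, ∀ a : F, a ≠ 0 →
    ∃ q : ℕ, q ≠ 0 ∧ q ≤ Q ∧ ∃ y : F, a = q * y ^ n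

theorem IsPAdicallyClosed.pc {p : ℕ} (hp : p.Prime) {L : Type} [Field L] [CharZero L]
    (hL : IsPAdicallyClosed p L) {O : ValuationSubring L} (hO : PVal p O) : PC p O := by
  have hp0 : (p : L) ≠ 0 := Nat.cast_ne_zero.mpr hp.ne_zero
  have hens : HenselRoot O := by
    obtain ⟨V, hV⟩ := exists_valuationSubring_extension (Ω := AlgebraicClosure L) O
    exact henselRoot_of_galoisStable hV (hL.galoisStable hp hO hV)
  refine ⟨hO, hens, fun n => ?_⟩
  induction n using induction_on_primes with
  | zero => exact fun h => absurd rfl h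
  | one => exact fun _ => ⟨1, fun a _ => ⟨1, one_ne_zero, le_rfl, a, by simp⟩⟩
  | prime_mul ℓ m hℓ ih =>
    intro hn
    obtain ⟨Q, hQ⟩ := ih (right_ne_zero_of_mul hn)
    obtain ⟨N, hN⟩ := hO.exists_unit_decomposition hp hens hℓ.ne_zero
    have hprime : ∀ a : L, a ≠ 0 → ∃ q : ℕ, q ≠ 0 ∧ q ≤ N * p ^ (ℓ * ℓ) ∧ ∃ y : L, a = q * y ^ ℓ := by
      intro a ha
      obtain ⟨i, z, hz, hiz⟩ := hL.exists_valuation_eq_pow hp hO hℓ ha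
      have hi : (p : L) ^ i = p ^ (i % ℓ) * (p ^ (i / ℓ)) ^ ℓ := by
        rw [← pow_mul, ← pow_add, mul_comm (i / ℓ), Nat.mod_add_div]
      set e := i % ℓ
      set t := i / ℓ
      obtain ⟨r, hr0, hrN, -, w, hw⟩ := hN (a * p ^ i / z ^ ℓ) (by
        rw [map_div₀, hiz, div_self ((_root_.map_ne_zero _).mpr (pow_ne_zero _ hz))])
      refine ⟨r * p ^ ((ℓ - 1) * e), by have := hp.ne_zero; positivity, ?_,
        z * w / (p ^ e * p ^ t), ?_⟩
      · refine Nat.mul_le_mul hrN.le (Nat.pow_le_pow_right hp.pos (Nat.mul_le_mul (by omega) ?_))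
        exact (Nat.mod_lt _ hℓ.pos).le
      · rw [hi, div_eq_iff (pow_ne_zero _ hz)] at hw
        obtain ⟨s, rfl⟩ : ∃ s, ℓ = s + 1 := ⟨ℓ - 1, by have := hℓ.pos; omega⟩
        have h1 : (p : L) ^ e ≠ 0 := pow_ne_zero _ hp0
        have h2 : (p : L) ^ t ≠ 0 := pow_ne_zero _ hp0
        have h3 : a * (p ^ e * (p ^ t) ^ (s + 1)) = r * w ^ (s + 1) * z ^ (s + 1) := hw
        rw [Nat.add_sub_cancel]
        push_cast
        rw [mul_comm s e, pow_mul, div_pow, mul_pow, mul_pow]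
        generalize (p : L) ^ e = P at *
        generalize (p : L) ^ t = T at *
        field_simp
        linear_combination P ^ s * h3
    refine ⟨Q * (N * p ^ (ℓ * ℓ)) ^ m, fun a ha => ?_⟩
    obtain ⟨q, hq, hqQ, y, rfl⟩ := hQ a ha
    have hy : y ≠ 0 := by
      rintro rfl
      simp [right_ne_zero_of_mul hn] at ha
    obtain ⟨q', hq', hqQ', z, rfl⟩ := hprime y hy
    refine ⟨q * q' ^ m, by positivity, Nat.mul_le_mul hqQ (Nat.pow_le_pow_left hqQ' m), z, ?_⟩
    push_cast
    ring

theorem PC.descend {p : ℕ} {F M : Type} [Field F] [CharZero F] [Field M] [Algebra F M]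
    {O : ValuationSubring F} {V : ValuationSubring M} (hV : ∀ a, algebraMap F M a ∈ V ↔ a ∈ O)
    (hrel : ∀ x : M, IsAlgebraic F x → x ∈ Set.range (algebraMap F M)) (h : PC p V) : PC p O := by
  refine ⟨h.pval.comap hV, fun d g hg hgi => ?_, fun n hn => ?_⟩
  · obtain ⟨x, hx⟩ := h.hensel d (g.map (algebraMap F M)) (natDegree_map_le.trans hg) (fun i => by
      rw [coeff_map, valuation_comap_lt_one hV]
      exact hgi i)
    have h1 : aeval x (X ^ (d + 1) - X ^ d + g) = 0 := by
      rw [← eval_map_algebraMap]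
      simpa using hx
    have h2 : (X ^ (d + 1) - X ^ d + g : F[X]) ≠ 0 := by
      intro h0
      have h3 := congrArg (coeff · (d + 1)) h0
      simp only [coeff_add, coeff_sub, coeff_X_pow, coeff_zero] at h3
      have h4 : g.coeff (d + 1) = -1 := by
        simp at h3
        linear_combination h3
      have := hgi (d + 1)
      rw [h4] at this
      simp at this
    obtain ⟨y, rfl⟩ := hrel x ⟨_, h2, h1⟩
    refine ⟨y, ?_⟩
    rw [aeval_algebraMap_apply] at h1
    exact (algebraMap F M).injective (by rw [map_zero]; exact h1)
  · obtain ⟨Q, hQ⟩ := h.decomp n hn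
    refine ⟨Q, fun a ha => ?_⟩
    obtain ⟨q, hq, hqQ, y, hy⟩ := hQ (algebraMap F M a) (by simpa using ha)
    have : CharZero M := charZero_of_injective_algebraMap (algebraMap F M).injective
    have hq0 : (q : M) ≠ 0 := Nat.cast_ne_zero.mpr hq
    have hyn : y ^ n = algebraMap F M (a / q) := by
      rw [map_div₀, hy, map_natCast]
      field_simp
    obtain ⟨z, rfl⟩ := hrel y (IsAlgebraic.of_pow (Nat.pos_of_ne_zero hn)
      (hyn ▸ isAlgebraic_algebraMap _))
    exact ⟨q, hq, hqQ, z, (algebraMap F M).injective (by simpa using hy)⟩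

theorem GaloisStable.valuation_algHom {F Ω : Type} [Field F] [Field Ω] [CharZero F] [Algebra F Ω]
    [Algebra.IsAlgebraic F Ω] [IsAlgClosed Ω] {V : ValuationSubring Ω} (h : GaloisStable F V)
    {E : IntermediateField F Ω} (τ : E →ₐ[F] Ω) (x : E) : V.valuation (τ x) = V.valuation x := by
  have := isGalois_of_isAlgClosed F Ω
  let σ := AlgEquiv.ofBijective (τ.liftNormal Ω) (Algebra.IsAlgebraic.algHom_bijective _)
  have hσ : τ x = σ x := (τ.liftNormal_commutes Ω x).symm
  rw [hσ, h.valuation_eq]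

theorem GaloisStable.mem_range_of_approx {F Ω : Type} [Field F] [Field Ω] [CharZero F]
    [Algebra F Ω] [Algebra.IsAlgebraic F Ω] [IsAlgClosed Ω] {V : ValuationSubring Ω}
    (h : GaloisStable F V) {a : Ω} (happ : ∀ b ∈ F⟮a⟯, b ≠ 0 → ∀ N : ℕ, N ≠ 0 →
      ∃ c : F, V.valuation (b - algebraMap F Ω c) < V.valuation (N * b)) :
    a ∈ Set.range (algebraMap F Ω) := by
  have hfin : FiniteDimensional F F⟮a⟯ :=
    IntermediateField.adjoin.finiteDimensional (Algebra.IsIntegral.isIntegral _)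
  set N := Module.finrank F F⟮a⟯ with hN
  have hN0 : N ≠ 0 := Module.finrank_pos.ne'
  have : CharZero Ω := charZero_of_injective_algebraMap (algebraMap F Ω).injective
  let z : F⟮a⟯ := ⟨a, IntermediateField.mem_adjoin_simple_self F a⟩
  let b : F⟮a⟯ := N • z - algebraMap F _ (Algebra.trace F _ z)
  have htr : Algebra.trace F F⟮a⟯ b = 0 := by
    rw [map_sub, map_nsmul, Algebra.trace_algebraMap, sub_self]
  rcases eq_or_ne b 0 with hb | hb
  · refine ⟨Algebra.trace F _ z / N, ?_⟩
    have h1 : (N : Ω) * a - algebraMap F Ω (Algebra.trace F _ z) = 0 := by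
      have := congrArg (algebraMap F⟮a⟯ Ω) hb
      rw [map_zero] at this
      rw [← this]
      simp only [b, z, map_sub, nsmul_eq_mul, map_mul, map_natCast]
      rfl
    have : (N : Ω) ≠ 0 := Nat.cast_ne_zero.mpr hN0
    rw [map_div₀, map_natCast]
    field_simp
    linear_combination -h1
  · obtain ⟨c, hc⟩ := happ b b.2 (by simpa using hb) N hN0
    exfalso
    have hcb : V.valuation (algebraMap F Ω c) = V.valuation b := by
      refine Valuation.eq_of_sub_lt ?_
      rw [Valuation.map_sub_swap]
      refine hc.trans_le ?_
      rw [map_mul]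
      exact mul_le_of_le_one_left zero_le (V.valuation_natCast_le_one N)
    have hsum : ∑ τ : F⟮a⟯ →ₐ[F] Ω, τ (b - algebraMap F _ c) = -(N * algebraMap F Ω c) := by
      simp only [map_sub, Finset.sum_sub_distrib, AlgHom.commutes, Finset.sum_const,
        Finset.card_univ, AlgHom.card, nsmul_eq_mul]
      rw [← trace_eq_sum_embeddings Ω, htr]
      simp [hN]
    refine hc.not_ge ?_
    rw [map_mul, ← hcb, ← map_mul, ← Valuation.map_neg, ← hsum]
    refine V.valuation.map_sum_le fun τ _ => ?_
    rw [h.valuation_algHom]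
    rfl

theorem PVal.mem_of_pow_eq {p : ℕ} (hp : p.Prime) {F : Type} [Field F] [CharZero F]
    {O : ValuationSubring F} (hO : PVal p O) {x y : F} (hy : y ^ (p + 1) = 1 + p * x ^ (p + 1)) :
    x ∈ O := by
  by_contra hx'
  have hx1 : 1 < O.valuation x := by
    rw [← not_le, O.valuation_le_one_iff]; exact hx'
  have hx0 : O.valuation x ≠ 0 := (zero_lt_one.trans hx1).ne'
  have hp0 : O.valuation (p : F) ≠ 0 := O.valuation.natCast_ne_zero hp.ne_zero
  have hpx : 1 ≤ O.valuation (p : F) * O.valuation x := by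
    have h1 : O.valuation x⁻¹ ≤ O.valuation (p : F) := hO.le _ (by
      rw [map_inv₀]; exact inv_lt_one_of_one_lt₀ hx1)
    rw [map_inv₀, inv_le_iff_one_le_mul₀ (zero_lt_iff.mpr hx0)] at h1
    exact h1
  have hpxm : 1 < O.valuation (p * x ^ (p + 1)) := by
    rw [map_mul, map_pow, pow_succ', ← mul_assoc]
    exact one_lt_mul_of_le_of_lt hpx (one_lt_pow₀ hx1 hp.ne_zero)
  have hyv : O.valuation (y / x) ^ (p + 1) = O.valuation (p : F) := by
    have : O.valuation (y ^ (p + 1)) = O.valuation (p * x ^ (p + 1)) := by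
      rw [hy]
      refine Valuation.eq_of_sub_lt ?_
      rw [add_sub_cancel_right, map_one]
      exact hpxm
    rw [map_div₀, div_pow, ← map_pow, this, map_mul, ← map_pow, mul_div_cancel_right₀]
    rw [map_pow]
    exact pow_ne_zero _ hx0
  have h1 : O.valuation (y / x) < 1 := by
    by_contra! h
    exact (hyv ▸ one_le_pow₀ h).not_gt hO.lt
  have h2 := pow_le_pow_left₀ zero_le (hO.le _ h1) (p + 1)
  rw [hyv, pow_succ'] at h2
  refine h2.not_gt (mul_lt_of_lt_one_right (zero_lt_iff.mpr hp0) ?_)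
  exact pow_lt_one₀ zero_le hO.lt hp.ne_zero

theorem HenselRoot.exists_pow_eq {p : ℕ} (hp : p.Prime) {F : Type} [Field F] [CharZero F]
    {O : ValuationSubring F} (hO : PVal p O) (h : HenselRoot O) {x : F} (hx : x ∈ O) :
    ∃ y, y ^ (p + 1) = 1 + p * x ^ (p + 1) := by
  have hdvd : ¬ p ∣ p + 1 := fun h => hp.one_lt.ne'
    (Nat.dvd_one.mp ((Nat.dvd_add_right (dvd_refl p)).mp h))
  obtain ⟨y, hy, -⟩ := h.exists_root (Nat.succ_ne_zero p) (u := 1 + p * x ^ (p + 1)) (by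
    rw [hO.valuation_natCast_eq_one hp hdvd, one_pow, add_sub_cancel_left, map_mul, map_pow]
    exact mul_lt_one_of_lt_of_le hO.lt (pow_le_one₀ zero_le ((O.valuation_le_one_iff _).mpr hx)))
  exact ⟨y, hy⟩

theorem PVal.valuationSubring_le {p : ℕ} (hp : p.Prime) {F : Type} [Field F] [CharZero F]
    {O O' : ValuationSubring F} (hO : PVal p O) (h : HenselRoot O) (hO' : PVal p O') : O ≤ O' :=
  fun _ hx => (h.exists_pow_eq hp hO hx).elim fun _ hy => hO'.mem_of_pow_eq hp hy

theorem PVal.eq_of_le {p : ℕ} (hp : p.Prime) {F : Type} [Field F] [CharZero F]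
    {O O' : ValuationSubring F} (hO : PVal p O) (hO' : PVal p O') (h : O ≤ O') : O = O' := by
  refine le_antisymm h fun x hx => ?_
  by_contra hxO
  have hp0 : (p : F) ≠ 0 := Nat.cast_ne_zero.mpr hp.ne_zero
  have hx1 : 1 < O.valuation x := by
    rw [← not_le, O.valuation_le_one_iff]; exact hxO
  have hx0 : x ≠ 0 := by rintro rfl; simp at hx1
  have h1 : x⁻¹ / p ∈ O := by
    rw [← O.valuation_le_one_iff, map_div₀]
    refine div_le_one_of_le₀ (hO.le _ ?_) zero_le
    rw [map_inv₀]; exact inv_lt_one_of_one_lt₀ hx1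
  have h2 : (p : F)⁻¹ ∈ O' := by
    have := mul_mem hx (h h1)
    rwa [← mul_div_assoc, mul_inv_cancel₀ hx0, one_div] at this
  rw [← O'.valuation_le_one_iff, map_inv₀] at h2
  refine h2.not_gt ((one_lt_inv₀ (zero_lt_iff.mpr ?_)).mpr hO'.lt)
  exact O'.valuation.natCast_ne_zero hp.ne_zero

theorem PVal.exists_eq_pow_of_pow_eq {p : ℕ} (hp : p.Prime) {F : Type} [Field F] [CharZero F]
    {O : ValuationSubring F} (hO : PVal p O) {x : F} {n j : ℕ} (hn : n ≠ 0)
    (h : O.valuation x ^ n = O.valuation (p : F) ^ j) : ∃ i, O.valuation x = O.valuation (p : F) ^ i := by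
  have hx : O.valuation x ≤ 1 := by
    by_contra! hx
    exact (one_lt_pow₀ hx hn).not_ge (h ▸ pow_le_one₀ zero_le hO.lt.le)
  exact hO.exists_eq_pow hp j x (h ▸ pow_le_of_le_one zero_le hx hn) hx

theorem PC.exists_valuation_eq {p : ℕ} (hp : p.Prime) {F E : Type} [Field F] [CharZero F] [Field E]
    [Algebra F E] [Algebra.IsAlgebraic F E] {O : ValuationSubring F} {W : ValuationSubring E}
    (hW : ∀ a, algebraMap F E a ∈ W ↔ a ∈ O) (hO : PC p O) (hE : PVal p W) {b : E} (hb : b ≠ 0) :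
    ∃ c : F, W.valuation (algebraMap F E c) = W.valuation b := by
  have : CharZero E := charZero_of_injective_algebraMap (algebraMap F E).injective
  let Ω := AlgebraicClosure E
  have : Algebra.IsAlgebraic F Ω := Algebra.IsAlgebraic.trans F E Ω
  obtain ⟨V, hV⟩ := exists_valuationSubring_extension (Ω := Ω) W
  have hst : GaloisStable F V := galoisStable_of_henselRoot (O := O) (fun a => by
    rw [IsScalarTower.algebraMap_apply F E Ω, hV, hW]) hO.hensel
  set β := algebraMap E Ω b
  have hfin : FiniteDimensional F F⟮β⟯ :=
    IntermediateField.adjoin.finiteDimensional (Algebra.IsIntegral.isIntegral _)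
  set N := Module.finrank F F⟮β⟯ with hN
  have hN0 : N ≠ 0 := Module.finrank_pos.ne'
  let z : F⟮β⟯ := ⟨β, IntermediateField.mem_adjoin_simple_self F β⟩
  have hz : z ≠ 0 := fun h => hb (by
    have := congrArg (algebraMap F⟮β⟯ Ω) h
    rw [map_zero] at this
    exact (algebraMap E Ω).injective (by rw [map_zero]; exact this))
  have hnorm : V.valuation (algebraMap F Ω (Algebra.norm F z)) = V.valuation β ^ N := by
    rw [Algebra.norm_eq_prod_embeddings F Ω z, map_prod, Finset.prod_congr rfl fun τ _ =>
      hst.valuation_algHom τ z, Finset.prod_const, Finset.card_univ, AlgHom.card]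
  obtain ⟨Q, hQ⟩ := hO.decomp N hN0
  obtain ⟨q, hq, -, y, hy⟩ := hQ (Algebra.norm F z) (Algebra.norm_ne_zero_iff.mpr hz)
  have hnz : Algebra.norm F z ≠ 0 := Algebra.norm_ne_zero_iff.mpr hz
  rw [hy] at hnz
  have hy0 : y ≠ 0 := by
    rintro rfl
    simp [hN0] at hnz
  have hnormW : W.valuation (algebraMap F E (q * y ^ N)) = W.valuation (b ^ N) := by
    rw [hy, IsScalarTower.algebraMap_apply F E Ω, ← map_pow, ← map_pow] at hnorm
    exact le_antisymm ((valuation_comap_le_iff hV _ _).mp hnorm.le)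
      ((valuation_comap_le_iff hV _ _).mp hnorm.ge)
  obtain ⟨j, hj⟩ := hE.exists_valuation_natCast_eq hp hq
  have hy1 : W.valuation (algebraMap F E y) ≠ 0 := (_root_.map_ne_zero _).mpr (by simpa using hy0)
  obtain ⟨i, hi⟩ := hE.exists_eq_pow_of_pow_eq hp (x := b / algebraMap F E y) hN0 (j := j) (by
    rw [← hj, map_div₀, div_pow, ← map_pow, ← hnormW]
    simp only [map_mul, map_pow, map_natCast]
    rw [mul_div_cancel_right₀ _ (pow_ne_zero _ hy1)])
  refine ⟨p ^ i * y, ?_⟩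
  rw [map_mul, map_mul, map_pow, map_natCast, map_pow, ← hi, map_div₀, div_mul_cancel₀ _ hy1]

theorem PC.exists_approx {p : ℕ} (hp : p.Prime) {F E : Type} [Field F] [CharZero F] [Field E]
    [CharZero E]
    [Algebra F E] [Algebra.IsAlgebraic F E] {O : ValuationSubring F} {W : ValuationSubring E}
    (hW : ∀ a, algebraMap F E a ∈ W ↔ a ∈ O) (hO : PC p O) (hE : PVal p W) {b : E} (hb : b ≠ 0)
    {N : ℕ} (hN : N ≠ 0) :
    ∃ c : F, W.valuation (b - algebraMap F E c) < W.valuation (N * b) := by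
  obtain ⟨a, ha⟩ := hO.exists_valuation_eq hp hW hE hb
  obtain ⟨M, hM⟩ := hE.exists_pow_lt hp hN
  have hb' : W.valuation b ≠ 0 := (_root_.map_ne_zero _).mpr hb
  have ha0 : algebraMap F E a ≠ 0 := by
    intro h
    rw [h, map_zero] at ha
    exact hb' ha.symm
  obtain ⟨r, -, hr⟩ := hE.exists_natCast_sub_le hp M (b / algebraMap F E a) (by
    rw [← W.valuation_le_one_iff, map_div₀, ha, div_self hb'])
  refine ⟨r * a, ?_⟩
  have : b - algebraMap F E (r * a) = (b / algebraMap F E a - r) * algebraMap F E a := by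
    rw [map_mul, map_natCast]
    field_simp
  rw [this, map_mul, map_mul, ha]
  exact mul_lt_mul_of_pos_right (hr.trans_lt hM) (zero_lt_iff.mpr hb')

theorem PC.isPAdicallyClosed {p : ℕ} (hp : p.Prime) {F : Type} [Field F] [CharZero F]
    {O : ValuationSubring F} (hO : PC p O) : IsPAdicallyClosed p F := by
  refine ⟨⟨O, hO.pval.witness hp⟩, fun E _ _ _ ⟨W, hW⟩ a => ?_⟩
  have : CharZero E := charZero_of_injective_algebraMap (algebraMap F E).injective
  have hE := hW.pval hp
  have hO' : PVal p (W.comap (algebraMap F E)) := PVal.comap (Z := E) (fun _ => Iff.rfl) hE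
  have heq := hO.pval.eq_of_le hp hO' (hO.pval.valuationSubring_le hp hO.hensel hO')
  have hWO : ∀ a, algebraMap F E a ∈ W ↔ a ∈ O := fun a => by rw [heq]; rfl
  let Ω := AlgebraicClosure E
  have : Algebra.IsAlgebraic F Ω := Algebra.IsAlgebraic.trans F E Ω
  obtain ⟨V, hV⟩ := exists_valuationSubring_extension (Ω := Ω) W
  have hst : GaloisStable F V := galoisStable_of_henselRoot (O := O) (fun a => by
    rw [IsScalarTower.algebraMap_apply F E Ω, hV, hWO]) hO.hensel
  obtain ⟨c, hc⟩ := hst.mem_range_of_approx (a := algebraMap E Ω a) fun b hb hb0 N hN => by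
    have hle : F⟮algebraMap E Ω a⟯ ≤ (IsScalarTower.toAlgHom F E Ω).fieldRange :=
      IntermediateField.adjoin_simple_le_iff.mpr ⟨a, rfl⟩
    obtain ⟨b, rfl⟩ := hle hb
    obtain ⟨c, hc⟩ := hO.exists_approx hp hWO hE (b := b) (by rintro rfl; simp at hb0) hN
    refine ⟨c, ?_⟩
    rw [IsScalarTower.algebraMap_apply F E Ω, ← map_natCast (algebraMap E Ω)]
    change V.valuation (algebraMap E Ω b - _) < V.valuation (_ * algebraMap E Ω b)
    rw [← map_sub, ← map_mul, valuation_comap_lt_iff hV]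
    exact hc
  exact ⟨c, (algebraMap E Ω).injective (by rw [← IsScalarTower.algebraMap_apply, hc])⟩

theorem PVal.eq_one_of_pow_eq_one {p : ℕ} (hp : p.Prime) {F : Type} [Field F] [CharZero F]
    {O : ValuationSubring F} (hO : PVal p O) {m : ℕ} (hm : m ≠ 0) {ζ : F} (hζ : ζ ^ m = 1)
    (h : O.valuation (ζ - 1) < O.valuation (p : F)) : ζ = 1 := by
  induction m using induction_on_primes generalizing ζ with
  | zero => exact absurd rfl hm
  | one => simpa using hζ
  | prime_mul ℓ m hℓ ih =>
    refine ih (right_ne_zero_of_mul hm) ?_ h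
    refine eq_one_of_pow_eq_one_of_sub_lt (e := ℓ) (V := O) (by rw [← pow_mul, mul_comm, hζ]) ?_
    have hpow := Valuation.pow_sub_one_lt hO.lt.le h m
    refine hpow.trans_le ?_
    rcases eq_or_ne ℓ p with rfl | hne
    · exact le_rfl
    · rw [hO.valuation_natCast_eq_one hp fun hd => hne ((Nat.prime_dvd_prime_iff_eq hp hℓ).mp hd).symm]
      exact hO.lt.le

theorem PVal.pow_totient_sub_one_lt {p : ℕ} (hp : p.Prime) {F : Type} [Field F] [CharZero F]
    {O : ValuationSubring F} (hO : PVal p O) {x : F} (hx : O.valuation x = 1) :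
    O.valuation (x ^ (p ^ 2).totient - 1) < O.valuation (p : F) := by
  have hp0 : O.valuation (p : F) ≠ 0 := O.valuation.natCast_ne_zero hp.ne_zero
  have hlt : O.valuation (p : F) ^ 2 < O.valuation (p : F) := by
    rw [pow_two]
    exact mul_lt_of_lt_one_right (zero_lt_iff.mpr hp0) hO.lt
  have hxO : x ∈ O := (O.valuation_le_one_iff _).mp hx.le
  obtain ⟨r, -, hr⟩ := hO.exists_natCast_sub_le hp 2 x hxO
  set n := (p ^ 2).totient
  have h1 : O.valuation (x ^ n - r ^ n) < O.valuation (p : F) :=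
    (valuation_pow_sub_pow_le hxO (natCast_mem O r) n).trans_lt (hr.trans_lt hlt)
  have hrp : ¬ p ∣ r := by
    rintro ⟨s, rfl⟩
    have h2 : O.valuation x ≤ O.valuation (p : F) := by
      have : x = (x - (p * s : ℕ)) + p * s := by push_cast; ring
      rw [this]
      refine (O.valuation.map_add _ _).trans (max_le (hr.trans hlt.le) ?_)
      rw [map_mul]
      exact mul_le_of_le_one_right zero_le (O.valuation_natCast_le_one s)
    exact (hx ▸ h2).not_gt hO.lt
  have hcop : r.Coprime (p ^ 2) := ((hp.coprime_iff_not_dvd.mpr hrp).symm).pow_right 2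
  obtain ⟨k, hk⟩ := (Nat.modEq_iff_dvd.mp (Nat.ModEq.pow_totient hcop).symm)
  have h2 : O.valuation ((r : F) ^ n - 1) < O.valuation (p : F) := by
    have : (r : F) ^ n - 1 = p ^ 2 * k := by
      have := congrArg (Int.cast (R := F)) hk
      push_cast at this
      exact this
    rw [this, map_mul, map_pow]
    exact (mul_le_of_le_one_right zero_le
      ((O.valuation_le_one_iff _).mpr (intCast_mem O k))).trans_lt hlt
  rw [← sub_add_sub_cancel _ ((r : F) ^ n)]
  exact (O.valuation.map_add _ _).trans_lt (max_lt h1 h2)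

theorem PVal.pow_totient_eq_one {p : ℕ} (hp : p.Prime) {F : Type} [Field F] [CharZero F]
    {O : ValuationSubring F} (hO : PVal p O) {x : F} {m : ℕ} (hm : m ≠ 0) (hx : x ^ m = 1) :
    x ^ (p ^ 2).totient = 1 := by
  refine hO.eq_one_of_pow_eq_one hp hm (by rw [← pow_mul, mul_comm, pow_mul, hx, one_pow])
    (hO.pow_totient_sub_one_lt hp ?_)
  exact (pow_eq_one_iff.mp (by rw [← map_pow, hx, map_one])).resolve_right hm

section Radical

variable {p : ℕ} {H Ω : Type} [Field H] [CharZero H] [Field Ω] [Algebra H Ω]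

/-- The radical elements of a subfield over `H`. -/
def radicals (n : ℕ) (M : IntermediateField H Ω) : Subgroup Ωˣ where
  carrier := {a | (∃ c ∈ M, c ^ n = a) ∧ ∃ e : ℕ, e ≠ 0 ∧ (a : Ω) ^ e ∈ Set.range (algebraMap H Ω)}
  one_mem' := ⟨⟨1, one_mem M, by simp⟩, 1, one_ne_zero, 1, by simp⟩
  mul_mem' := by
    rintro a b ⟨⟨c, hc, hca⟩, e, he, x, hx⟩ ⟨⟨d, hd, hdb⟩, e', he', x', hx'⟩
    refine ⟨⟨c * d, mul_mem hc hd, by rw [mul_pow, hca, hdb]; rfl⟩, e * e', mul_ne_zero he he',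
      x ^ e' * x' ^ e, ?_⟩
    rw [map_mul, map_pow, map_pow, hx, hx', Units.val_mul]
    ring
  inv_mem' := by
    rintro a ⟨⟨c, hc, hca⟩, e, he, x, hx⟩
    exact ⟨⟨c⁻¹, inv_mem hc, by rw [inv_pow, hca, Units.val_inv_eq_inv_val]⟩, e, he, x⁻¹, by
      rw [map_inv₀, hx, Units.val_inv_eq_inv_val, inv_pow]⟩

variable {V : ValuationSubring Ω} {M : IntermediateField H Ω}

theorem exists_natCast_sub_lt_of_mem [CharZero Ω] (hp : p.Prime)
    (hM : PVal p (V.comap (algebraMap M Ω))) {x : Ω} (hx : x ∈ M)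
    (hx1 : V.valuation x = 1) {e : ℕ} (he : e ≠ 0) :
    ∃ r : ℕ, r ≠ 0 ∧ V.valuation (r : Ω) = 1 ∧ V.valuation (x / r - 1) < V.valuation (e : Ω) := by
  have hV : ∀ a, algebraMap M Ω a ∈ V ↔ a ∈ V.comap (algebraMap M Ω) := fun _ => Iff.rfl
  have : CharZero M := charZero_of_injective_algebraMap (algebraMap H M).injective
  obtain ⟨k, hk⟩ := hM.exists_pow_lt hp he
  obtain ⟨r, -, hr⟩ := hM.exists_natCast_sub_le hp k ⟨x, hx⟩
    ((V.valuation_le_one_iff _).mp hx1.le)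
  have hlt := (valuation_comap_lt_iff hV _ _).mpr (hr.trans_lt hk)
  rw [map_sub, map_natCast, map_natCast] at hlt
  change V.valuation (x - r) < _ at hlt
  have hr1 : V.valuation (r : Ω) = 1 := by
    rw [← hx1]
    refine Valuation.eq_of_sub_lt ?_
    rw [Valuation.map_sub_swap, hx1]
    exact hlt.trans_le (V.valuation_natCast_le_one _)
  have hr0 : r ≠ 0 := by rintro rfl; simp at hr1
  refine ⟨r, hr0, hr1, ?_⟩
  rwa [Valuation.div_sub_one_lt_iff (Nat.cast_ne_zero.mpr hr0), hr1, mul_one]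

variable [Algebra.IsAlgebraic H Ω] [IsAlgClosed Ω]

theorem mem_range_of_mem_radicals (hst : GaloisStable H V) (hp : p.Prime)
    (hM : PVal p (V.comap (algebraMap M Ω)))
    {n : ℕ} {a : Ωˣ} (ha : a ∈ radicals n M) {h : H}
    (hv : V.valuation (a : Ω) = V.valuation (algebraMap H Ω h)) :
    (a : Ω) ∈ Set.range (algebraMap H Ω) := by
  have : CharZero Ω := charZero_of_injective_algebraMap (algebraMap H Ω).injective
  obtain ⟨⟨c, hc, hca⟩, e, he, x, hx⟩ := ha
  have hh0 : algebraMap H Ω h ≠ 0 := by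
    intro h0
    rw [h0, map_zero, _root_.map_eq_zero] at hv
    exact a.ne_zero hv
  have haM : (a : Ω) / algebraMap H Ω h ∈ M :=
    div_mem (hca ▸ pow_mem hc n) (IntermediateField.algebraMap_mem _ _)
  obtain ⟨r, hr0, hr1, hr⟩ := exists_natCast_sub_lt_of_mem hp hM haM (by
    rw [map_div₀, hv, div_self ((_root_.map_ne_zero _).mpr hh0)]) he
  have hr0' : (r : Ω) ≠ 0 := Nat.cast_ne_zero.mpr hr0
  obtain ⟨s, hs⟩ := hst.mem_range_of_pow ⟨x / h ^ e / r ^ e, by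
    rw [div_pow, div_pow, map_div₀, map_div₀, hx, map_pow, map_pow, map_natCast]⟩ hr
  refine ⟨s * (h * r), ?_⟩
  rw [map_mul, hs, map_mul, map_natCast]
  field_simp

theorem exists_mem_radicals (hst : GaloisStable H V) (hp : p.Prime)
    (hM : PC p (V.comap (algebraMap M Ω)))
    {n : ℕ} (hn : n ≠ 0) {b : Ω} (hb : b ∈ M) (hb0 : b ≠ 0) :
    ∃ a ∈ radicals n M, ∃ q : ℕ, V.valuation b = V.valuation (q * (a : Ω)) := by
  have : CharZero Ω := charZero_of_injective_algebraMap (algebraMap H Ω).injective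
  have : CharZero M := charZero_of_injective_algebraMap (algebraMap H M).injective
  have hfin : FiniteDimensional H H⟮b⟯ :=
    IntermediateField.adjoin.finiteDimensional (Algebra.IsIntegral.isIntegral _)
  set e := Module.finrank H H⟮b⟯ with he
  have he0 : e ≠ 0 := Module.finrank_pos.ne'
  let z : H⟮b⟯ := ⟨b, IntermediateField.mem_adjoin_simple_self H b⟩
  have hz : z ≠ 0 := fun h => hb0 (congrArg Subtype.val h)
  set h := Algebra.norm H z
  have hnorm : V.valuation (algebraMap H Ω h) = V.valuation b ^ e := by
    rw [Algebra.norm_eq_prod_embeddings H Ω z, map_prod, Finset.prod_congr rfl fun τ _ =>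
      hst.valuation_algHom τ z, Finset.prod_const, Finset.card_univ, AlgHom.card]
  have hh0 : algebraMap H Ω h ≠ 0 := by
    rw [_root_.map_ne_zero]
    exact Algebra.norm_ne_zero_iff.mpr hz
  obtain ⟨Q, hQ⟩ := hM.decomp n hn
  obtain ⟨q, hq, -, y, hy⟩ := hQ ⟨b, hb⟩ (fun h => hb0 (congrArg Subtype.val h))
  have hy' : b = q * (y : Ω) ^ n := by simpa using congrArg Subtype.val hy
  have hq0 : (q : Ω) ≠ 0 := Nat.cast_ne_zero.mpr hq
  have hy0 : (y : Ω) ≠ 0 := by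
    intro h0
    rw [h0, zero_pow hn, mul_zero] at hy'
    exact hb0 hy'
  obtain ⟨N, hN⟩ := hM.pval.exists_unit_decomposition hp hM.hensel (mul_ne_zero hn he0)
  let g : M := algebraMap H M h / q ^ e
  have hg : (g : Ω) = algebraMap H Ω h / q ^ e := by simp [g]
  have hg0 : (g : Ω) ≠ 0 := by rw [hg]; exact div_ne_zero hh0 (pow_ne_zero _ hq0)
  have hV : ∀ a, algebraMap M Ω a ∈ V ↔ a ∈ V.comap (algebraMap M Ω) := fun _ => Iff.rfl
  have hone : ∀ x : M, (V.comap (algebraMap M Ω)).valuation x = 1 ↔ V.valuation (x : Ω) = 1 := by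
    intro x
    have h1 := valuation_comap_le_iff hV x 1
    have h2 := valuation_comap_le_iff hV 1 x
    rw [map_one, map_one, map_one] at h1 h2
    rw [le_antisymm_iff, le_antisymm_iff, ← h1, ← h2]
    rfl
  have hgv : V.valuation (g : Ω) = V.valuation ((y : Ω) ^ n) ^ e := by
    rw [hg, map_div₀, hnorm, hy', map_mul, mul_pow, map_pow _ _ e,
      mul_div_cancel_left₀ _ (pow_ne_zero _ ((_root_.map_ne_zero _).mpr hq0))]
  obtain ⟨r, hr0, -, hr1, w, hw⟩ := hN ((y ^ n) ^ e / g) (by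
    rw [hone]
    push_cast
    rw [map_div₀, map_pow V.valuation _ e, hgv, div_self]
    exact pow_ne_zero _ ((_root_.map_ne_zero _).mpr (pow_ne_zero _ hy0)))
  have hw' : ((y : Ω) ^ n) ^ e / g = r * (w : Ω) ^ (n * e) := by
    simpa using congrArg (Subtype.val) hw
  have hr1' : V.valuation (r : Ω) = 1 := by
    have := (hone (r : M)).mp hr1
    simpa using this
  have hw1 : V.valuation (w : Ω) = 1 := by
    have h1 := congrArg V.valuation hw'
    rw [map_mul, hr1', one_mul, map_div₀, map_pow V.valuation _ e, hgv, div_self, map_pow] at h1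
    · exact (pow_eq_one_iff.mp h1.symm).resolve_right (mul_ne_zero hn he0)
    · exact pow_ne_zero _ ((_root_.map_ne_zero _).mpr (pow_ne_zero _ hy0))
  have hw0 : (w : Ω) ≠ 0 := by
    intro h0
    rw [h0, map_zero] at hw1
    exact zero_ne_one hw1
  refine ⟨Units.mk0 (((y : Ω) / w) ^ n) (pow_ne_zero _ (div_ne_zero hy0 hw0)),
    ⟨⟨y / w, div_mem y.2 w.2, rfl⟩, e, he0, h / q ^ e * r, ?_⟩, q, ?_⟩
  · have h1 : (g : Ω) * r = ((y : Ω) ^ n) ^ e / w ^ (n * e) := by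
      rw [div_eq_iff hg0] at hw'
      rw [eq_div_iff (pow_ne_zero _ hw0), hw']
      ring
    rw [map_mul, map_div₀, map_pow, map_natCast, map_natCast, ← hg, h1, Units.val_mk0, div_pow,
      div_pow, ← pow_mul (w : Ω)]
  · rw [hy', Units.val_mk0, map_mul, map_mul, div_pow, map_div₀, map_pow _ (w : Ω), hw1, one_pow,
      div_one]

end Radical

theorem sum_eq_zero_of_dominant {H Ω B : Type} [Field H] [Field Ω] [Algebra H Ω]
    (v : ValuationSubring Ω) {f₁ f₂ : B → Ω} (hf₁ : ∀ a, f₁ a ≠ 0)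
    (hprop : ∀ a a' (h : H), v.valuation (f₁ a) = v.valuation (algebraMap H Ω h * f₁ a') →
      ∃ g : H, f₁ a = algebraMap H Ω g * f₁ a' ∧ f₂ a = algebraMap H Ω g * f₂ a')
    (s : Finset B) (h : B → H) (hs : ∑ a ∈ s, algebraMap H Ω (h a) * f₁ a = 0) :
    ∑ a ∈ s, algebraMap H Ω (h a) * f₂ a = 0 := by
  classical
  induction hn : s.card using Nat.strong_induction_on generalizing s h with
  | _ n ih =>
  subst hn
  by_cases h0 : ∃ a ∈ s, h a = 0
  · obtain ⟨a, ha, ha0⟩ := h0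
    have := ih _ (Finset.card_erase_lt_of_mem ha) (s.erase a) h (by
      rw [← hs, ← Finset.add_sum_erase _ _ ha, ha0]; simp) rfl
    rw [← Finset.add_sum_erase _ _ ha, this, ha0]
    simp
  push Not at h0
  rcases s.eq_empty_or_nonempty with rfl | hne
  · simp
  by_cases hinj : ∀ i ∈ s, ∀ j ∈ s, v.valuation (algebraMap H Ω (h i) * f₁ i) =
      v.valuation (algebraMap H Ω (h j) * f₁ j) → i = j
  · obtain ⟨i, hi, hlt⟩ := v.valuation.exists_dominant hne
      (f := fun a => algebraMap H Ω (h a) * f₁ a)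
      (fun i hi => mul_ne_zero (by simpa using h0 i hi) (hf₁ i)) hinj
    rw [hs, zero_sub, Valuation.map_neg] at hlt
    exact absurd hlt (lt_irrefl _)
  push Not at hinj
  obtain ⟨i, hi, j, hj, hv, hij⟩ := hinj
  have hi0 : algebraMap H Ω (h i) ≠ 0 := by simpa using h0 i hi
  obtain ⟨g, hg₁, hg₂⟩ := hprop i j (h j / h i) (by
    rw [map_mul] at hv
    rw [map_div₀, div_mul_eq_mul_div, map_div₀, ← hv,
      mul_div_cancel_left₀ _ ((_root_.map_ne_zero _).mpr hi0)])
  have key : ∀ f : B → Ω, f i = algebraMap H Ω g * f j →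
      ∑ a ∈ s.erase i, algebraMap H Ω (Function.update h j (h j + h i * g) a) * f a =
        ∑ a ∈ s, algebraMap H Ω (h a) * f a := by
    intro f hf
    have hj' : j ∈ s.erase i := Finset.mem_erase.mpr ⟨Ne.symm hij, hj⟩
    rw [← Finset.add_sum_erase _ _ hi, ← Finset.add_sum_erase _ _ hj',
      ← Finset.add_sum_erase _ (fun a => algebraMap H Ω (h a) * f a) hj', hf,
      Function.update_self, Finset.sum_congr rfl (g := fun a => algebraMap H Ω (h a) * f a)]
    · rw [map_add, map_mul]; ring
    · intro a ha
      rw [Function.update_of_ne (Finset.ne_of_mem_erase ha)]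
  rw [← key f₂ hg₂]
  refine ih _ (Finset.card_erase_lt_of_mem hi) _ _ ?_ rfl
  rw [key f₁ hg₁, hs]

theorem exists_algHom_of_galoisStable {p : ℕ} (hp : p.Prime) {H Ω : Type} [Field H] [CharZero H]
    [Field Ω] [Algebra H Ω] [Algebra.IsAlgebraic H Ω] [IsAlgClosed Ω] {V : ValuationSubring Ω}
    (hst : GaloisStable H V) {K₁ K₂ : IntermediateField H Ω}
    (h₁ : PC p (V.comap (algebraMap K₁ Ω))) (h₂ : PVal p (V.comap (algebraMap K₂ Ω)))
    (hpow : ∀ m : ℕ, m ≠ 0 → ∀ h : H, (∃ f ∈ K₁, f ^ m = algebraMap H Ω h) →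
      ∃ f ∈ K₂, f ^ m = algebraMap H Ω h) : Nonempty (K₁ →ₐ[H] K₂) := by
  classical
  have : CharZero Ω := charZero_of_injective_algebraMap (algebraMap H Ω).injective
  have : CharZero K₁ := charZero_of_injective_algebraMap (algebraMap H K₁).injective
  have : CharZero K₂ := charZero_of_injective_algebraMap (algebraMap H K₂).injective
  set n := (p ^ 2).totient with hn
  have hn0 : n ≠ 0 := (Nat.totient_pos.mpr (pow_pos hp.pos 2)).ne'
  let B := radicals (H := H) n K₁
  let P : Ω → Ω → Prop := fun a b => (∃ c ∈ K₂, c ^ n = b) ∧ ∃ e : ℕ, e ≠ 0 ∧ b ^ e = a ^ e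
  have huniq : ∀ a b b', a ≠ 0 → P a b → P a b' → b = b' := by
    rintro a b b' ha ⟨⟨c, hc, rfl⟩, e, he, hbe⟩ ⟨⟨c', hc', rfl⟩, e', he', hbe'⟩
    have hc0 : c' ≠ 0 := by
      rintro rfl
      rw [zero_pow hn0, zero_pow he'] at hbe'
      exact pow_ne_zero _ ha hbe'.symm
    have hm : (c / c') ^ (n * (e * e')) = 1 := by
      rw [div_pow, pow_mul, pow_mul (c ^ n), hbe, mul_comm e, pow_mul c', pow_mul (c' ^ n), hbe',
        ← pow_mul, ← pow_mul, mul_comm, div_self (pow_ne_zero _ ha)]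
    have h3 : (⟨c / c', div_mem hc hc'⟩ : K₂) ^ n = 1 :=
      h₂.pow_totient_eq_one hp (m := n * (e * e')) (by positivity) (Subtype.ext (by simpa using hm))
    have h4 : (c / c') ^ n = 1 := congrArg Subtype.val h3
    rwa [div_pow, div_eq_one_iff_eq (pow_ne_zero _ hc0)] at h4
  have hex : ∀ a : B, ∃ b, P (a : Ωˣ) b := by
    rintro ⟨a, ⟨c, hc, hca⟩, e, he, x, hx⟩
    obtain ⟨f, hf, hfx⟩ := hpow (n * e) (mul_ne_zero hn0 he) x ⟨c, hc, by rw [pow_mul, hca, hx]⟩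
    exact ⟨f ^ n, ⟨f, hf, rfl⟩, e, he, by rw [← pow_mul, hfx, hx]⟩
  choose φ hφ using hex
  have hφ1 : φ 1 = 1 := huniq 1 _ _ one_ne_zero (hφ 1) ⟨⟨1, one_mem _, by simp⟩, 1, one_ne_zero, by simp⟩
  have hφm : ∀ a b, φ (a * b) = φ a * φ b := by
    intro a b
    refine huniq _ _ _ (a * b : B).1.ne_zero (hφ (a * b)) ?_
    obtain ⟨⟨c, hc, hca⟩, e, he, hae⟩ := hφ a
    obtain ⟨⟨d, hd, hdb⟩, e', he', hbe⟩ := hφ b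
    refine ⟨⟨c * d, mul_mem hc hd, by rw [mul_pow, hca, hdb]⟩, e * e', mul_ne_zero he he', ?_⟩
    rw [Subgroup.coe_mul, Units.val_mul, mul_pow, mul_pow, pow_mul, hae, mul_comm e, pow_mul (φ b),
      hbe, ← pow_mul, ← pow_mul, mul_comm e']
  let Φ : B →* Ω := ⟨⟨φ, hφ1⟩, hφm⟩
  let j : B →* Ω := (Units.coeHom Ω).comp B.subtype
  have hker : ∀ f : MonoidAlgebra H B, MonoidAlgebra.lift H Ω B j f = 0 →
      MonoidAlgebra.lift H Ω B Φ f = 0 := by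
    intro f hf
    rw [MonoidAlgebra.lift_apply'] at hf ⊢
    refine sum_eq_zero_of_dominant V (f₁ := j) (f₂ := Φ) (fun a => a.1.ne_zero) ?_ _ _ hf
    intro a a' h hv
    have ha' : V.valuation (a'.1 : Ω) ≠ 0 := (_root_.map_ne_zero _).mpr a'.1.ne_zero
    obtain ⟨g, hg⟩ := mem_range_of_mem_radicals hst hp h₁.pval (a / a' : B).2 (h := h) (by
      change V.valuation ((a.1 / a'.1 : Ωˣ) : Ω) = _
      rw [Units.val_div_eq_div_val, map_div₀, div_eq_iff ha', ← map_mul]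
      exact hv)
    have hg' : algebraMap H Ω g = (a.1 : Ω) / a'.1 := by
      rw [hg]
      change ((a.1 / a'.1 : Ωˣ) : Ω) = _
      rw [Units.val_div_eq_div_val]
    have hj : j a = algebraMap H Ω g * j a' := by
      rw [hg']
      exact (div_mul_cancel₀ _ a'.1.ne_zero).symm
    refine ⟨g, hj, huniq _ _ _ a.1.ne_zero (hφ a) ?_⟩
    obtain ⟨⟨d, hd, hda⟩, e, he, hae⟩ := hφ a'
    obtain ⟨x, hx, hxg⟩ := hpow n hn0 g (by
      obtain ⟨c, hc, hca⟩ := (a / a' : B).2.1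
      exact ⟨c, hc, by rw [hca, hg]⟩)
    refine ⟨⟨x * d, mul_mem hx hd, by rw [mul_pow, hda, hxg]; rfl⟩, e, he, ?_⟩
    change (algebraMap H Ω g * φ a') ^ e = (j a) ^ e
    rw [hj, mul_pow, mul_pow, hae]
    rfl
  let Φ₁ := MonoidAlgebra.lift H Ω B j
  let Φ₂ := MonoidAlgebra.lift H Ω B Φ
  have hr₂ : ∀ f, Φ₂ f ∈ K₂ := by
    intro f
    change MonoidAlgebra.lift H Ω B Φ f ∈ K₂
    rw [MonoidAlgebra.lift_apply']
    refine sum_mem fun a _ => mul_mem (IntermediateField.algebraMap_mem _ _) ?_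
    obtain ⟨⟨d, hd, hda⟩, -⟩ := hφ a
    change φ a ∈ K₂
    exact hda ▸ pow_mem hd n
  have hr₁ : ∀ f, Φ₁ f ∈ K₁ := by
    intro f
    change MonoidAlgebra.lift H Ω B j f ∈ K₁
    rw [MonoidAlgebra.lift_apply']
    refine sum_mem fun a _ => mul_mem (IntermediateField.algebraMap_mem _ _) ?_
    obtain ⟨⟨d, hd, hda⟩, -⟩ := a.2
    change (a.1 : Ω) ∈ K₁
    exact hda ▸ pow_mem hd n
  have hsurj : ∀ a ∈ K₁, ∃ f, Φ₁ f = a := by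
    intro a ha
    let F : IntermediateField H Ω := Φ₁.range.toIntermediateField fun x hx =>
      Subalgebra.inv_mem_of_algebraic Φ₁.range (x := ⟨x, hx⟩) (Algebra.IsAlgebraic.isAlgebraic x)
    have hFK : F ≤ K₁ := by rintro _ ⟨f, rfl⟩; exact hr₁ f
    have hBF : ∀ b : B, ((b : Ωˣ) : Ω) ∈ F := fun b =>
      ⟨MonoidAlgebra.single b 1, by simp [Φ₁, j]⟩
    have : CharZero F := charZero_of_injective_algebraMap (algebraMap H F).injective
    have : Algebra.IsAlgebraic F Ω := Algebra.IsAlgebraic.tower_top (K := H) F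
    have hstF : GaloisStable F V := fun σ x => hst (σ.restrictScalars H) x
    obtain ⟨⟨c, f, hf⟩, hc⟩ := hstF.mem_range_of_approx (a := a) fun b hb hb0 N hN => by
      have hbK : b ∈ K₁ := by
        have hle : (IntermediateField.restrictScalars H (F⟮a⟯)) ≤ K₁ := by
          rw [IntermediateField.restrictScalars_adjoin, IntermediateField.adjoin_le_iff]
          rintro x (hx | hx)
          · exact hFK hx
          · rw [hx]; exact ha
        exact hle hb
      obtain ⟨c, hc, q, hq⟩ := exists_mem_radicals hst hp h₁ hn0 hbK hb0
      have hbv : V.valuation b ≠ 0 := (_root_.map_ne_zero _).mpr hb0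
      have hqc : (q * (c : Ω)) ≠ 0 := by
        intro h0
        rw [h0, map_zero] at hq
        exact hbv hq
      have hcK : (c : Ω) ∈ K₁ := hFK (hBF ⟨c, hc⟩)
      obtain ⟨r, hr0, hr1, hr⟩ := exists_natCast_sub_lt_of_mem hp h₁.pval
        (x := b / (q * c)) (div_mem hbK (mul_mem (natCast_mem _ _) hcK))
        (by rw [map_div₀, hq, div_self (hq ▸ hbv)]) hN
      have hr0' : (r : Ω) ≠ 0 := Nat.cast_ne_zero.mpr hr0
      refine ⟨⟨r * (q * c), mul_mem (natCast_mem _ _) (mul_mem (natCast_mem _ _)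
        (hBF ⟨c, hc⟩))⟩, ?_⟩
      change V.valuation (b - r * (q * c)) < _
      rw [div_div, Valuation.div_sub_one_lt_iff (mul_ne_zero hqc hr0'), map_mul _ _ (r : Ω), hr1,
        mul_one, ← hq, ← map_mul] at hr
      rwa [mul_comm (r : Ω)]
    exact ⟨f, hf.trans hc⟩
  let Ψ₁ : MonoidAlgebra H B →ₐ[H] K₁ := Φ₁.codRestrict K₁.toSubalgebra hr₁
  let Ψ₂ : MonoidAlgebra H B →ₐ[H] K₂ := Φ₂.codRestrict K₂.toSubalgebra hr₂
  have hΨ : Function.Surjective Ψ₁ := fun a => by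
    obtain ⟨f, hf⟩ := hsurj a a.2
    exact ⟨f, Subtype.ext hf⟩
  exact ⟨AlgHom.liftOfSurjective Ψ₁ hΨ Ψ₂ fun f hf =>
    Subtype.ext (hker f (congrArg Subtype.val hf))⟩

theorem PC.of_ringEquiv {p : ℕ} {F M : Type} [Field F] [CharZero F] [Field M]
    {O : ValuationSubring F} {V : ValuationSubring M} (e : F ≃+* M) (he : ∀ a, e a ∈ V ↔ a ∈ O)
    (h : PC p V) : PC p O := by
  let _ : Algebra F M := e.toRingHom.toAlgebra
  exact h.descend (fun a => he a) fun x _ => ⟨e.symm x, e.apply_symm_apply x⟩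

theorem PVal.exists_sub_le_of_immediate {p : ℕ} {F Z : Type} [Field F] [Field Z] [Algebra F Z]
    {V : ValuationSubring Z} (h : PVal p V)
    (himm : ∀ a : Z, a ≠ 0 → ∃ c : F, V.valuation (algebraMap F Z c - a) < V.valuation a)
    (M : ℕ) (a : Z) : ∃ c : F, V.valuation (a - algebraMap F Z c) ≤ V.valuation (p ^ M * a) := by
  induction M with
  | zero => exact ⟨0, by simp⟩
  | succ M ih =>
    obtain ⟨c, hc⟩ := ih
    rcases eq_or_ne (a - algebraMap F Z c) 0 with h0 | h0
    · exact ⟨c, by rw [h0, map_zero]; exact zero_le⟩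
    obtain ⟨c', hc'⟩ := himm _ h0
    have hv0 : 0 < V.valuation (a - algebraMap F Z c) :=
      zero_lt_iff.mpr ((_root_.map_ne_zero _).mpr h0)
    have hle := h.le ((algebraMap F Z c' - (a - algebraMap F Z c)) / (a - algebraMap F Z c))
      (by rwa [map_div₀, div_lt_one₀ hv0])
    rw [map_div₀, div_le_iff₀ hv0] at hle
    refine ⟨c + c', ?_⟩
    rw [map_add, ← sub_sub, V.valuation.map_sub_swap]
    refine hle.trans ?_
    rw [pow_succ', mul_assoc, map_mul V.valuation (p : Z)]
    exact mul_le_mul_right hc _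

theorem exists_algHom_of_pow {p : ℕ} (hp : p.Prime) {K K₁ K₂ : Type} [Field K] [CharZero K]
    [Field K₁] [Field K₂] [Algebra K K₁] [Algebra K K₂] [Algebra.IsAlgebraic K K₁]
    [Algebra.IsAlgebraic K K₂] {O₁ : ValuationSubring K₁} {O₂ : ValuationSubring K₂}
    (h₁ : PC p O₁) (h₂ : PC p O₂)
    (hpow : ∀ m : ℕ, m ≠ 0 → ∀ a : K, (∃ f : K₁, f ^ m = algebraMap K K₁ a) →
      ∃ f : K₂, f ^ m = algebraMap K K₂ a) : Nonempty (K₁ →ₐ[K] K₂) := by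
  have : CharZero K₁ := charZero_of_injective_algebraMap (algebraMap K K₁).injective
  have : CharZero K₂ := charZero_of_injective_algebraMap (algebraMap K K₂).injective
  have hO₁ : PVal p (O₁.comap (algebraMap K K₁)) := h₁.pval.comap (Z := K₁) fun _ => Iff.rfl
  have hO₂ : PVal p (O₂.comap (algebraMap K K₂)) := h₂.pval.comap (Z := K₂) fun _ => Iff.rfl
  have hO : O₁.comap (algebraMap K K₁) = O₂.comap (algebraMap K K₂) := by
    refine hO₁.eq_of_le hp hO₂ fun x hx => ?_
    obtain ⟨y, hy⟩ := h₁.hensel.exists_pow_eq hp h₁.pval hx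
    obtain ⟨z, hz⟩ := hpow (p + 1) p.succ_ne_zero (1 + p * x ^ (p + 1)) ⟨y, by simpa using hy⟩
    exact h₂.pval.mem_of_pow_eq hp (y := z) (by simpa using hz)
  let Ω := AlgebraicClosure K
  have : CharZero Ω := charZero_of_injective_algebraMap (algebraMap K Ω).injective
  have : IsGalois K Ω := isGalois_of_isAlgClosed K Ω
  let j₁ : K₁ →ₐ[K] Ω := IsAlgClosed.lift
  let ι₂ : K₂ →ₐ[K] Ω := IsAlgClosed.lift
  obtain ⟨W, hW⟩ := @exists_valuationSubring_extension K₁ Ω _ _ j₁.toRingHom.toAlgebra O₁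
  obtain ⟨V, hV₂⟩ := @exists_valuationSubring_extension K₂ Ω _ _ ι₂.toRingHom.toAlgebra O₂
  change ∀ a, j₁ a ∈ W ↔ _ at hW
  change ∀ a, ι₂ a ∈ V ↔ _ at hV₂
  have hVK : ∀ a, algebraMap K Ω a ∈ V ↔ a ∈ O₂.comap (algebraMap K K₂) := fun a => by
    rw [← ι₂.commutes, hV₂]; rfl
  obtain ⟨σ, hσ⟩ := exists_algEquiv_comap_eq hVK (W := W) fun a => by
    rw [← j₁.commutes, hW, ← hO]; rfl
  let ι₁ : K₁ →ₐ[K] Ω := σ.toAlgHom.comp j₁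
  have hV₁ : ∀ a, ι₁ a ∈ V ↔ a ∈ O₁ := fun a => (hσ (j₁ a)).trans (hW a)
  let D : Subgroup Gal(Ω/K) :=
    { carrier := {σ | ∀ x, σ x ∈ V ↔ x ∈ V}
      mul_mem' := fun {a b} ha hb x => by rw [AlgEquiv.mul_apply, ha, hb]
      one_mem' := fun x => Iff.rfl
      inv_mem' := fun {a} ha x => by
        rw [← ha, ← AlgEquiv.mul_apply, mul_inv_cancel]; rfl }
  let H : IntermediateField K Ω := IntermediateField.fixedField D
  have : CharZero H := charZero_of_injective_algebraMap (algebraMap K H).injective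
  have key : ∀ (E : Type) [Field E] [Algebra K E] (O : ValuationSubring E) (h : PC p O)
      (ι : E →ₐ[K] Ω), (∀ a, ι a ∈ V ↔ a ∈ O) → ∃ (E' : IntermediateField H Ω) (e : E' ≃+* E),
        (∀ a, ι (e a) = a) ∧ PC p (V.comap (algebraMap E' Ω)) := by
    intro E _ _ O h ι hι
    have hle : H ≤ ι.fieldRange := by
      intro a ha
      let _ : Algebra E Ω := ι.toRingHom.toAlgebra
      have : IsScalarTower K E Ω := IsScalarTower.of_algebraMap_eq fun x => (ι.commutes x).symm
      have : CharZero E := charZero_of_injective_algebraMap (algebraMap K E).injective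
      have : Algebra.IsAlgebraic E Ω := Algebra.IsAlgebraic.tower_top (K := K) E
      have : IsGalois E Ω := isGalois_of_isAlgClosed E Ω
      have hst : GaloisStable E V := galoisStable_of_henselRoot hι h.hensel
      exact (InfiniteGalois.mem_range_algebraMap_iff_fixed a).mpr fun τ =>
        ha ⟨τ.restrictScalars K, fun x => hst τ x⟩
    let e₀ : E ≃+* ι.fieldRange := (AlgEquiv.ofInjectiveField ι).toRingEquiv
    let e : IntermediateField.extendScalars hle ≃+* E := e₀.symm
    have he : ∀ a, ι (e a) = a := fun a => congrArg Subtype.val (e₀.apply_symm_apply a)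
    have : CharZero (IntermediateField.extendScalars hle) :=
      charZero_of_injective_algebraMap (algebraMap H _).injective
    refine ⟨IntermediateField.extendScalars hle, e, he, h.of_ringEquiv e fun a => ?_⟩
    rw [← hι, he]
    rfl
  obtain ⟨E₁, e₁, he₁, hE₁⟩ := key K₁ O₁ h₁ ι₁ hV₁
  obtain ⟨E₂, e₂, he₂, hE₂⟩ := key K₂ O₂ h₂ ι₂ hV₂
  have hst : GaloisStable H V := galoisStable_of_fixed fun a ha =>
    ⟨⟨a, fun τ => ha { τ.1 with commutes' := fun x => x.2 τ } τ.2⟩, rfl⟩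
  let VH : ValuationSubring H := V.comap (algebraMap H Ω)
  have hVH : ∀ a, algebraMap H Ω a ∈ V ↔ a ∈ VH := fun a => Iff.rfl
  have himm : ∀ x : H, x ≠ 0 → ∃ c : K,
      VH.valuation (algebraMap K H c - x) < VH.valuation x := fun x hx => by
    obtain ⟨c, hc⟩ := exists_sub_lt_of_fixed (F := K) V (a := x) (by simpa using hx)
      fun σ hσ => x.2 ⟨σ, hσ⟩
    exact ⟨c, by rwa [← valuation_comap_lt_iff hVH]⟩
  have hH : PVal p VH := hO₂.of_immediate (fun a => hVK a) fun x hx _ => himm x fun h => by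
    rw [h, map_zero] at hx
    exact not_lt_zero hx
  have hroot : ∀ (E : IntermediateField H Ω), PC p (V.comap (algebraMap E Ω)) →
      ∀ m : ℕ, m ≠ 0 → ∀ u : H, VH.valuation (u - 1) < VH.valuation m ^ m →
        ∃ f ∈ E, f ^ m = algebraMap H Ω u := by
    intro E hE m hm u hu
    have : CharZero E := charZero_of_injective_algebraMap (algebraMap H E).injective
    obtain ⟨y, hy, -⟩ := hE.hensel.exists_root hm (u := algebraMap H E u) (by
      rw [← map_pow, ← valuation_comap_lt_iff (F := H) (Z := E) (O := VH)
        (V := V.comap (algebraMap E Ω)) fun _ => Iff.rfl] at hu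
      simpa using hu)
    exact ⟨y, y.2, congrArg Subtype.val hy⟩
  obtain ⟨φ⟩ := exists_algHom_of_galoisStable hp hst hE₁ hE₂.pval fun m hm h ⟨f, hf, hfh⟩ => by
    rcases eq_or_ne h 0 with rfl | h0
    · exact ⟨0, zero_mem _, by simp [hm]⟩
    obtain ⟨M, hM⟩ := hH.exists_pow_lt hp (pow_ne_zero m hm)
    obtain ⟨a, ha⟩ := hH.exists_sub_le_of_immediate himm M h
    have hu : VH.valuation (algebraMap K H a / h - 1) < VH.valuation m ^ m := by
      rw [Valuation.div_sub_one_lt_iff h0, VH.valuation.map_sub_swap]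
      refine ha.trans_lt ?_
      rw [map_mul, map_pow]
      rw [Nat.cast_pow, map_pow] at hM
      exact mul_lt_mul_of_pos_right hM (zero_lt_iff.mpr ((_root_.map_ne_zero _).mpr h0))
    have h0' : (algebraMap H Ω h) ≠ 0 := by simpa using h0
    obtain ⟨y, hy, hyu⟩ := hroot E₁ hE₁ m hm _ hu
    obtain ⟨z, hz, hzu⟩ := hroot E₂ hE₂ m hm _ hu
    rw [map_div₀, ← IsScalarTower.algebraMap_apply K H Ω] at hyu hzu
    obtain ⟨g, hg⟩ := hpow m hm a ⟨e₁ ⟨f * y, mul_mem hf hy⟩, ι₁.toRingHom.injective (by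
      change ι₁ _ = ι₁ _
      rw [map_pow, he₁, ι₁.commutes, mul_pow, hfh, hyu, mul_div_cancel₀ _ h0'])⟩
    have ha0 : algebraMap K Ω a ≠ 0 := by
      intro h
      rw [h, zero_div] at hyu
      have : VH.valuation (algebraMap K H a) = 0 := by
        rw [show algebraMap K H a = 0 from (algebraMap H Ω).injective (by
          rw [← IsScalarTower.algebraMap_apply, h, map_zero]), map_zero]
      have h1 := Valuation.eq_one_of_sub_one_lt (lt_of_lt_of_le hu
        (pow_le_one₀ zero_le (VH.valuation_natCast_le_one m)))
      rw [map_div₀, this, zero_div] at h1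
      exact zero_ne_one h1
    refine ⟨ι₂ g / z, div_mem ?_ hz, ?_⟩
    · rw [← e₂.apply_symm_apply g, he₂]
      exact (e₂.symm g).2
    · rw [div_pow, ← map_pow, hg, ι₂.commutes, hzu, div_div_cancel₀ ha0]
  refine ⟨⟨(e₂.toRingHom.comp φ.toRingHom).comp e₁.symm.toRingHom, fun a => ?_⟩⟩
  apply ι₂.toRingHom.injective
  change ι₂ (e₂ (φ (e₁.symm (algebraMap K K₁ a)))) = ι₂ _
  have h3 : e₁.symm (algebraMap K K₁ a) = algebraMap H E₁ (algebraMap K H a) := by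
    apply e₁.injective
    apply ι₁.toRingHom.injective
    change ι₁ _ = ι₁ _
    rw [e₁.apply_symm_apply, he₁, ι₁.commutes]
    rfl
  rw [he₂, h3, φ.commutes, ι₂.commutes]
  rfl

theorem PVal.exists_pow_lt_of_comap {p : ℕ} {𝔽 Ω : Type} [Field 𝔽] [CharZero 𝔽] [Field Ω]
    [Algebra 𝔽 Ω] {V : ValuationSubring Ω} (hp : p.Prime) (h : PVal p (V.comap (algebraMap 𝔽 Ω))) {n : ℕ}
    (hn : n ≠ 0) : ∃ k, V.valuation (p : Ω) ^ k < V.valuation (n : Ω) := by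
  obtain ⟨k, hk⟩ := h.exists_pow_lt hp hn
  rw [← map_pow] at hk
  have := (valuation_comap_lt_iff (F := 𝔽) (V := V) (O := V.comap (algebraMap 𝔽 Ω))
    (fun _ => Iff.rfl) _ _).mpr hk
  exact ⟨k, by simpa using this⟩

theorem PVal.valuation_lt_one_of_comap {p : ℕ} {𝔽 Ω : Type} [Field 𝔽] [Field Ω]
    [Algebra 𝔽 Ω] {V : ValuationSubring Ω} (h : PVal p (V.comap (algebraMap 𝔽 Ω))) :
    V.valuation (p : Ω) < 1 := by
  have := (valuation_comap_lt_one (F := 𝔽) (V := V) (O := V.comap (algebraMap 𝔽 Ω))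
    (fun _ => Iff.rfl) _).mpr h.lt
  rwa [map_natCast] at this

section

variable {p : ℕ} {F 𝔽 Ω : Type} [Field F] [Field 𝔽] [CharZero 𝔽] [Field Ω]
  [CharZero Ω] [Algebra F 𝔽] [Algebra 𝔽 Ω] [Algebra F Ω] [IsScalarTower F 𝔽 Ω]
  [Algebra.IsAlgebraic 𝔽 Ω] [IsAlgClosed Ω] {V : ValuationSubring Ω}

/-- The mean and the norm of an algebraic element. -/
theorem GaloisStable.exists_mean_norm (hst : GaloisStable 𝔽 V)
    (hrel : ∀ x : 𝔽, IsAlgebraic F x → x ∈ Set.range (algebraMap F 𝔽)) {α : Ω}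
    (hα : IsAlgebraic F α) : ∃ D : ℕ, D ≠ 0 ∧ ∃ a e : F,
      (∀ t : 𝔽, V.valuation (D * (algebraMap 𝔽 Ω t - algebraMap F Ω a)) ≤
        V.valuation (algebraMap 𝔽 Ω t - α)) ∧
      V.valuation α ^ D = V.valuation (algebraMap F Ω e) := by
  have hfin : FiniteDimensional 𝔽 𝔽⟮α⟯ :=
    IntermediateField.adjoin.finiteDimensional (Algebra.IsIntegral.isIntegral _)
  set D := Module.finrank 𝔽 𝔽⟮α⟯ with hD
  have hD0 : D ≠ 0 := Module.finrank_pos.ne'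
  let z : 𝔽⟮α⟯ := ⟨α, IntermediateField.mem_adjoin_simple_self 𝔽 α⟩
  have : IsScalarTower F 𝔽⟮α⟯ Ω := IsScalarTower.of_algebraMap_eq
    fun _ => rfl
  have hz : IsAlgebraic F z := by
    rw [← isAlgebraic_algebraMap_iff (algebraMap 𝔽⟮α⟯ Ω).injective]
    exact hα
  have hσ : ∀ σ : 𝔽⟮α⟯ →ₐ[𝔽] Ω, σ z ∈ algebraicClosure F Ω := fun σ =>
    mem_algebraicClosure_iff.mpr (hz.algHom (σ.restrictScalars F))
  have hdesc : ∀ x : 𝔽, algebraMap 𝔽 Ω x ∈ algebraicClosure F Ω → ∃ a : F, algebraMap F 𝔽 a = x :=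
    fun x hx => hrel x ((isAlgebraic_algebraMap_iff (algebraMap 𝔽 Ω).injective).mp
      (mem_algebraicClosure_iff.mp hx))
  obtain ⟨a, ha⟩ := hdesc (Algebra.trace 𝔽 _ z) (by
    rw [trace_eq_sum_embeddings Ω]
    exact sum_mem fun σ _ => hσ σ)
  obtain ⟨e, he⟩ := hdesc (Algebra.norm 𝔽 z) (by
    rw [Algebra.norm_eq_prod_embeddings]
    exact prod_mem fun σ _ => hσ σ)
  refine ⟨D, hD0, a / D, e, fun t => ?_, ?_⟩
  · have hD' : (D : Ω) ≠ 0 := Nat.cast_ne_zero.mpr hD0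
    have hsum : ∑ σ : 𝔽⟮α⟯ →ₐ[𝔽] Ω, σ (algebraMap 𝔽 _ t - z) =
        D * (algebraMap 𝔽 Ω t - algebraMap F Ω (a / D)) := by
      simp only [map_sub, Finset.sum_sub_distrib, AlgHom.commutes, Finset.sum_const,
        Finset.card_univ, AlgHom.card, nsmul_eq_mul]
      rw [← trace_eq_sum_embeddings Ω, ← ha, ← IsScalarTower.algebraMap_apply, map_div₀,
        map_natCast, mul_sub, mul_div_cancel₀ _ hD', ← hD]
    rw [← hsum]
    refine V.valuation.map_sum_le fun σ _ => ?_
    rw [hst.valuation_algHom]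
    rfl
  · rw [IsScalarTower.algebraMap_apply F 𝔽 Ω, he, Algebra.norm_eq_prod_embeddings, map_prod,
      Finset.prod_congr rfl fun σ _ => hst.valuation_algHom σ z, Finset.prod_const,
      Finset.card_univ, AlgHom.card]

theorem PC.exists_pow_bounds [CharZero F] (hp : p.Prime) (hst : GaloisStable 𝔽 V)
    (hrel : ∀ x : 𝔽, IsAlgebraic F x → x ∈ Set.range (algebraMap F 𝔽))
    (h : PC p (V.comap (algebraMap 𝔽 Ω))) {n : ℕ} (hn : n ≠ 0) {α : Ω} (hα : IsAlgebraic F α)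
    (hα0 : α ≠ 0) : ∃ (w : F) (k : ℕ), w ≠ 0 ∧
      V.valuation (p ^ k * algebraMap F Ω w ^ n) ≤ V.valuation α ∧
      V.valuation α ≤ V.valuation (algebraMap F Ω w ^ n) := by
  obtain ⟨D, hD, -, e, -, he⟩ := hst.exists_mean_norm hrel hα
  have hF : PC p (V.comap (algebraMap F Ω)) := h.descend (fun x => by
    change algebraMap 𝔽 Ω _ ∈ V ↔ algebraMap F Ω x ∈ V
    rw [← IsScalarTower.algebraMap_apply]) hrel
  obtain ⟨Q, hQ⟩ := hF.decomp (n * D) (mul_ne_zero hn hD)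
  have he0 : e ≠ 0 := by
    rintro rfl
    rw [map_zero, map_zero] at he
    exact pow_ne_zero _ ((_root_.map_ne_zero _).mpr hα0) he
  obtain ⟨q, hq, -, w, rfl⟩ := hQ e he0
  have hw : w ≠ 0 := by
    rintro rfl
    exact he0 (by rw [zero_pow (mul_ne_zero hn hD), mul_zero])
  obtain ⟨k, hk⟩ := h.pval.exists_pow_lt_of_comap hp hq
  rw [map_mul, map_pow, map_natCast, pow_mul, map_mul, map_pow V.valuation] at he
  refine ⟨w, k, hw, ?_, ?_⟩
  · refine le_of_pow_le_pow_left₀ hD zero_le ?_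
    rw [he, map_mul, mul_pow, map_pow]
    refine mul_le_mul_left ((pow_le_of_le_one zero_le ?_ hD).trans hk.le) _
    rw [← map_pow]
    exact_mod_cast V.valuation_natCast_le_one _
  · refine le_of_pow_le_pow_left₀ hD zero_le ?_
    rw [he]
    exact mul_le_of_le_one_left zero_le (V.valuation_natCast_le_one q)

end

section

variable {p : ℕ} {F 𝔽 Ω : Type} [Field F] [CharZero F] [Field 𝔽] [CharZero 𝔽] [Field Ω]
  [CharZero Ω] [Algebra F 𝔽] [Algebra 𝔽 Ω] [Algebra F Ω] [IsScalarTower F 𝔽 Ω]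
  [Algebra.IsAlgebraic 𝔽 Ω] [IsAlgClosed Ω] {V : ValuationSubring Ω}

theorem PC.valuation_gap (hp : p.Prime) (hst : GaloisStable 𝔽 V)
    (hrel : ∀ x : 𝔽, IsAlgebraic F x → x ∈ Set.range (algebraMap F 𝔽))
    (h : PC p (V.comap (algebraMap 𝔽 Ω))) {t : 𝔽} (ht0 : t ≠ 0)
    (ht : ∀ e : F, V.valuation (algebraMap 𝔽 Ω t) ≠ V.valuation (algebraMap F Ω e)) {α : Ω}
    (hα : IsAlgebraic F α) (N : ℕ) : V.valuation α < V.valuation (p ^ N * algebraMap 𝔽 Ω t) ∨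
      V.valuation (algebraMap 𝔽 Ω t) < V.valuation (p ^ N * α) := by
  have hp0 : (p : Ω) ≠ 0 := Nat.cast_ne_zero.mpr hp.ne_zero
  have ht0' : algebraMap 𝔽 Ω t ≠ 0 := by simpa using ht0
  rcases eq_or_ne α 0 with rfl | hα0
  · left
    rw [map_zero, zero_lt_iff, _root_.map_ne_zero]
    exact mul_ne_zero (pow_ne_zero _ hp0) ht0'
  by_contra! hcon
  obtain ⟨h1, h2⟩ := hcon
  obtain ⟨w, k, hw, hk1, hk2⟩ := h.exists_pow_bounds hp hst hrel one_ne_zero hα hα0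
  rw [pow_one] at hk1 hk2
  have hw' : V.valuation (algebraMap F Ω w) ≠ 0 := by simpa using hw
  let x : 𝔽 := p ^ N * t / algebraMap F 𝔽 w
  have hx : algebraMap 𝔽 Ω x = p ^ N * algebraMap 𝔽 Ω t / algebraMap F Ω w := by
    simp [x, ← IsScalarTower.algebraMap_apply]
  have hcmp := valuation_comap_le_iff (F := 𝔽) (V := V) (O := V.comap (algebraMap 𝔽 Ω))
    (fun _ => Iff.rfl)
  obtain ⟨j, hj⟩ := h.pval.exists_eq_pow hp (N + k + N) x (by
    rw [← map_pow, ← hcmp, hx, map_div₀, le_div_iff₀ (zero_lt_iff.mpr hw'), map_pow, map_natCast,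
      ← map_mul, pow_add, pow_add, mul_comm (p ^ N * p ^ k : Ω), mul_assoc, mul_assoc,
      map_mul V.valuation ((p : Ω) ^ N), map_mul V.valuation ((p : Ω) ^ N), map_mul V.valuation ((p : Ω) ^ N)]
    refine mul_le_mul_right (le_trans ?_ h2) _
    rw [map_mul V.valuation ((p : Ω) ^ N)]
    exact mul_le_mul_right hk1 _) (by
    rw [← map_one (V.comap (algebraMap 𝔽 Ω)).valuation, ← hcmp, hx, map_one, map_one, map_div₀]
    exact div_le_one_of_le₀ (h1.trans hk2) zero_le)
  have hj' : V.valuation (algebraMap 𝔽 Ω x) = V.valuation (p ^ j) := by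
    rw [← map_pow] at hj
    have := le_antisymm ((hcmp _ _).mpr hj.le) ((hcmp _ _).mpr hj.ge)
    simpa using this
  refine ht (p ^ j * w / p ^ N) ?_
  have : algebraMap 𝔽 Ω t = algebraMap 𝔽 Ω x * algebraMap F Ω w / p ^ N := by
    have : algebraMap F Ω w ≠ 0 := by simpa using hw
    rw [hx]
    field_simp
  rw [this, map_div₀, map_mul, hj', ← map_mul, ← map_div₀]
  simp

theorem PC.exists_pow_between (hp : p.Prime) (hst : GaloisStable 𝔽 V)
    (hrel : ∀ x : 𝔽, IsAlgebraic F x → x ∈ Set.range (algebraMap F 𝔽))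
    (h : PC p (V.comap (algebraMap 𝔽 Ω))) {t : 𝔽} (ht0 : t ≠ 0)
    (ht : ∀ e : F, V.valuation (algebraMap 𝔽 Ω t) ≠ V.valuation (algebraMap F Ω e)) {n q : ℕ}
    (hn : n ≠ 0) (hq : q ≠ 0) (M : ℕ) (S : Finset Ω) (hS : ∀ α ∈ S, IsAlgebraic F α) :
    ∃ z : F, z ≠ 0 ∧ ∀ α ∈ S,
      (V.valuation α < V.valuation (algebraMap 𝔽 Ω t) →
        V.valuation α < V.valuation (p ^ M * (q * algebraMap F Ω z ^ n))) ∧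
      (V.valuation (algebraMap 𝔽 Ω t) < V.valuation α →
        V.valuation (q * algebraMap F Ω z ^ n) < V.valuation (p ^ M * α)) := by
  classical
  have hp0 : (p : Ω) ≠ 0 := Nat.cast_ne_zero.mpr hp.ne_zero
  have hpF : (p : F) ≠ 0 := Nat.cast_ne_zero.mpr hp.ne_zero
  have hq0 : (q : Ω) ≠ 0 := Nat.cast_ne_zero.mpr hq
  have ht0' : 0 < V.valuation (algebraMap 𝔽 Ω t) := by simpa [zero_lt_iff] using ht0
  have hv0 : ∀ x : Ω, x ≠ 0 → 0 < V.valuation x := fun x hx => by simpa [zero_lt_iff] using hx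
  have hp1 := h.pval.valuation_lt_one_of_comap
  have hgap := fun α hα N => h.valuation_gap hp hst hrel ht0 ht (α := α) (hS α hα) N
  obtain ⟨k, hk⟩ := h.pval.exists_pow_lt_of_comap hp hq
  have hpN : ∀ (N : ℕ) (x : Ω), V.valuation (p ^ N * x) ≤ V.valuation x := fun N x => by
    rw [map_mul, map_pow]
    exact mul_le_of_le_one_left zero_le (pow_le_one₀ zero_le hp1.le)
  let A := S.filter fun α => α ≠ 0 ∧ V.valuation α < V.valuation (algebraMap 𝔽 Ω t)
  let B := S.filter fun α => V.valuation (algebraMap 𝔽 Ω t) < V.valuation α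
  rcases A.eq_empty_or_nonempty with hA | hA
  · have hA' : ∀ α ∈ S, V.valuation α < V.valuation (algebraMap 𝔽 Ω t) → α = 0 := by
      intro α hα hlt
      by_contra h0
      exact Finset.eq_empty_iff_forall_notMem.mp hA α (Finset.mem_filter.mpr ⟨hα, h0, hlt⟩)
    have hAz : ∀ z : F, z ≠ 0 → ∀ α ∈ S, V.valuation α < V.valuation (algebraMap 𝔽 Ω t) →
        V.valuation α < V.valuation (p ^ M * (q * algebraMap F Ω z ^ n)) := by
      intro z hz α hα hlt
      rw [hA' α hα hlt, map_zero]
      have : algebraMap F Ω z ≠ 0 := by simpa using hz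
      exact hv0 _ (by positivity)
    rcases B.eq_empty_or_nonempty with hB | hB
    · exact ⟨1, one_ne_zero, fun α hα => ⟨hAz 1 one_ne_zero α hα, fun hlt => absurd
        (Finset.mem_filter.mpr ⟨hα, hlt⟩) (Finset.eq_empty_iff_forall_notMem.mp hB α)⟩⟩
    obtain ⟨β, hβ, hmin⟩ := B.exists_min_image V.valuation hB
    obtain ⟨hβS, hβt⟩ := Finset.mem_filter.mp hβ
    obtain ⟨w, l, hw, hl, -⟩ := h.exists_pow_bounds hp hst hrel hn (hS β hβS)
      (fun h0 => by simp [h0] at hβt)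
    have hz : p ^ (M + l + 1) * w ≠ 0 := mul_ne_zero (pow_ne_zero _ hpF) hw
    have hw0 : algebraMap F Ω w ≠ 0 := by simpa using hw
    refine ⟨p ^ (M + l + 1) * w, hz, fun α hα => ⟨hAz _ hz α hα, fun hlt => ?_⟩⟩
    calc V.valuation (q * algebraMap F Ω (p ^ (M + l + 1) * w) ^ n)
        ≤ V.valuation (algebraMap F Ω (p ^ (M + l + 1) * w) ^ n) := by
          rw [map_mul]
          exact mul_le_of_le_one_left zero_le (V.valuation_natCast_le_one q)
      _ = V.valuation (p : Ω) ^ ((M + l + 1) * n) * V.valuation (algebraMap F Ω w ^ n) := by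
          simp [mul_pow, pow_mul]
      _ < V.valuation (p : Ω) ^ (M + l) * V.valuation (algebraMap F Ω w ^ n) := by
          refine mul_lt_mul_of_pos_right (pow_lt_pow_right_of_lt_one₀ (hv0 _ hp0) hp1 ?_)
            (hv0 _ (pow_ne_zero _ hw0))
          calc M + l < M + l + 1 := Nat.lt_succ_self _
            _ ≤ (M + l + 1) * n := Nat.le_mul_of_pos_right _ (Nat.pos_of_ne_zero hn)
      _ = V.valuation (p : Ω) ^ M * V.valuation (p ^ l * algebraMap F Ω w ^ n) := by
          simp [pow_add, mul_assoc]
      _ ≤ V.valuation (p : Ω) ^ M * V.valuation α :=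
          mul_le_mul_right (hl.trans (hmin α (Finset.mem_filter.mpr ⟨hα, hlt⟩))) _
      _ = _ := by simp
  · obtain ⟨β, hβ, hmax⟩ := A.exists_max_image V.valuation hA
    obtain ⟨hβS, hβ0, hβt⟩ := Finset.mem_filter.mp hβ
    obtain ⟨w, l, hw, hl1, hl2⟩ := h.exists_pow_bounds hp hst hrel hn (hS β hβS) hβ0
    have hw0 : algebraMap F Ω w ≠ 0 := by simpa using hw
    have hz : w / p ^ (M + k) ≠ 0 := div_ne_zero hw (pow_ne_zero _ hpF)
    have hc0 : (q * algebraMap F Ω (w / p ^ (M + k)) ^ n) ≠ 0 := by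
      have : algebraMap F Ω (w / p ^ (M + k)) ≠ 0 := by simpa using hz
      positivity
    have hc : (p : Ω) ^ ((M + k) * n) * (q * algebraMap F Ω (w / p ^ (M + k)) ^ n) =
        q * algebraMap F Ω w ^ n := by
      rw [map_div₀, map_pow, map_natCast, pow_mul, mul_left_comm, div_pow,
        mul_div_cancel₀ _ (pow_ne_zero _ (pow_ne_zero _ hp0))]
    refine ⟨w / p ^ (M + k), hz, fun α hα => ⟨fun hlt => ?_, fun hlt => ?_⟩⟩
    · rcases eq_or_ne α 0 with rfl | hα0
      · rw [map_zero]
        exact hv0 _ (mul_ne_zero (pow_ne_zero _ hp0) hc0)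
      refine (hmax α (Finset.mem_filter.mpr ⟨hα, hα0, hlt⟩)).trans_lt (hl2.trans_lt ?_)
      have hpk : 0 < V.valuation (p : Ω) ^ k := pow_pos (hv0 _ hp0) k
      refine lt_of_mul_lt_mul_left (a := V.valuation (p : Ω) ^ k) ?_ zero_le
      calc V.valuation (p : Ω) ^ k * V.valuation (algebraMap F Ω w ^ n)
          < V.valuation (q : Ω) * V.valuation (algebraMap F Ω w ^ n) :=
            mul_lt_mul_of_pos_right hk (hv0 _ (pow_ne_zero _ hw0))
        _ = V.valuation (p : Ω) ^ ((M + k) * n) *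
              V.valuation (q * algebraMap F Ω (w / p ^ (M + k)) ^ n) := by
            rw [← map_pow V.valuation, ← map_mul, ← map_mul, hc]
        _ ≤ V.valuation (p : Ω) ^ (M + k) *
              V.valuation (q * algebraMap F Ω (w / p ^ (M + k)) ^ n) :=
            mul_le_mul_left (pow_le_pow_right_of_le_one' hp1.le
              (Nat.le_mul_of_pos_right _ (Nat.pos_of_ne_zero hn))) _
        _ = _ := by
            rw [← map_pow V.valuation, ← map_pow V.valuation, ← map_mul, ← map_mul]
            congr 1
            ring
    · have h1 : V.valuation β < V.valuation (p ^ ((M + k) * n + l) * algebraMap 𝔽 Ω t) := by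
        refine (hgap β hβS _).resolve_right fun h => ?_
        exact (h.trans_le (hpN _ _)).not_gt hβt
      have h2 : V.valuation (algebraMap 𝔽 Ω t) < V.valuation (p ^ M * α) := by
        refine (hgap α hα M).resolve_left fun h => ?_
        exact (h.trans_le (hpN _ _)).not_gt hlt
      refine lt_trans ?_ h2
      have hpk : 0 < V.valuation (p : Ω) ^ ((M + k) * n + l) := pow_pos (hv0 _ hp0) _
      refine lt_of_mul_lt_mul_left (a := V.valuation (p : Ω) ^ ((M + k) * n + l)) ?_ zero_le
      calc V.valuation (p : Ω) ^ ((M + k) * n + l) *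
            V.valuation (q * algebraMap F Ω (w / p ^ (M + k)) ^ n)
          = V.valuation (q : Ω) * V.valuation (p ^ l * algebraMap F Ω w ^ n) := by
            rw [← map_pow V.valuation, ← map_mul, ← map_mul, pow_add, mul_right_comm, hc]
            congr 1
            ring
        _ ≤ V.valuation (p ^ l * algebraMap F Ω w ^ n) :=
            mul_le_of_le_one_left zero_le (V.valuation_natCast_le_one q)
        _ ≤ V.valuation β := hl1
        _ < _ := by rwa [← map_pow, ← map_mul]

end

section

variable {p : ℕ} {F 𝔽 Ω : Type} [Field F] [CharZero F] [Field 𝔽] [CharZero 𝔽] [Field Ω]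
  [CharZero Ω] [Algebra F 𝔽] [Algebra 𝔽 Ω] [Algebra F Ω] [IsScalarTower F 𝔽 Ω]
  [Algebra.IsAlgebraic 𝔽 Ω] [IsAlgClosed Ω] {V : ValuationSubring Ω}

theorem PC.exists_sub_div_of_ne_valuation (hp : p.Prime) (hst : GaloisStable 𝔽 V)
    (hrel : ∀ x : 𝔽, IsAlgebraic F x → x ∈ Set.range (algebraMap F 𝔽))
    (h : PC p (V.comap (algebraMap 𝔽 Ω))) {t : 𝔽}
    (ht : ∀ e : F, V.valuation (algebraMap 𝔽 Ω t) ≠ V.valuation (algebraMap F Ω e)) {n : ℕ}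
    (hn : n ≠ 0) (M : ℕ) (S : Finset Ω) (hS : ∀ α ∈ S, IsAlgebraic F α) :
    ∃ (c : F) (r : 𝔽), r ≠ 0 ∧ ∀ α ∈ S,
      V.valuation ((algebraMap F Ω c - α) / (algebraMap 𝔽 Ω t - α) - 1) < V.valuation (p : Ω) ^ M ∨
      V.valuation ((algebraMap F Ω c - α) / (algebraMap 𝔽 Ω r ^ n * (algebraMap 𝔽 Ω t - α)) - 1) <
        V.valuation (p : Ω) ^ M := by
  have hp0 : (p : Ω) ≠ 0 := Nat.cast_ne_zero.mpr hp.ne_zero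
  have hp1 := h.pval.valuation_lt_one_of_comap
  have hγ : V.valuation (p : Ω) ^ M ≤ 1 := pow_le_one₀ zero_le hp1.le
  have ht0 : t ≠ 0 := by
    rintro rfl
    exact ht 0 (by simp)
  obtain ⟨Q, hQ⟩ := h.decomp n hn
  obtain ⟨q, hq, -, y, hy⟩ := hQ t ht0
  obtain ⟨z, hz, hzS⟩ := h.exists_pow_between hp hst hrel ht0 ht hn hq M S hS
  have hy0 : y ≠ 0 := by
    rintro rfl
    rw [zero_pow hn, mul_zero] at hy
    exact ht0 hy
  have hz0 : algebraMap F 𝔽 z ≠ 0 := by simpa using hz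
  have hr0 : algebraMap F 𝔽 z / y ≠ 0 := div_ne_zero hz0 hy0
  refine ⟨q * z ^ n, algebraMap F 𝔽 z / y, hr0, fun α hα => ?_⟩
  set T := algebraMap 𝔽 Ω t with hT
  set c := algebraMap F Ω (q * z ^ n) with hc
  set R := algebraMap 𝔽 Ω (algebraMap F 𝔽 z / y) ^ n with hR
  have hT0 : T ≠ 0 := by simpa [hT] using ht0
  have hR0 : R ≠ 0 := pow_ne_zero _ (by simpa using hr0)
  have hcR : c = R * T := by
    rw [hc, hR, hT, hy, ← map_pow, ← map_mul, IsScalarTower.algebraMap_apply F 𝔽 Ω]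
    congr 1
    rw [map_mul, map_pow, map_natCast, mul_left_comm, ← mul_pow, div_mul_cancel₀ _ hy0]
  have hc0 : c ≠ 0 := hcR ▸ mul_ne_zero hR0 hT0
  have hc' : (q * algebraMap F Ω z ^ n : Ω) = c := by simp [hc]
  obtain ⟨h1, h2⟩ := hzS α hα
  rw [hc'] at h1 h2
  have hpM : ∀ x : Ω, V.valuation (p ^ M * x) = V.valuation (p : Ω) ^ M * V.valuation x :=
    fun x => by rw [map_mul, map_pow]
  have hpN : ∀ x : Ω, V.valuation (p ^ M * x) ≤ V.valuation x := fun x => by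
    rw [hpM]
    exact mul_le_of_le_one_left zero_le hγ
  have key : ∀ x w : Ω, w ≠ 0 → V.valuation x < V.valuation (p ^ M * w) →
      V.valuation ((w - x) / w - 1) < V.valuation (p : Ω) ^ M := by
    intro x w hw hlt
    rw [Valuation.div_sub_one_lt_iff hw, sub_sub_cancel_left, Valuation.map_neg, ← hpM]
    exact hlt
  rcases h.valuation_gap hp hst hrel ht0 ht (hS α hα) M with hlt | hlt
  · right
    have h3 := Valuation.div_sub_one_lt hγ (key _ _ hc0 (h1 (hlt.trans_le (hpN _))))
      (key _ _ hT0 hlt)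
    convert h3 using 3
    rw [hcR]
    field_simp
  · left
    have hα0 : α ≠ 0 := by
      rintro rfl
      simp at hlt
    have h3 := Valuation.div_sub_one_lt hγ (key _ _ hα0 (h2 (hlt.trans_le (hpN _))))
      (key _ _ hα0 hlt)
    convert h3 using 3
    rw [div_div_div_cancel_right₀ hα0, ← neg_sub, ← neg_sub α T, neg_div_neg_eq]

theorem PC.exists_sub_div (hp : p.Prime) (hst : GaloisStable 𝔽 V)
    (hrel : ∀ x : 𝔽, IsAlgebraic F x → x ∈ Set.range (algebraMap F 𝔽))
    (h : PC p (V.comap (algebraMap 𝔽 Ω))) {t : 𝔽} (ht : t ∉ Set.range (algebraMap F 𝔽)) {n : ℕ}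
    (hn : n ≠ 0) (M : ℕ) (S : Finset Ω) (hS : ∀ α ∈ S, IsAlgebraic F α) :
    ∃ (c : F) (r : 𝔽), r ≠ 0 ∧ ∀ α ∈ S,
      V.valuation ((algebraMap F Ω c - α) / (algebraMap 𝔽 Ω t - α) - 1) < V.valuation (p : Ω) ^ M ∨
      V.valuation ((algebraMap F Ω c - α) / (algebraMap 𝔽 Ω r ^ n * (algebraMap 𝔽 Ω t - α)) - 1) <
        V.valuation (p : Ω) ^ M := by
  classical
  have hp0 : (p : Ω) ≠ 0 := Nat.cast_ne_zero.mpr hp.ne_zero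
  have hp1 := h.pval.valuation_lt_one_of_comap
  have htow := IsScalarTower.algebraMap_apply F 𝔽 Ω
  have htα : ∀ α : Ω, IsAlgebraic F α → algebraMap 𝔽 Ω t - α ≠ 0 := by
    intro α hα h0
    rw [← sub_eq_zero.mp h0, isAlgebraic_algebraMap_iff (algebraMap 𝔽 Ω).injective] at hα
    exact ht (hrel t hα)
  have hpos : ∀ α : Ω, IsAlgebraic F α → 0 < V.valuation (algebraMap 𝔽 Ω t - α) := fun α hα => by
    simpa [zero_lt_iff] using htα α hα
  have hpM : ∀ (N : ℕ) (x : Ω), V.valuation (p ^ N * x) = V.valuation (p : Ω) ^ N * V.valuation x :=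
    fun N x => by rw [map_mul, map_pow]
  by_cases hA : ∃ a : F, ∀ α ∈ S, V.valuation (algebraMap 𝔽 Ω t - algebraMap F Ω a) <
      V.valuation (p ^ M * (algebraMap 𝔽 Ω t - α))
  · obtain ⟨a, ha⟩ := hA
    refine ⟨a, 1, one_ne_zero, fun α hα => Or.inl ?_⟩
    rw [Valuation.div_sub_one_lt_iff (htα α (hS α hα)), sub_sub_sub_cancel_right,
      Valuation.map_sub_swap, ← hpM]
    exact ha α hα
  by_cases hB : ∃ a : F, ∀ e : F, V.valuation (algebraMap 𝔽 Ω t - algebraMap F Ω a) ≠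
      V.valuation (algebraMap F Ω e)
  · obtain ⟨a, ha⟩ := hB
    have hsub : algebraMap 𝔽 Ω (t - algebraMap F 𝔽 a) = algebraMap 𝔽 Ω t - algebraMap F Ω a := by
      rw [map_sub, ← htow]
    obtain ⟨c, r, hr, hcr⟩ := h.exists_sub_div_of_ne_valuation hp hst hrel
      (t := t - algebraMap F 𝔽 a) (by rwa [hsub]) hn M
      (S.image fun α => α - algebraMap F Ω a) (by
        intro β hβ
        obtain ⟨α, hα, rfl⟩ := Finset.mem_image.mp hβ
        exact (hS α hα).sub (isAlgebraic_algebraMap a))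
    refine ⟨c + a, r, hr, fun α hα => ?_⟩
    have := hcr _ (Finset.mem_image_of_mem _ hα)
    rw [hsub, sub_sub_sub_cancel_right, sub_sub_eq_add_sub, ← map_add] at this
    exact this
  push Not at hB
  exfalso
  have himp : ∀ (a : F) (N : ℕ), ∃ b : F, V.valuation (algebraMap 𝔽 Ω t - algebraMap F Ω b) ≤
      V.valuation (p : Ω) ^ N * V.valuation (algebraMap 𝔽 Ω t - algebraMap F Ω a) := by
    intro a N
    obtain ⟨e, he⟩ := hB a
    have he0 : algebraMap F Ω e ≠ 0 := by
      intro h0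
      rw [h0, map_zero] at he
      exact (hpos _ (isAlgebraic_algebraMap a)).ne' he
    have heF : algebraMap F 𝔽 e ≠ 0 := by
      intro h0
      exact he0 (by rw [htow, h0, map_zero])
    let u : 𝔽 := (t - algebraMap F 𝔽 a) / algebraMap F 𝔽 e
    have hu : algebraMap 𝔽 Ω u = (algebraMap 𝔽 Ω t - algebraMap F Ω a) / algebraMap F Ω e := by
      simp only [u, map_div₀, map_sub, ← htow]
    have huO : u ∈ V.comap (algebraMap 𝔽 Ω) := by
      change algebraMap 𝔽 Ω u ∈ V
      rw [← V.valuation_le_one_iff, hu, map_div₀, he, div_self]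
      simpa using he0
    obtain ⟨r, -, hr⟩ := h.pval.exists_natCast_sub_le hp N u huO
    rw [← map_pow] at hr
    have hr' := (valuation_comap_le_iff (F := 𝔽) (V := V) (O := V.comap (algebraMap 𝔽 Ω))
      (fun _ => Iff.rfl) _ _).mpr hr
    rw [map_sub, hu, map_natCast, map_pow, map_natCast, map_pow] at hr'
    refine ⟨a + r * e, ?_⟩
    have : algebraMap 𝔽 Ω t - algebraMap F Ω (a + r * e) =
        ((algebraMap 𝔽 Ω t - algebraMap F Ω a) / algebraMap F Ω e - r) * algebraMap F Ω e := by
      simp only [map_add, map_mul, map_natCast]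
      field_simp
      ring
    rw [this, map_mul, he]
    exact mul_le_mul_left hr' _
  have hclose : ∀ α ∈ S, ∃ a : F, V.valuation (algebraMap 𝔽 Ω t - algebraMap F Ω a) <
      V.valuation (p ^ M * (algebraMap 𝔽 Ω t - α)) := by
    intro α hα
    obtain ⟨D, hD, a, -, ha, -⟩ := hst.exists_mean_norm hrel (hS α hα)
    obtain ⟨k, hk⟩ := h.pval.exists_pow_lt_of_comap hp hD
    obtain ⟨b, hb⟩ := himp a (k + M)
    refine ⟨b, hb.trans_lt ?_⟩
    rw [hpM, pow_add, mul_comm (V.valuation (p : Ω) ^ k), mul_assoc]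
    refine mul_lt_mul_of_pos_left ?_ (pow_pos (by simpa [zero_lt_iff] using hp0) _)
    refine lt_of_lt_of_le ?_ (ha t)
    rw [map_mul]
    exact mul_lt_mul_of_pos_right hk (hpos _ (isAlgebraic_algebraMap a))
  rcases S.eq_empty_or_nonempty with rfl | hne
  · exact hA ⟨0, by simp⟩
  choose! a ha using hclose
  obtain ⟨β, hβ, hmin⟩ := S.exists_min_image
    (fun α => V.valuation (algebraMap 𝔽 Ω t - α)) hne
  refine hA ⟨a β, fun α hα => (ha β hβ).trans_le ?_⟩
  rw [hpM, hpM]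
  exact mul_le_mul_right (hmin α hα) _

end

section

variable {p : ℕ} {F 𝔽 Ω : Type} [Field F] [CharZero F] [Field 𝔽] [CharZero 𝔽] [Field Ω]
  [CharZero Ω] [Algebra F 𝔽] [Algebra 𝔽 Ω] [Algebra F Ω] [IsScalarTower F 𝔽 Ω]
  [Algebra.IsAlgebraic 𝔽 Ω] [IsAlgClosed Ω] {V : ValuationSubring Ω}

theorem PC.exists_eval_eq_pow_mul (hp : p.Prime) (hst : GaloisStable 𝔽 V)
    (hrel : ∀ x : 𝔽, IsAlgebraic F x → x ∈ Set.range (algebraMap F 𝔽))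
    (h : PC p (V.comap (algebraMap 𝔽 Ω))) {t : 𝔽} (ht : t ∉ Set.range (algebraMap F 𝔽)) {n : ℕ}
    (hn : n ≠ 0) (hs : Finset F[X]) (hs0 : ∀ f ∈ hs, f ≠ 0) :
    ∃ c : F, ∀ f ∈ hs, ∃ s : 𝔽, s ≠ 0 ∧ algebraMap F 𝔽 (f.eval c) = s ^ n * aeval t f := by
  classical
  have hp1 := h.pval.valuation_lt_one_of_comap
  obtain ⟨M, hM⟩ := h.pval.exists_pow_lt_of_comap hp (pow_ne_zero n hn)
  have hγ : V.valuation (p : Ω) ^ M ≤ 1 := pow_le_one₀ zero_le hp1.le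
  have hγ0 : 0 < V.valuation (p : Ω) ^ M := by
    have hp0 : (p : Ω) ≠ 0 := Nat.cast_ne_zero.mpr hp.ne_zero
    exact pow_pos (by simpa [zero_lt_iff] using hp0) _
  let S : Finset Ω := hs.biUnion fun f => (f.aroots Ω).toFinset
  have hSalg : ∀ α ∈ S, IsAlgebraic F α := by
    intro α hα
    obtain ⟨f, hf, hα⟩ := Finset.mem_biUnion.mp hα
    rw [Multiset.mem_toFinset, mem_aroots] at hα
    exact ⟨f, hα⟩
  obtain ⟨c, r, hr, hcr⟩ := h.exists_sub_div hp hst hrel ht hn M S hSalg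
  have hr' : algebraMap 𝔽 Ω r ^ n ≠ 0 := pow_ne_zero _ (by simpa using hr)
  have htα : ∀ α ∈ S, algebraMap 𝔽 Ω t - α ≠ 0 := by
    intro α hα h0
    have := hSalg α hα
    rw [← sub_eq_zero.mp h0, isAlgebraic_algebraMap_iff (algebraMap 𝔽 Ω).injective] at this
    exact ht (hrel t this)
  have hprod : ∀ m : Multiset Ω, (∀ α ∈ m, α ∈ S) → ∃ (s : 𝔽) (u : Ω), s ≠ 0 ∧
      V.valuation (u - 1) < V.valuation (p : Ω) ^ M ∧
      (m.map fun α => algebraMap F Ω c - α).prod =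
        algebraMap 𝔽 Ω s ^ n * (m.map fun α => algebraMap 𝔽 Ω t - α).prod * u := by
    intro m
    induction m using Multiset.induction_on with
    | empty => exact fun _ => ⟨1, 1, one_ne_zero, by simpa using hγ0, by simp⟩
    | cons α m ih =>
      intro hm
      obtain ⟨s, u, hs, hu, hsu⟩ := ih fun β hβ => hm β (Multiset.mem_cons_of_mem hβ)
      have hαS := hm α (Multiset.mem_cons_self _ _)
      have ha := htα α hαS
      rw [Multiset.map_cons, Multiset.prod_cons, Multiset.map_cons, Multiset.prod_cons, hsu]
      rcases hcr α hαS with hw | hw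
      · refine ⟨s, _, hs, Valuation.mul_sub_one_lt hγ hu hw, ?_⟩
        field_simp
      · refine ⟨s * r, _, mul_ne_zero hs hr, Valuation.mul_sub_one_lt hγ hu hw, ?_⟩
        rw [map_mul, mul_pow]
        field_simp
  refine ⟨c, fun f hf => ?_⟩
  have hft : aeval t f ≠ 0 := fun h0 => ht (hrel t ⟨f, hs0 f hf, h0⟩)
  obtain ⟨s, u, hs, hu, hsu⟩ := hprod (f.aroots Ω) fun α hα =>
    Finset.mem_biUnion.mpr ⟨f, hf, Multiset.mem_toFinset.mpr hα⟩
  have hsplit := IsAlgClosed.splits (f.map (algebraMap F Ω))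
  have hval : algebraMap F Ω (f.eval c) = algebraMap 𝔽 Ω s ^ n * algebraMap 𝔽 Ω (aeval t f) * u := by
    rw [← aeval_algebraMap_apply, hsplit.aeval_eq_prod_aroots, mul_left_comm,
      mul_assoc (algebraMap F Ω _), ← hsu, ← hsplit.aeval_eq_prod_aroots,
      aeval_algebraMap_apply, aeval_def, Algebra.algebraMap_self, eval₂_id]
  let u' : 𝔽 := algebraMap F 𝔽 (f.eval c) / (s ^ n * aeval t f)
  have hden : s ^ n * aeval t f ≠ 0 := mul_ne_zero (pow_ne_zero _ hs) hft
  have hu' : algebraMap 𝔽 Ω u' = u := by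
    have : algebraMap 𝔽 Ω (s ^ n * aeval t f) ≠ 0 := by simpa using hden
    rw [map_div₀, div_eq_iff this, ← IsScalarTower.algebraMap_apply, hval, map_mul, map_pow,
      mul_comm]
  have hlt : (V.comap (algebraMap 𝔽 Ω)).valuation (u' - 1) <
      (V.comap (algebraMap 𝔽 Ω)).valuation (n : 𝔽) ^ n := by
    rw [← map_pow, ← valuation_comap_lt_iff (F := 𝔽) (V := V) (O := V.comap (algebraMap 𝔽 Ω))
      (fun _ => Iff.rfl), map_sub, hu', map_one, map_pow, map_natCast, ← Nat.cast_pow]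
    exact hu.trans hM
  obtain ⟨y, hy, -⟩ := h.hensel.exists_root hn hlt
  have hu0 : u ≠ 0 := by
    rintro rfl
    rw [zero_sub, Valuation.map_neg, map_one] at hu
    exact hu.not_ge hγ
  have hy0 : y ≠ 0 := by
    rintro rfl
    rw [zero_pow hn] at hy
    rw [← hu', ← hy, map_zero] at hu0
    exact hu0 rfl
  refine ⟨s * y, mul_ne_zero hs hy0, ?_⟩
  rw [mul_pow, hy, mul_right_comm, mul_div_cancel₀ _ hden]

end

theorem Ultrafilter.exists_eventually_eq {I : Type} (U : Ultrafilter I) (f : I → ℕ) (N : ℕ)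
    (hf : ∀ᶠ i in U, f i < N) : ∃ m < N, ∀ᶠ i in U, f i = m := by
  by_contra! h
  have h1 : ∀ᶠ i in U, ∀ m ∈ Finset.range N, f i ≠ m := by
    rw [Filter.eventually_all_finset]
    intro m hm
    exact h m (Finset.mem_range.mp hm)
  obtain ⟨i, hi1, hi2⟩ := (hf.and h1).exists
  exact hi2 _ (Finset.mem_range.mpr hi1) rfl

section Ultrapower

variable {I F : Type} [Field F] (U : Ultrafilter I)

/-- The valuation subring induced on an ultrapower. -/
def ultrapowerValuationSubring (O : ValuationSubring F) :
    ValuationSubring (Filter.Germ (U : Filter I) F) where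
  carrier := {x | x.LiftPred (· ∈ O)}
  zero_mem' := Filter.Germ.liftPred_coe.mpr (Filter.Eventually.of_forall fun _ => O.zero_mem)
  one_mem' := Filter.Germ.liftPred_coe.mpr (Filter.Eventually.of_forall fun _ => O.one_mem)
  add_mem' {x y} := by
    induction x using Filter.Germ.inductionOn
    induction y using Filter.Germ.inductionOn
    intro h1 h2
    exact Filter.Germ.liftPred_coe.mpr ((Filter.Germ.liftPred_coe.mp h1).mp ((Filter.Germ.liftPred_coe.mp h2).mono
      fun i h2 h1 => O.add_mem _ _ h1 h2))
  mul_mem' {x y} := by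
    induction x using Filter.Germ.inductionOn
    induction y using Filter.Germ.inductionOn
    intro h1 h2
    exact Filter.Germ.liftPred_coe.mpr ((Filter.Germ.liftPred_coe.mp h1).mp ((Filter.Germ.liftPred_coe.mp h2).mono
      fun i h2 h1 => O.mul_mem _ _ h1 h2))
  neg_mem' {x} := by
    induction x using Filter.Germ.inductionOn
    intro h1
    exact Filter.Germ.liftPred_coe.mpr ((Filter.Germ.liftPred_coe.mp h1).mono fun i h1 => O.neg_mem _ h1)
  mem_or_inv_mem' x := by
    induction x using Filter.Germ.inductionOn with
    | h f =>
      have : ∀ᶠ i in U, f i ∈ O ∨ (f i)⁻¹ ∈ O :=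
        Filter.Eventually.of_forall fun i => O.mem_or_inv_mem _
      exact Ultrafilter.eventually_or.mp this

theorem coe_mem_ultrapowerValuationSubring (O : ValuationSubring F) (f : I → F) :
    (f : Filter.Germ (U : Filter I) F) ∈ ultrapowerValuationSubring U O ↔ ∀ᶠ i in U, f i ∈ O :=
  Iff.rfl

theorem valuation_coe_le_coe (O : ValuationSubring F) (f g : I → F) :
    (ultrapowerValuationSubring U O).valuation (f : Filter.Germ (U : Filter I) F) ≤
      (ultrapowerValuationSubring U O).valuation (g : Filter.Germ (U : Filter I) F) ↔
      ∀ᶠ i in U, O.valuation (f i) ≤ O.valuation (g i) := by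
  simp only [ValuationSubring.valuation_le_iff]
  constructor
  · rintro ⟨⟨a, ha⟩, h⟩
    induction a using Filter.Germ.inductionOn with
    | h a =>
      rw [coe_mem_ultrapowerValuationSubring] at ha
      have h' : ∀ᶠ i in U, a i * g i = f i := Filter.Germ.coe_eq.mp h
      filter_upwards [ha, h'] with i h1 h2 using ⟨⟨a i, h1⟩, h2⟩
  · intro h
    obtain ⟨a, ha⟩ := h.choice
    refine ⟨⟨((fun i => (a i : F) : I → F) : Filter.Germ (U : Filter I) F), ?_⟩, ?_⟩
    · rw [coe_mem_ultrapowerValuationSubring]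
      exact Filter.Eventually.of_forall fun i => (a i).2
    · exact Filter.Germ.coe_eq.mpr ha

theorem valuation_coe_lt_coe (O : ValuationSubring F) (f g : I → F) :
    (ultrapowerValuationSubring U O).valuation (f : Filter.Germ (U : Filter I) F) <
      (ultrapowerValuationSubring U O).valuation (g : Filter.Germ (U : Filter I) F) ↔
      ∀ᶠ i in U, O.valuation (f i) < O.valuation (g i) := by
  simp only [← not_le, Ultrafilter.eventually_not, valuation_coe_le_coe]

theorem valuation_coe_lt_one (O : ValuationSubring F) (f : I → F) :
    (ultrapowerValuationSubring U O).valuation (f : Filter.Germ (U : Filter I) F) < 1 ↔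
      ∀ᶠ i in U, O.valuation (f i) < 1 := by
  simpa using valuation_coe_lt_coe U O f 1

theorem PC.ultrapower {p : ℕ} (hp : p.Prime) [CharZero F] {O : ValuationSubring F} (h : PC p O) :
    PC p (ultrapowerValuationSubring U O) := by
  have hcast : ∀ m : ℕ, (m : Filter.Germ (U : Filter I) F) =
      ((fun _ => (m : F) : I → F) : Filter.Germ (U : Filter I) F) := fun _ => rfl
  refine ⟨⟨?_, fun x => ?_, fun x => ?_⟩, fun d g hg hgi => ?_, fun n hn => ?_⟩
  · rw [hcast, valuation_coe_lt_one]
    exact Filter.Eventually.of_forall fun _ => h.pval.lt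
  · induction x using Filter.Germ.inductionOn with
    | h f =>
      rw [hcast, valuation_coe_lt_one, valuation_coe_le_coe]
      exact fun hf => hf.mono fun i => h.pval.le _
  · induction x using Filter.Germ.inductionOn with
    | h f =>
      rw [coe_mem_ultrapowerValuationSubring]
      intro hf
      have h1 : ∀ᶠ i in U, ∃ r : ℕ, r < p ^ 1 ∧ O.valuation (f i - r) < 1 := hf.mono fun i hi => by
        obtain ⟨r, hr, hr'⟩ := h.pval.exists_natCast_sub_le hp 1 _ hi
        rw [pow_one] at hr'
        exact ⟨r, hr, hr'.trans_lt h.pval.lt⟩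
      obtain ⟨r, hr⟩ := h1.choice
      obtain ⟨m, -, hm⟩ := U.exists_eventually_eq r _ (hr.mono fun i hi => hi.1)
      refine ⟨m, ?_⟩
      rw [hcast, ← Filter.Germ.coe_sub, valuation_coe_lt_one]
      filter_upwards [hr, hm] with i h1 h2
      rw [← h2]
      exact h1.2
  · let φ := Filter.Germ.coeRingHom (R := F) (U : Filter I)
    have hφ : ∀ x, ∃ f, φ f = x := fun x => by
      induction x using Filter.Germ.inductionOn with
      | h f => exact ⟨f, rfl⟩
    choose a ha using fun j => hφ (g.coeff j)
    have h1 : ∀ᶠ i in U, ∀ j ∈ Finset.range (d + 2), O.valuation (a j i) < 1 := by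
      rw [Filter.eventually_all_finset]
      intro j _
      rw [← valuation_coe_lt_one]
      exact (congrArg _ (ha j)).trans_lt (hgi j)
    have h2 : ∀ᶠ i in U, ∃ x : F,
        x ^ (d + 1) - x ^ d + ∑ j ∈ Finset.range (d + 2), a j i * x ^ j = 0 := by
      filter_upwards [h1] with i hi
      obtain ⟨x, hx⟩ := h.hensel d (∑ j ∈ Finset.range (d + 2), C (a j i) * X ^ j)
        (natDegree_sum_le_of_forall_le _ _ fun j hj => (natDegree_C_mul_X_pow_le _ _).trans
          (Nat.lt_succ_iff.mp (Finset.mem_range.mp hj))) (fun m => by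
            rw [finsetSum_coeff]
            simp only [coeff_C_mul_X_pow]
            rw [Finset.sum_ite_eq]
            split_ifs with hm
            · exact hi m hm
            · simp)
      refine ⟨x, ?_⟩
      simpa [eval_finsetSum] using hx
    obtain ⟨x, hx⟩ := h2.choice
    refine ⟨φ x, ?_⟩
    rw [eval_add, eval_eq_sum_range' (Nat.lt_succ_of_le hg) (p := g)]
    simp only [eval_sub, eval_pow, eval_X, ← ha, ← map_pow, ← map_mul, ← map_sub, ← map_sum,
      ← map_add]
    refine Filter.Germ.coe_eq.mpr (hx.mono fun i hi => ?_)
    simpa using hi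
  · obtain ⟨Q, hQ⟩ := h.decomp n hn
    refine ⟨Q, fun x => ?_⟩
    induction x using Filter.Germ.inductionOn with
    | h f =>
      intro hf
      have hf' : ∀ᶠ i in U, f i ≠ 0 := by
        rw [Ultrafilter.eventually_not]
        exact fun h0 => hf (Filter.Germ.coe_eq.mpr h0)
      have h1 : ∀ᶠ i in U, ∃ qy : ℕ × F, qy.1 ≠ 0 ∧ qy.1 < Q + 1 ∧ f i = qy.1 * qy.2 ^ n :=
        hf'.mono fun i hi => by
          obtain ⟨q, hq, hqQ, y, hy⟩ := hQ _ hi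
          exact ⟨(q, y), hq, Nat.lt_succ_of_le hqQ, hy⟩
      obtain ⟨qy, hqy⟩ := h1.choice
      obtain ⟨m, hm, hmq⟩ := U.exists_eventually_eq (fun i => (qy i).1) _
        (hqy.mono fun i hi => hi.2.1)
      obtain ⟨i, hi1, hi2⟩ := (hqy.and hmq).exists
      refine ⟨m, hi2 ▸ hi1.1, Nat.lt_succ_iff.mp hm,
        ((fun i => (qy i).2 : I → F) : Filter.Germ (U : Filter I) F), ?_⟩
      rw [hcast, ← Filter.Germ.coe_pow, ← Filter.Germ.coe_mul]
      refine Filter.Germ.coe_eq.mpr ?_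
      filter_upwards [hqy, hmq] with i h1 h2
      rw [h1.2.2]
      simp [← h2]

end Ultrapower

theorem exists_algHom_adjoin_simple {F E M : Type} [Field F] [Field E] [Field M] [Algebra F E]
    [Algebra F M] {t : M} {s : E} (ht : Transcendental F t) (hs : Transcendental F s) :
    ∃ j : F⟮t⟯ →ₐ[F] E, j (IntermediateField.AdjoinSimple.gen F t) = s := by
  let e := (RatFunc.algEquivOfTranscendental t ht).symm.trans
    (RatFunc.algEquivOfTranscendental s hs)
  refine ⟨F⟮s⟯.val.comp e.toAlgHom, ?_⟩
  have : RatFunc.algEquivOfTranscendental t ht (algebraMap F[X] (RatFunc F) X) =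
      IntermediateField.AdjoinSimple.gen F t := by
    rw [RatFunc.algEquivOfTranscendental_algebraMap, aeval_X]
  change F⟮s⟯.val (RatFunc.algEquivOfTranscendental s hs
    ((RatFunc.algEquivOfTranscendental t ht).symm _)) = s
  rw [← this, AlgEquiv.symm_apply_apply]
  simp

theorem PC.relative_algebraicClosure {p : ℕ} {F M : Type} [Field F] [CharZero F] [Field M] [Algebra F M]
    {O : ValuationSubring M} (h : PC p O) :
    PC p (O.comap (algebraMap (algebraicClosure F M) M)) := by
  have : CharZero (algebraicClosure F M) :=
    charZero_of_injective_algebraMap (algebraMap F _).injective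
  refine PC.descend (F := algebraicClosure F M) (M := M) (V := O) (fun _ => Iff.rfl) (fun x hx => ?_) h
  have : IsAlgebraic F x := IsAlgebraic.restrictScalars F hx
  exact ⟨⟨x, mem_algebraicClosure_iff.mpr this⟩, rfl⟩

/-- Elements algebraic over a simple transcendental extension can be moved to another
`p`-adically closed field with enough powers. -/
theorem PC.exists_point_of_pow {p : ℕ} (hp : p.Prime) {F M E ι : Type} [Field F] [CharZero F]
    [Field M] [Field E] [Algebra F M] [Algebra F E] {O : ValuationSubring M}
    {W : ValuationSubring E} (h : PC p O) (hW : PC p W) {t : M} {s : E} (ht : Transcendental F t)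
    (hs : Transcendental F s)
    (hpow : ∀ m : ℕ, m ≠ 0 → ∀ P : F[X], P ≠ 0 → (∃ f : M, f ^ m = aeval t P) →
      ∃ f : E, f ^ m = aeval s P)
    (x : ι → M) (hx : ∀ j, IsAlgebraic F⟮t⟯ (x j)) :
    ∃ z : ι → E, ∀ f : MvPolynomial ι F, MvPolynomial.aeval x f = 0 →
      MvPolynomial.aeval z f = 0 := by
  obtain ⟨j, hj⟩ := exists_algHom_adjoin_simple ht hs
  let : Algebra F⟮t⟯ E := j.toRingHom.toAlgebra
  have hjE : ∀ a, algebraMap F⟮t⟯ E a = j a := fun _ => rfl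
  have hst : IsScalarTower F F⟮t⟯ E := IsScalarTower.of_algebraMap_eq fun a => (j.commutes a).symm
  have : CharZero F⟮t⟯ := charZero_of_injective_algebraMap (algebraMap F _).injective
  have hjaeval : ∀ P : F[X], algebraMap F⟮t⟯ E (aeval (IntermediateField.AdjoinSimple.gen F t) P) =
      aeval s P := fun P => by
    rw [hjE, ← hj, aeval_algHom_apply]
  have htaeval : ∀ P : F[X], algebraMap F⟮t⟯ M (aeval (IntermediateField.AdjoinSimple.gen F t) P) =
      aeval t P := fun P => by
    rw [← aeval_algebraMap_apply, IntermediateField.AdjoinSimple.algebraMap_gen]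
  obtain ⟨σ⟩ := exists_algHom_of_pow hp (K := F⟮t⟯) (h.relative_algebraicClosure (F := F⟮t⟯))
    (hW.relative_algebraicClosure (F := F⟮t⟯)) (fun m hm a ⟨f, hf⟩ => by
      rcases eq_or_ne a 0 with rfl | ha
      · exact ⟨0, by simp [zero_pow hm]⟩
      obtain ⟨m, rfl⟩ := Nat.exists_eq_succ_of_ne_zero hm
      obtain ⟨r, q, hrq⟩ := (IntermediateField.mem_adjoin_simple_iff F _).mp a.2
      have ha' : (a : M) ≠ 0 := by simpa using ha
      have hq : aeval t q ≠ 0 := by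
        intro h0
        rw [h0, div_zero] at hrq
        exact ha' hrq
      have hr : aeval t r ≠ 0 := by
        intro h0
        rw [h0, zero_div] at hrq
        exact ha' hrq
      have hq0 : q ≠ 0 := by
        rintro rfl
        simp at hq
      have hr0 : r ≠ 0 := by
        rintro rfl
        simp at hr
      have hf' : (f : M) ^ (m + 1) = a := congrArg (algebraMap _ M) hf
      obtain ⟨y, hy⟩ := hpow (m + 1) hm (r * q ^ m) (mul_ne_zero hr0 (pow_ne_zero _ hq0))
        ⟨f * aeval t q, by
          rw [mul_pow, hf', hrq, map_mul, map_pow, pow_succ]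
          field_simp⟩
      have hqs : aeval s q ≠ 0 := fun h0 => hs ⟨q, hq0, h0⟩
      have hae : a = aeval (IntermediateField.AdjoinSimple.gen F t) r /
          aeval (IntermediateField.AdjoinSimple.gen F t) q := by
        apply (algebraMap F⟮t⟯ M).injective
        rw [map_div₀, htaeval, htaeval, ← hrq]
        rfl
      have hya : (y / aeval s q) ^ (m + 1) = algebraMap F⟮t⟯ E a := by
        rw [hae, map_div₀, hjaeval, hjaeval, div_pow, hy, map_mul, map_pow, pow_succ]
        field_simp
      refine ⟨⟨y / aeval s q, mem_algebraicClosure_iff.mpr ?_⟩, ?_⟩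
      · exact IsAlgebraic.of_pow (Nat.succ_pos m) (by rw [hya]; exact isAlgebraic_algebraMap a)
      · exact Subtype.ext hya)
  let x' : ι → algebraicClosure F⟮t⟯ M := fun i => ⟨x i, mem_algebraicClosure_iff.mpr (hx i)⟩
  let τ : algebraicClosure F⟮t⟯ M →ₐ[F] E :=
    ((IsScalarTower.toAlgHom F⟮t⟯ (algebraicClosure F⟮t⟯ E) E).comp σ).restrictScalars F
  have hMt : IsScalarTower F (algebraicClosure F⟮t⟯ M) M := IsScalarTower.of_algebraMap_eq fun _ => rfl
  refine ⟨fun i => τ (x' i), fun f hf => ?_⟩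
  have h0 : MvPolynomial.aeval x' f = 0 := by
    apply (algebraMap (algebraicClosure F⟮t⟯ M) M).injective
    rw [map_zero, ← MvPolynomial.aeval_algebraMap_apply]
    exact hf
  rw [← MvPolynomial.comp_aeval_apply, h0, map_zero]

theorem PC.exists_point_of_simple {p : ℕ} (hp : p.Prime) {F M ι : Type} [Finite ι] [Field F]
    [CharZero F] [Field M] [Algebra F M] {O : ValuationSubring M} (h : PC p O)
    (hrel : ∀ x : M, IsAlgebraic F x → x ∈ Set.range (algebraMap F M)) {t : M}
    (ht : t ∉ Set.range (algebraMap F M)) (x : ι → M) (hx : ∀ j, IsAlgebraic F⟮t⟯ (x j)) :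
    ∃ z : ι → F, ∀ f : MvPolynomial ι F, MvPolynomial.aeval x f = 0 →
      MvPolynomial.aeval z f = 0 := by
  classical
  have : CharZero M := charZero_of_injective_algebraMap (algebraMap F M).injective
  have : CharZero (AlgebraicClosure M) :=
    charZero_of_injective_algebraMap (algebraMap M _).injective
  obtain ⟨V, hV⟩ := exists_valuationSubring_extension (Ω := AlgebraicClosure M) O
  have hst := galoisStable_of_henselRoot hV h.hensel
  have hOV : V.comap (algebraMap M (AlgebraicClosure M)) = O := ValuationSubring.ext _ _ hV
  let I := ℕ × Finset F[X]
  have hc : ∀ i : I, ∃ c : F, ∀ f ∈ i.2.filter (· ≠ 0), ∃ s : M, s ≠ 0 ∧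
      algebraMap F M (f.eval c) = s ^ i.1.factorial * aeval t f := fun i =>
    PC.exists_eval_eq_pow_mul hp hst hrel (by rwa [hOV]) ht (Nat.factorial_ne_zero _)
      _ (fun f hf => (Finset.mem_filter.mp hf).2)
  choose c hc using hc
  have htr : Transcendental F t := fun hal => ht (hrel t hal)
  let U : Ultrafilter I := Ultrafilter.of Filter.atTop
  have hU : ∀ (m : ℕ) (P : F[X]), m ≠ 0 → ∀ᶠ i : I in U, m ∣ i.1.factorial ∧ P ∈ i.2 := by
    intro m P hm
    refine Filter.Eventually.filter_mono (Ultrafilter.of_le _) ?_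
    filter_upwards [Filter.eventually_ge_atTop ((m, {P}) : I)] with i hi
    exact ⟨Nat.dvd_factorial (Nat.pos_of_ne_zero hm) hi.1, hi.2 (Finset.mem_singleton_self _)⟩
  let E := Filter.Germ (U : Filter I) F
  let φ : (I → F) →+* E := Filter.Germ.coeRingHom (U : Filter I)
  have hφ : ∀ f g : I → F, φ f = φ g ↔ ∀ᶠ i in U, f i = g i := fun f g => Filter.Germ.coe_eq
  have hφs : ∀ y : E, ∃ f, φ f = y := fun y => by
    induction y using Filter.Germ.inductionOn with
    | h f => exact ⟨f, rfl⟩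
  let : Algebra F E := (φ.comp (Pi.constRingHom I F)).toAlgebra
  let ψ : (I → F) →ₐ[F] E := { φ with commutes' := fun _ => rfl }
  have hψ : ∀ f, ψ f = φ f := fun _ => rfl
  have haeval : ∀ P : F[X], aeval (φ c) P = φ (fun i => P.eval (c i)) := by
    intro P
    rw [← hψ, aeval_algHom_apply, hψ]
    congr 1
    ext i
    rw [← coe_aeval_eq_eval, ← Pi.evalAlgHom_apply F (fun _ => F) i (aeval c P), ← aeval_algHom_apply]
    rfl
  have hF : PC p (O.comap (algebraMap F M)) := PC.descend (V := O) (fun _ => Iff.rfl) hrel h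
  have hs : Transcendental F (φ c) := by
    rintro ⟨P, hP, hP0⟩
    rw [haeval, ← map_zero φ, hφ] at hP0
    obtain ⟨i, ⟨-, hi⟩, hi0⟩ := ((hU 1 P one_ne_zero).and hP0).exists
    obtain ⟨s, hs, hs'⟩ := hc i P (Finset.mem_filter.mpr ⟨hi, hP⟩)
    rw [hi0, Pi.zero_apply, map_zero] at hs'
    exact mul_ne_zero (pow_ne_zero _ hs) (fun h0 => htr ⟨P, hP, h0⟩) hs'.symm
  obtain ⟨z, hz⟩ := h.exists_point_of_pow hp (hF.ultrapower U hp) htr hs (fun m hm P hP ⟨f, hf⟩ => by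
    have h1 : ∀ᶠ i in U, ∃ y : F, y ^ m = P.eval (c i) := by
      filter_upwards [hU m P hm] with i hi
      obtain ⟨⟨l, hl⟩, hP'⟩ := hi
      obtain ⟨s, hs, hs'⟩ := hc i P (Finset.mem_filter.mpr ⟨hP', hP⟩)
      have hfs : (s ^ l * f) ^ m = algebraMap F M (P.eval (c i)) := by
        rw [hs', mul_pow, hf, hl, ← pow_mul, mul_comm l m]
      obtain ⟨y, hy⟩ := hrel (s ^ l * f) (IsAlgebraic.of_pow (Nat.pos_of_ne_zero hm) (by
        rw [hfs]
        exact isAlgebraic_algebraMap _))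
      refine ⟨y, (algebraMap F M).injective ?_⟩
      rw [map_pow, hy, hfs]
    obtain ⟨y, hy⟩ := h1.choice
    refine ⟨φ y, ?_⟩
    rw [haeval, ← map_pow, hφ]
    exact hy) x hx
  choose w hw using fun j => hφs (z j)
  obtain ⟨s, hs⟩ := IsNoetherian.noetherian (RingHom.ker (MvPolynomial.aeval (R := F) x))
  have h2 : ∀ᶠ i in U, ∀ f ∈ s, MvPolynomial.aeval (fun j => w j i) f = 0 := by
    rw [Filter.eventually_all_finset]
    intro f hf
    have hf0 : f ∈ RingHom.ker (MvPolynomial.aeval (R := F) x) := by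
      rw [← hs]
      exact Submodule.subset_span hf
    have h3 := hz f hf0
    rw [show z = fun j => ψ (w j) from funext fun j => (hw j).symm, ← MvPolynomial.comp_aeval_apply, hψ, ← map_zero φ, hφ] at h3
    filter_upwards [h3] with i hi
    rw [Pi.zero_apply, ← Pi.evalAlgHom_apply F (fun _ => F) i (MvPolynomial.aeval w f), MvPolynomial.comp_aeval_apply] at hi
    exact hi
  obtain ⟨i, hi⟩ := h2.exists
  refine ⟨fun j => w j i, fun f hf => ?_⟩
  have hle : RingHom.ker (MvPolynomial.aeval (R := F) x) ≤
      RingHom.ker (MvPolynomial.aeval (R := F) fun j => w j i) := by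
    rw [← hs]
    exact Submodule.span_le.mpr hi
  exact hle hf

theorem PC.exists_point_of_ncard_le {p : ℕ} (hp : p.Prime) {M ι : Type} [Finite ι] [Field M]
    [CharZero M] {O : ValuationSubring M} (h : PC p O) (n : ℕ) (x : ι → M) (F : Type) [Field F]
    [Algebra F M] (hrel : ∀ y : M, IsAlgebraic F y → y ∈ Set.range (algebraMap F M))
    (hn : {j | x j ∉ Set.range (algebraMap F M)}.ncard ≤ n) :
    ∃ z : ι → F, ∀ f : MvPolynomial ι F, MvPolynomial.aeval x f = 0 →
      MvPolynomial.aeval z f = 0 := by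
  induction n generalizing F with
  | zero =>
    rw [Nat.le_zero, Set.ncard_eq_zero, Set.eq_empty_iff_forall_notMem] at hn
    simp only [Set.mem_ofPred_eq, not_not] at hn
    choose z hz using hn
    refine ⟨z, fun f hf => (algebraMap F M).injective ?_⟩
    rw [← MvPolynomial.aeval_algebraMap_apply, map_zero, ← hf]
    congr 2
    exact funext hz
  | succ n ih =>
    rcases Set.eq_empty_or_nonempty {j | x j ∉ Set.range (algebraMap F M)} with he | ⟨j, hj⟩
    · exact ih F hrel (by rw [he]; simp)
    have hFM : CharZero F := ((algebraMap F M).charZero_iff (algebraMap F M).injective).mpr inferInstance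
    let T := algebraicClosure F⟮x j⟯ M
    have hT : ∀ y : M, y ∈ Set.range (algebraMap T M) ↔ IsAlgebraic F⟮x j⟯ y := fun y =>
      ⟨fun ⟨w, hw⟩ => hw ▸ mem_algebraicClosure_iff.mp w.2,
        fun hy => ⟨⟨y, mem_algebraicClosure_iff.mpr hy⟩, rfl⟩⟩
    have hFT : IsScalarTower F T M := IsScalarTower.of_algebraMap_eq fun _ => rfl
    obtain ⟨w, hw⟩ := ih T (fun y hy => (hT y).mpr (IsAlgebraic.restrictScalars F⟮x j⟯ hy)) (by
      have hsub : {i | x i ∉ Set.range (algebraMap T M)} ⊆ {i | x i ∉ Set.range (algebraMap F M)} := by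
        rintro i hi ⟨a, ha⟩
        exact hi ⟨algebraMap F T a, by rw [← IsScalarTower.algebraMap_apply, ha]⟩
      refine Nat.le_of_lt_succ (lt_of_lt_of_le (Set.ncard_lt_ncard
        ((Set.ssubset_iff_of_subset hsub).mpr ⟨j, hj, fun hj' => hj' ?_⟩) (Set.toFinite _)) hn)
      rw [hT]
      exact isAlgebraic_algebraMap (IntermediateField.AdjoinSimple.gen F (x j)))
    obtain ⟨z, hz⟩ := h.exists_point_of_simple hp hrel hj (fun i => (w i : M))
      fun i => mem_algebraicClosure_iff.mp (w i).2
    refine ⟨z, fun f hf => hz f ?_⟩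
    have h1 := hw (MvPolynomial.map (algebraMap F T) f) (by
      rwa [MvPolynomial.aeval_map_algebraMap])
    rw [MvPolynomial.aeval_map_algebraMap] at h1
    have h2 := congrArg (algebraMap T M) h1
    rwa [map_zero, ← MvPolynomial.aeval_algebraMap_apply] at h2

/-- A relatively algebraically closed subfield of a `p`-adically closed field is existentially
closed in it. -/
theorem PC.exists_point {p : ℕ} (hp : p.Prime) {F M ι : Type} [Finite ι] [Field F] [Field M]
    [CharZero M] [Algebra F M] {O : ValuationSubring M} (h : PC p O)
    (hrel : ∀ y : M, IsAlgebraic F y → y ∈ Set.range (algebraMap F M)) (x : ι → M) :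
    ∃ z : ι → F, ∀ f : MvPolynomial ι F, MvPolynomial.aeval x f = 0 →
      MvPolynomial.aeval z f = 0 :=
  h.exists_point_of_ncard_le hp _ x F hrel le_rfl

/-- A derivation on a field as a bundled derivation. -/
abbrev FieldDeriv.differential {F : Type} [Field F] (δ : FieldDeriv F) : Differential F where
  deriv := Derivation.mk' (AddMonoidHom.mk' δ.d δ.map_add).toIntLinearMap fun a b => by
    simp [δ.leibniz, mul_comm]

section
open scoped Differential

theorem isAlgebraic_of_deriv_eq_zero {k L M : Type} [Field k] [Field L] [Field M] [Differential L]
    [Differential M] [Algebra L M] [DifferentialAlgebra L M] [Algebra k L] [Algebra k M]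
    [IsScalarTower k L M] [Differential.ContainConstants k L] {x : M} (hx : IsAlgebraic L x)
    (h : x′ = 0) : IsAlgebraic k x := by
  have hP := minpoly.monic hx.isIntegral
  have hc := Differential.deriv_aeval_eq (A := L) x (minpoly L x)
  rw [minpoly.aeval, map_zero, h, mul_zero, add_zero, eq_comm] at hc
  have h0 : Differential.mapCoeffs (minpoly L x) = 0 := by
    by_contra hne
    refine (minpoly.degree_le_of_ne_zero L x hne hc).not_gt ?_
    rw [Polynomial.degree_eq_natDegree hP.ne_zero, Polynomial.degree_lt_iff_coeff_zero]
    intro m hm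
    rw [Differential.coeff_mapCoeffs]
    rcases hm.eq_or_lt with rfl | hlt
    · rw [hP.coeff_natDegree, Derivation.map_one_eq_zero]
    · rw [coeff_eq_zero_of_natDegree_lt hlt, map_zero]
  have hl : minpoly L x ∈ Polynomial.lifts (algebraMap k L) := by
    rw [Polynomial.lifts_iff_coeff_lifts]
    intro i
    refine mem_range_of_deriv_eq_zero k ?_
    rw [← Differential.coeff_mapCoeffs, h0, coeff_zero]
  obtain ⟨q, hq⟩ := (Polynomial.mem_lifts _).mp hl
  refine ⟨q, ?_, ?_⟩
  · rintro rfl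
    exact hP.ne_zero (by rw [← hq, Polynomial.map_zero])
  · rw [← Polynomial.aeval_map_algebraMap L, hq, minpoly.aeval]

theorem deriv_eq_div {K M : Type} [Field K] [Field M] [CharZero K] [Differential K]
    [Differential M] [Algebra K M] [DifferentialAlgebra K M] {x : M} (hx : IsAlgebraic K x) :
    x′ = -aeval x (Differential.mapCoeffs (minpoly K x)) / aeval x (derivative (minpoly K x)) := by
  have hc := Differential.deriv_aeval_eq (A := K) x (minpoly K x)
  rw [minpoly.aeval, map_zero] at hc
  have hs : aeval x (derivative (minpoly K x)) ≠ 0 :=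
    (minpoly.irreducible hx.isIntegral).separable.aeval_derivative_ne_zero (minpoly.aeval K x)
  rw [eq_div_iff hs]
  linear_combination -hc

theorem IsAlgebraic.deriv {K M : Type} [Field K] [Field M] [CharZero K] [Differential K]
    [Differential M] [Algebra K M] [DifferentialAlgebra K M] {x : M} (hx : IsAlgebraic K x) :
    IsAlgebraic K (x′) := by
  rw [deriv_eq_div hx, ← mem_algebraicClosure_iff]
  have hm : x ∈ algebraicClosure K M := mem_algebraicClosure_iff.mpr hx
  have ha (q : Polynomial K) : aeval x q ∈ algebraicClosure K M :=
    ((aeval (⟨x, hm⟩ : algebraicClosure K M) q).2 :) |> fun h => by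
      rwa [← IntermediateField.algebraMap_apply, ← aeval_algebraMap_apply] at h
  exact div_mem (neg_mem (ha _)) (ha _)

theorem AlgHom.map_deriv_of_isAlgebraic {K M N : Type} [Field K] [Field M] [Field N] [CharZero K]
    [Differential K] [Differential M] [Differential N] [Algebra K M] [Algebra K N]
    [DifferentialAlgebra K M] [DifferentialAlgebra K N] [Algebra.IsAlgebraic K M]
    (φ : M →ₐ[K] N) (x : M) : φ (x′) = (φ x)′ := by
  have hx : IsAlgebraic K x := Algebra.IsAlgebraic.isAlgebraic x
  rw [deriv_eq_div hx, deriv_eq_div (hx.algHom φ), minpoly.algHom_eq φ φ.injective, map_div₀, map_neg,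
    ← aeval_algHom_apply, ← aeval_algHom_apply]

theorem exists_differentialAlgebra {F M : Type} [Field F] [Field M] [Differential M] [Algebra F M]
    (h : ∀ a : F, ∃ b : F, algebraMap F M b = (algebraMap F M a)′) :
    ∃ _ : Differential F, DifferentialAlgebra F M := by
  choose f hf using h
  have hi := (algebraMap F M).injective
  let D : Differential F := ⟨Derivation.mk' (AddMonoidHom.mk' f fun a b => hi (by
    simp [hf])).toIntLinearMap fun a b => hi (by simp [hf])⟩
  exact ⟨D, ⟨fun a => (hf a).symm⟩⟩

theorem IsPAdicallyClosed.mem_range {p : ℕ} (hp : p.Prime) {k M : Type} [Field k] [Field M]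
    [CharZero M] [Algebra k M] (hk : IsPAdicallyClosed p k) {O : ValuationSubring M}
    (h : PVal p O) {x : M} (hx : IsAlgebraic k x) : x ∈ Set.range (algebraMap k M) := by
  have hO : PVal p (O.comap (algebraMap (algebraicClosure k M) M)) :=
    PVal.comap (Z := M) (V := O) (fun _ => Iff.rfl) h
  obtain ⟨y, hy⟩ := hk.2 (algebraicClosure k M) inferInstance ⟨_, hO.witness hp⟩ ⟨x, mem_algebraicClosure_iff.mpr hx⟩
  exact ⟨y, congrArg Subtype.val hy⟩

theorem MvPolynomial.exists_derivation {R σ : Type} [CommRing R] [Differential R]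
    (v : σ → MvPolynomial σ R) : ∃ D : Derivation ℤ (MvPolynomial σ R) (MvPolynomial σ R),
      (∀ a, D (MvPolynomial.C a) = MvPolynomial.C (a′)) ∧ ∀ i, D (MvPolynomial.X i) = v i := by
  let P := MvPolynomial σ R
  let g : R →+* DualNumber P :=
    { toFun a := TrivSqZeroExt.inl (MvPolynomial.C a) + TrivSqZeroExt.inr (MvPolynomial.C (a′))
      map_one' := by ext <;> simp
      map_zero' := by ext <;> simp
      map_add' a b := by ext1 <;> simp
      map_mul' a b := by ext1 <;> simp [mul_comm] }
  let Φ : P →+* DualNumber P :=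
    MvPolynomial.eval₂Hom g fun i => TrivSqZeroExt.inl (MvPolynomial.X i) + TrivSqZeroExt.inr (v i)
  have hC (a : R) : Φ (MvPolynomial.C a) = g a := MvPolynomial.eval₂Hom_C _ _ a
  have hX (i : σ) : Φ (MvPolynomial.X i) =
      TrivSqZeroExt.inl (MvPolynomial.X i) + TrivSqZeroExt.inr (v i) :=
    MvPolynomial.eval₂Hom_X' _ _ i
  have hfst (f : P) : (Φ f).fst = f := by
    induction f using MvPolynomial.induction_on with
    | C a => rw [hC]; simp [g]
    | add f g hf hg => rw [map_add, TrivSqZeroExt.fst_add, hf, hg]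
    | mul_X f i hf => rw [map_mul, TrivSqZeroExt.fst_mul, hf, hX]; simp
  refine ⟨Derivation.mk' (AddMonoidHom.mk' (fun f => (Φ f).snd) fun a b => by
    simp).toIntLinearMap fun a b => ?_, fun a => ?_, fun i => ?_⟩
  · simp [hfst, mul_comm]
  · simp [hC, g]
  · simp [hX]

theorem Derivation.map_ringHom_mvPolynomial {R σ S : Type} [CommRing R] [Differential R]
    [CommRing S] [Differential S] {D : Derivation ℤ (MvPolynomial σ R) (MvPolynomial σ R)}
    (s : MvPolynomial σ R →+* S) (hC : ∀ a, (s (MvPolynomial.C a))′ = s (D (MvPolynomial.C a)))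
    (hX : ∀ i, (s (MvPolynomial.X i))′ = s (D (MvPolynomial.X i))) (f : MvPolynomial σ R) :
    (s f)′ = s (D f) := by
  induction f using MvPolynomial.induction_on with
  | C a => exact hC a
  | add f g hf hg => simp only [map_add, hf, hg]
  | mul_X f i hf => simp [hf, hX]

theorem Derivation.coeff_mvPolynomial {R σ : Type} [CommRing R] [Differential R]
    {D : Derivation ℤ (MvPolynomial σ R) (MvPolynomial σ R)}
    (hC : ∀ a, D (MvPolynomial.C a) = MvPolynomial.C (a′)) (hX : ∀ i, D (MvPolynomial.X i) = 0)
    (f : MvPolynomial σ R) (m : σ →₀ ℕ) : (D f).coeff m = (f.coeff m)′ := by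
  classical
  induction f using MvPolynomial.induction_on generalizing m with
  | C a =>
    rw [hC, MvPolynomial.coeff_C, MvPolynomial.coeff_C]
    split_ifs <;> simp
  | add f g hf hg => simp [hf, hg]
  | mul_X f i hf =>
    rw [Derivation.leibniz, hX, smul_zero, zero_add, smul_eq_mul, mul_comm,
      MvPolynomial.coeff_mul_X', MvPolynomial.coeff_mul_X']
    split_ifs <;> simp [hf]

end

section
open scoped Differential

theorem MvPolynomial.eval_eq_zero_of_derivation_mem {k M σ : Type} [Field k] [Field M]
    [Differential M] [Algebra k M] [Differential.ContainConstants k M]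
    {D : Derivation ℤ (MvPolynomial σ M) (MvPolynomial σ M)}
    (hC : ∀ a, D (MvPolynomial.C a) = MvPolynomial.C (a′)) (hX : ∀ i, D (MvPolynomial.X i) = 0)
    (W : Submodule M (MvPolynomial σ M)) (hW : ∀ f ∈ W, D f ∈ W) (c : σ → k)
    (hc : ∀ g : MvPolynomial σ k, MvPolynomial.map (algebraMap k M) g ∈ W →
      MvPolynomial.eval c g = 0)
    {f : MvPolynomial σ M} (hf : f ∈ W) :
    MvPolynomial.eval (fun i => algebraMap k M (c i)) f = 0 := by
  have hco := Derivation.coeff_mvPolynomial hC hX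
  have hlt {u : MvPolynomial σ M} {m : σ →₀ ℕ} (hm : u.coeff m = 1) :
      (D u).support.card < u.support.card := by
    refine Finset.card_lt_card ((Finset.ssubset_iff_of_subset fun i hi => ?_).mpr ⟨m, ?_, ?_⟩)
    · rw [MvPolynomial.mem_support_iff, hco] at hi
      exact MvPolynomial.mem_support_iff.mpr fun h0 => hi (by rw [h0, map_zero])
    · rw [MvPolynomial.mem_support_iff, hm]
      exact one_ne_zero
    · rw [MvPolynomial.notMem_support_iff, hco, hm, Derivation.map_one_eq_zero]
  have hcard (a : M) (u : MvPolynomial σ M) : (a • u).support.card ≤ u.support.card :=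
    Finset.card_le_card MvPolynomial.support_smul
  induction hn : f.support.card using Nat.strong_induction_on generalizing f with
  | _ n ih =>
    subst hn
    by_cases hf0 : f = 0
    · rw [hf0, map_zero]
    obtain ⟨m, hm⟩ := MvPolynomial.ne_zero_iff.mp hf0
    set h := (f.coeff m)⁻¹ • f with hh
    have hhW : h ∈ W := W.smul_mem _ hf
    have hh1 : h.coeff m = 1 := by rw [hh, MvPolynomial.coeff_smul, smul_eq_mul, inv_mul_cancel₀ hm]
    suffices hs : MvPolynomial.eval (fun i => algebraMap k M (c i)) h = 0 by
      rw [hh, MvPolynomial.smul_eval] at hs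
      exact (mul_eq_zero.mp hs).resolve_left (inv_ne_zero hm)
    have hDh := ih _ ((hlt hh1).trans_le (hcard _ _)) (hW h hhW) rfl
    by_cases h0 : D h = 0
    · have hk (i : σ →₀ ℕ) : h.coeff i ∈ (algebraMap k M).range :=
        mem_range_of_deriv_eq_zero k (by rw [← hco, h0, MvPolynomial.coeff_zero])
      obtain ⟨g, hg⟩ := (MvPolynomial.mem_range_map_iff_coeffs_subset (f := algebraMap k M)).mpr
        fun a ha => by
          obtain ⟨i, -, rfl⟩ := MvPolynomial.mem_coeffs_iff.mp ha
          exact hk i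
      rw [← hg] at hhW ⊢
      rw [MvPolynomial.eval_map, ← map_zero (algebraMap k M), ← hc g hhW]
      exact (MvPolynomial.eval₂_comp (algebraMap k M) c g).symm
    · obtain ⟨m', hm'⟩ := MvPolynomial.ne_zero_iff.mp h0
      rw [hco] at hm'
      have hne : h.coeff m' ≠ 0 := fun h0 => hm' (by rw [h0, map_zero])
      have hu1 : ((h.coeff m')⁻¹ • h).coeff m' = 1 := by
        rw [MvPolynomial.coeff_smul, smul_eq_mul, inv_mul_cancel₀ hne]
      have hDu := ih _ ((hlt hu1).trans_le ((hcard _ _).trans (hcard _ _)))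
        (hW _ (W.smul_mem _ hhW)) rfl
      rw [MvPolynomial.smul_eq_C_mul, Derivation.leibniz, hC, map_add, smul_eq_mul, smul_eq_mul,
        map_mul, map_mul, hDh, mul_zero, zero_add, MvPolynomial.eval_C, Derivation.leibniz_inv] at hDu
      refine (mul_eq_zero.mp hDu).resolve_right ?_
      simp [hne, hm']

end

theorem Matrix.aeval_mvPolynomialX_det {R S m : Type} [CommRing R] [CommRing S] [Algebra R S]
    [Fintype m] [DecidableEq m] (x : Matrix m m S) :
    MvPolynomial.aeval (fun q : m × m => x q.1 q.2) (Matrix.mvPolynomialX m m R).det = x.det := by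
  rw [AlgHom.map_det]
  congr 1
  ext i j
  simp

theorem PC.exists_matrix {p : ℕ} (hp : p.Prime) {F M m : Type} [Fintype m] [DecidableEq m]
    [Field F] [Field M] [CharZero M] [Algebra F M] {O : ValuationSubring M} (h : PC p O)
    (hrel : ∀ y : M, IsAlgebraic F y → y ∈ Set.range (algebraMap F M)) (x : Matrix m m M)
    (hx : x.det ≠ 0) : ∃ z : Matrix m m F, z.det ≠ 0 ∧ ∀ f : MvPolynomial (m × m) F,
      MvPolynomial.aeval (fun q : m × m => x q.1 q.2) f = 0 →
        MvPolynomial.aeval (fun q : m × m => z q.1 q.2) f = 0 := by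
  obtain ⟨z, hz⟩ := h.exists_point hp hrel
    (fun o : Option (m × m) => o.elim x.det⁻¹ fun q => x q.1 q.2)
  have hs (f : MvPolynomial (m × m) F) :
      MvPolynomial.aeval z (MvPolynomial.rename some f) =
        MvPolynomial.aeval (fun q : m × m => Matrix.of (fun i j => z (some (i, j))) q.1 q.2) f := by
    rw [MvPolynomial.aeval_rename]
    rfl
  have hs' (f : MvPolynomial (m × m) F) :
      MvPolynomial.aeval (fun o : Option (m × m) => o.elim x.det⁻¹ fun q => x q.1 q.2)
        (MvPolynomial.rename some f) = MvPolynomial.aeval (fun q : m × m => x q.1 q.2) f := by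
    rw [MvPolynomial.aeval_rename]
    rfl
  refine ⟨Matrix.of fun i j => z (some (i, j)), fun h0 => ?_, fun f hf => ?_⟩
  · have := hz (MvPolynomial.rename some (Matrix.mvPolynomialX m m F).det * MvPolynomial.X none - 1)
      (by
        rw [map_sub, map_mul, hs', Matrix.aeval_mvPolynomialX_det, MvPolynomial.aeval_X, map_one]
        simp [hx])
    rw [map_sub, map_mul, hs, Matrix.aeval_mvPolynomialX_det, h0, zero_mul, map_one] at this
    simp at this
  · rw [← hs]
    exact hz _ (by rw [hs', hf])

section
open scoped Differential

theorem exists_constant_matrix {p : ℕ} (hp : p.Prime) {k E M N m : Type} [Fintype m]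
    [DecidableEq m] [Field k] [Field E] [Field M] [Field N] [CharZero M] [CharZero N]
    [Differential E] [Differential M] [Differential N] [Algebra E M] [Algebra E N] [Algebra k N]
    [DifferentialAlgebra E M] [DifferentialAlgebra E N] [Differential.ContainConstants k N]
    {O : ValuationSubring M} (hO : PC p O)
    (hE : ∀ y : M, IsAlgebraic E y → y ∈ Set.range (algebraMap E M))
    {V : ValuationSubring N} (hV : PC p V)
    (hk : ∀ y : N, IsAlgebraic k y → y ∈ Set.range (algebraMap k N)) (A : Matrix m m E)
    {F : Matrix m m M} (hF : F.det ≠ 0) (hFA : ∀ i j, (F i j)′ = (A.map (algebraMap E M) * F) i j)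
    {G : Matrix m m N} (hG : G.det ≠ 0) (hGA : ∀ i j, (G i j)′ = (A.map (algebraMap E N) * G) i j) :
    ∃ c : Matrix m m k, c.det ≠ 0 ∧ ∀ f : MvPolynomial (m × m) E,
      MvPolynomial.aeval (fun q : m × m => F q.1 q.2) f = 0 →
        MvPolynomial.aeval (fun q : m × m => (G * c.map (algebraMap k N)) q.1 q.2) f = 0 := by
  obtain ⟨P, hP, hPF⟩ := hO.exists_matrix hp hE F hF
  let C : Matrix m m N := G⁻¹ * P.map (algebraMap E N)
  have hGC : G * C = P.map (algebraMap E N) :=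
    Matrix.mul_nonsing_inv_cancel_left _ _ (isUnit_iff_ne_zero.mpr hG)
  have hPN : (P.map (algebraMap E N)).det ≠ 0 := by
    rw [← RingHom.mapMatrix_apply, ← RingHom.map_det]
    exact (_root_.map_ne_zero _).mpr hP
  have hC : C.det ≠ 0 := by
    rw [← hGC, Matrix.det_mul] at hPN
    exact right_ne_zero_of_mul hPN
  obtain ⟨c, hc, hcC⟩ := hV.exists_matrix hp hk C hC
  refine ⟨c, hc, fun f hf => ?_⟩
  let T : MvPolynomial (m × m) E →ₐ[E] MvPolynomial (m × m) N :=
    MvPolynomial.aeval fun q => ∑ l, MvPolynomial.C (G q.1 l) * MvPolynomial.X (l, q.2)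
  have hT (B : Matrix m m N) (f : MvPolynomial (m × m) E) :
      MvPolynomial.eval (fun q : m × m => B q.1 q.2) (T f) =
        MvPolynomial.aeval (fun q : m × m => (G * B) q.1 q.2) f := by
    rw [← MvPolynomial.coe_aeval_eq_eval]
    change ((MvPolynomial.aeval (fun q : m × m => B q.1 q.2)).restrictScalars E) (T f) = _
    rw [MvPolynomial.comp_aeval_apply]
    congr 2
    ext q
    simp [Matrix.mul_apply]
  obtain ⟨D, hDC, hDX⟩ := MvPolynomial.exists_derivation (R := N) (σ := m × m) 0
  obtain ⟨D', hDC', hDX'⟩ := MvPolynomial.exists_derivation (R := E)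
    fun q : m × m => ∑ l, MvPolynomial.C (A q.1 l) * MvPolynomial.X (l, q.2)
  have hDT (f : MvPolynomial (m × m) E) : D (T f) = T (D' f) := by
    let : Differential (MvPolynomial (m × m) N) := ⟨D⟩
    refine Derivation.map_ringHom_mvPolynomial T.toRingHom
      (fun a => ?_) (fun q => ?_) f
    · change D (T (MvPolynomial.C a)) = T (D' (MvPolynomial.C a))
      rw [hDC', ← MvPolynomial.algebraMap_eq, AlgHom.commutes, AlgHom.commutes,
        MvPolynomial.algebraMap_apply, hDC, deriv_algebraMap, MvPolynomial.algebraMap_apply]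
    · change D (T (MvPolynomial.X q)) = T (D' (MvPolynomial.X q))
      simp only [hDX', T, MvPolynomial.aeval_X, map_sum, map_mul, Derivation.leibniz, hDC, hDX, hGA,
        Matrix.mul_apply, Pi.zero_apply, smul_eq_mul, Matrix.map_apply, Finset.mul_sum,
        MvPolynomial.aeval_C, MvPolynomial.algebraMap_apply]
      rw [Finset.sum_comm]
      exact Finset.sum_congr rfl fun i _ => by
        rw [mul_zero, zero_add]
        exact Finset.sum_congr rfl fun l _ => by ring
  have hDF (f : MvPolynomial (m × m) E) :
      (MvPolynomial.aeval (fun q : m × m => F q.1 q.2) f)′ =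
        MvPolynomial.aeval (fun q : m × m => F q.1 q.2) (D' f) := by
    refine Derivation.map_ringHom_mvPolynomial
      (MvPolynomial.aeval (R := E) fun q : m × m => F q.1 q.2).toRingHom
      (fun a => ?_) (fun q => ?_) f
    · simp [hDC', deriv_algebraMap]
    · simp [hDX', hFA, Matrix.mul_apply]
  let W : Submodule N (MvPolynomial (m × m) N) := Submodule.span N
    (T '' {f | MvPolynomial.aeval (fun q : m × m => F q.1 q.2) f = 0})
  have hW : ∀ f ∈ W, D f ∈ W := fun f hf => by
    induction hf using Submodule.span_induction with
    | mem f hf =>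
      obtain ⟨g, hg, rfl⟩ := hf
      rw [hDT]
      refine Submodule.subset_span ⟨_, ?_, rfl⟩
      rw [Set.mem_ofPred_eq] at hg ⊢
      rw [← hDF, hg, map_zero]
    | zero => rw [map_zero]; exact W.zero_mem
    | add f g _ _ hf hg => rw [map_add]; exact W.add_mem hf hg
    | smul a f hf' hf =>
      rw [MvPolynomial.smul_eq_C_mul, Derivation.leibniz, hDC, smul_eq_mul, smul_eq_mul, mul_comm f,
        ← MvPolynomial.smul_eq_C_mul, ← MvPolynomial.smul_eq_C_mul]
      exact W.add_mem (W.smul_mem _ hf) (W.smul_mem _ hf')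
  have hWC : ∀ f ∈ W, MvPolynomial.eval (fun q : m × m => C q.1 q.2) f = 0 := fun f hf => by
    induction hf using Submodule.span_induction with
    | mem f hf =>
      obtain ⟨g, hg, rfl⟩ := hf
      rw [hT, hGC, ← map_zero (algebraMap E N), ← hPF g hg]
      exact MvPolynomial.aeval_algebraMap_apply _ _ _
    | zero => rw [map_zero]
    | add f g _ _ hf hg => rw [map_add, hf, hg, add_zero]
    | smul a f _ hf => rw [MvPolynomial.smul_eval, hf, mul_zero]
  rw [← hT]
  refine MvPolynomial.eval_eq_zero_of_derivation_mem (k := k) hDC hDX W hW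
    (fun q => c q.1 q.2) (fun g hg => ?_) (Submodule.subset_span ⟨f, hf, rfl⟩)
  refine hcC g ?_
  rw [← hWC _ hg, MvPolynomial.eval_map]
  rfl

end

theorem Ideal.comap_le_of_le_comap {S : Type} [CommRing S] [IsNoetherianRing S] {I : Ideal S}
    (s : S →+* S) (hs : Function.Surjective s) (h : I ≤ I.comap s) : I.comap s ≤ I := by
  have hmem (n : ℕ) (f : S) : f ∈ (Ideal.comap s)^[n] I ↔ s^[n] f ∈ I := by
    induction n generalizing f with
    | zero => rfl
    | succ n ih =>
      rw [Function.iterate_succ_apply', Ideal.mem_comap, ih, Function.iterate_succ_apply]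
  have hmono : Monotone fun n => (Ideal.comap s)^[n] I :=
    Monotone.monotone_iterate_of_le_map (fun _ _ hJ => Ideal.comap_mono hJ) h
  obtain ⟨n, hn⟩ := monotone_stabilizes_iff_noetherian.mpr ‹IsNoetherianRing S› ⟨_, hmono⟩
  intro f hf
  obtain ⟨g, rfl⟩ := hs.iterate n f
  rw [← hmem]
  have hg : g ∈ (Ideal.comap s)^[n + 1] I := by
    rw [hmem, Function.iterate_succ_apply']
    exact hf
  exact (hn (n + 1) n.le_succ).ge hg

theorem AlgHom.exists_range_equiv {E S M N : Type} [Field E] [CommRing S] [CommRing M]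
    [CommRing N] [Algebra E S] [Algebra E M] [Algebra E N] (f : S →ₐ[E] M) (g : S →ₐ[E] N)
    (h : ∀ a, f a = 0 ↔ g a = 0) :
    ∃ e : f.range ≃ₐ[E] g.range, ∀ a, (e (f.rangeRestrict a) : N) = g a := by
  have hk : RingHom.ker f = RingHom.ker g := Ideal.ext h
  let e₁ := Ideal.quotientKerEquivRange f
  refine ⟨e₁.symm.trans ((Ideal.quotientEquivAlgOfEq E hk).trans (Ideal.quotientKerEquivRange g)),
    fun a => ?_⟩
  have h₁ : f.rangeRestrict a = e₁ (Ideal.Quotient.mk _ a) := rfl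
  rw [AlgEquiv.trans_apply, h₁, AlgEquiv.symm_apply_apply]
  rfl

open scoped IntermediateField.algebraAdjoinAdjoin in
theorem MvPolynomial.exists_algEquiv_adjoin {E M N σ : Type} [Field E] [Field M] [Field N]
    [Algebra E M] [Algebra E N] {x : σ → M} {y : σ → N}
    (h : ∀ f : MvPolynomial σ E, MvPolynomial.aeval x f = 0 ↔ MvPolynomial.aeval y f = 0) :
    ∃ e : IntermediateField.adjoin E (Set.range x) ≃ₐ[E] IntermediateField.adjoin E (Set.range y),
      ∀ i (hi : x i ∈ IntermediateField.adjoin E (Set.range x)), (e ⟨x i, hi⟩ : N) = y i := by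
  obtain ⟨e₀, he₀⟩ : ∃ e : Algebra.adjoin E (Set.range x) ≃ₐ[E] Algebra.adjoin E (Set.range y),
      ∀ i (hi : x i ∈ Algebra.adjoin E (Set.range x)), (e ⟨x i, hi⟩ : N) = y i := by
    rw [Algebra.adjoin_range_eq_range_aeval, Algebra.adjoin_range_eq_range_aeval]
    obtain ⟨e, he⟩ := AlgHom.exists_range_equiv _ _ h
    refine ⟨e, fun i hi => ?_⟩
    rw [← MvPolynomial.aeval_X (R := E) y i, ← he]
    congr 2
    exact Subtype.ext (MvPolynomial.aeval_X (R := E) x i).symm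
  refine ⟨(IsFractionRing.fieldEquivOfAlgEquiv E (IntermediateField.adjoin E (Set.range x))
    (IntermediateField.adjoin E (Set.range y)) e₀).restrictScalars E, fun i hi => ?_⟩
  have hi' : x i ∈ Algebra.adjoin E (Set.range x) := Algebra.subset_adjoin ⟨i, rfl⟩
  rw [← he₀ i hi']
  exact congrArg Subtype.val (IsFractionRing.fieldEquivOfAlgEquiv_algebraMap E
    (IntermediateField.adjoin E (Set.range x)) (IntermediateField.adjoin E (Set.range y)) e₀
    ⟨x i, hi'⟩)

theorem IntermediateField.adjoin_matrix_mul {E M m : Type} [Fintype m] [DecidableEq m] [Field E]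
    [Field M] [Algebra E M] (G : Matrix m m M) {c : Matrix m m E} (hc : c.det ≠ 0) :
    IntermediateField.adjoin E
        (Set.range fun q : m × m => (G * c.map (algebraMap E M)) q.1 q.2) =
      IntermediateField.adjoin E (Set.range fun q : m × m => G q.1 q.2) := by
  have hle (G : Matrix m m M) (c : Matrix m m E) : IntermediateField.adjoin E
        (Set.range fun q : m × m => (G * c.map (algebraMap E M)) q.1 q.2) ≤
      IntermediateField.adjoin E (Set.range fun q : m × m => G q.1 q.2) := by
    rw [IntermediateField.adjoin_le_iff]
    rintro _ ⟨q, rfl⟩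
    exact sum_mem fun l _ => mul_mem (IntermediateField.subset_adjoin _ _ ⟨(q.1, l), rfl⟩)
      (IntermediateField.algebraMap_mem _ _)
  refine le_antisymm (hle G c) ?_
  have := hle (G * c.map (algebraMap E M)) c⁻¹
  rwa [Matrix.mul_assoc, ← Matrix.map_mul, Matrix.mul_nonsing_inv _ (isUnit_iff_ne_zero.mpr hc),
    Matrix.map_one _ (map_zero _) (map_one _), Matrix.mul_one] at this

section
open scoped Differential

theorem IntermediateField.deriv_mem_adjoin {E M : Type} [Field E] [Field M] [Differential E]
    [Differential M] [Algebra E M] [DifferentialAlgebra E M] {S : Set M}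
    (hS : ∀ x ∈ S, x′ ∈ IntermediateField.adjoin E S) {x : M}
    (hx : x ∈ IntermediateField.adjoin E S) : x′ ∈ IntermediateField.adjoin E S := by
  induction hx using IntermediateField.adjoin_induction with
  | mem x hx => exact hS x hx
  | algebraMap a =>
    rw [deriv_algebraMap]
    exact IntermediateField.algebraMap_mem _ _
  | add x y _ _ hx hy =>
    rw [map_add]
    exact add_mem hx hy
  | inv x hx' hx =>
    rw [Derivation.leibniz_inv, smul_eq_mul]
    exact mul_mem (neg_mem (pow_mem (inv_mem hx') 2)) hx
  | mul x y hx' hy' hx hy =>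
    rw [Derivation.leibniz, smul_eq_mul, smul_eq_mul]
    exact add_mem (mul_mem hx' hy) (mul_mem hy' hx)

theorem IntermediateField.map_deriv_adjoin {E M N : Type} [Field E] [Field M] [Field N]
    [Differential E] [Differential M] [Differential N] [Algebra E M] [Algebra E N]
    [DifferentialAlgebra E M] [DifferentialAlgebra E N] {S : Set M}
    (hS : ∀ x ∈ S, x′ ∈ IntermediateField.adjoin E S) (φ : IntermediateField.adjoin E S →ₐ[E] N)
    (hφ : ∀ x (hx : x ∈ S), φ ⟨x′, hS x hx⟩ =
      (φ ⟨x, IntermediateField.subset_adjoin E S hx⟩)′) {x : M}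
    (hx : x ∈ IntermediateField.adjoin E S) :
    φ ⟨x′, IntermediateField.deriv_mem_adjoin hS hx⟩ = (φ ⟨x, hx⟩)′ := by
  induction hx using IntermediateField.adjoin_induction with
  | mem x hx => exact hφ x hx
  | algebraMap a =>
    refine Eq.trans ?_ ((congrArg (·′) (φ.commutes a)).trans (deriv_algebraMap a)).symm
    rw [← φ.commutes]
    exact congrArg φ (Subtype.ext (deriv_algebraMap a))
  | add x y hx' hy' hx hy =>
    refine Eq.trans ?_ ((congrArg (·′) (_root_.map_add φ ⟨x, hx'⟩ ⟨y, hy'⟩)).trans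
      (_root_.map_add Differential.deriv _ _)).symm
    rw [← hx, ← hy, ← _root_.map_add]
    exact congrArg φ (Subtype.ext (map_add _ _ _))
  | inv x hx' hx =>
    refine Eq.trans ?_ ((congrArg (·′) (map_inv₀ φ ⟨x, hx'⟩)).trans
      (Derivation.leibniz_inv _ _)).symm
    rw [← hx, ← map_inv₀, ← map_pow, ← map_neg, smul_eq_mul,
      ← _root_.map_mul]
    exact congrArg φ (Subtype.ext (Derivation.leibniz_inv _ _))
  | mul x y hx' hy' hx hy =>
    refine Eq.trans ?_ ((congrArg (·′) (_root_.map_mul φ ⟨x, hx'⟩ ⟨y, hy'⟩)).trans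
      (Derivation.leibniz _ _ _)).symm
    rw [← hx, ← hy, smul_eq_mul, smul_eq_mul, ← _root_.map_mul, ← _root_.map_mul,
      ← _root_.map_add]
    exact congrArg φ (Subtype.ext (Derivation.leibniz _ _ _))

end

/-- Right multiplication of the generic matrix by `c`. -/
noncomputable def MvPolynomial.mulRight {E m : Type} [CommRing E] [Fintype m]
    (c : Matrix m m E) : MvPolynomial (m × m) E →ₐ[E] MvPolynomial (m × m) E :=
  MvPolynomial.aeval fun q => ∑ l, MvPolynomial.X (q.1, l) * MvPolynomial.C (c l q.2)

theorem MvPolynomial.aeval_mulRight {E M m : Type} [CommRing E] [CommRing M] [Algebra E M]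
    [Fintype m] (c : Matrix m m E) (B : Matrix m m M) (f : MvPolynomial (m × m) E) :
    MvPolynomial.aeval (fun q : m × m => B q.1 q.2) (MvPolynomial.mulRight c f) =
      MvPolynomial.aeval (fun q : m × m => (B * c.map (algebraMap E M)) q.1 q.2) f := by
  rw [MvPolynomial.mulRight, MvPolynomial.comp_aeval_apply]
  congr 2
  ext q
  simp [Matrix.mul_apply]

theorem MvPolynomial.mulRight_surjective {E m : Type} [Field E] [Fintype m] [DecidableEq m]
    {c : Matrix m m E} (hc : c.det ≠ 0) : Function.Surjective (MvPolynomial.mulRight c) := by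
  intro f
  refine ⟨MvPolynomial.mulRight c⁻¹ f, ?_⟩
  have h := MvPolynomial.aeval_mulRight c⁻¹
    (Matrix.mvPolynomialX m m E * c.map (algebraMap E (MvPolynomial (m × m) E))) f
  rw [Matrix.mul_assoc, ← Matrix.map_mul, Matrix.mul_nonsing_inv _ (isUnit_iff_ne_zero.mpr hc),
    Matrix.map_one _ (map_zero _) (map_one _), Matrix.mul_one] at h
  rw [← MvPolynomial.aeval_mulRight] at h
  have hX (f : MvPolynomial (m × m) E) :
      MvPolynomial.aeval (fun q : m × m => Matrix.mvPolynomialX m m E q.1 q.2) f = f :=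
    MvPolynomial.aeval_X_left_apply f
  rwa [hX, hX] at h

theorem AlgHom.eq_zero_of_apply_eq_zero {E S M : Type} [CommRing E] [CommRing S] [CommRing M]
    [IsNoetherianRing S] [Algebra E S] [Algebra E M] (u : S →ₐ[E] M) (s : S →ₐ[E] S)
    (hs : Function.Surjective s) (h : ∀ f, u f = 0 → u (s f) = 0) {f : S} (hf : u (s f) = 0) :
    u f = 0 :=
  Ideal.comap_le_of_le_comap (I := RingHom.ker u) s.toRingHom hs h hf

section
open scoped Differential

theorem deriv_matrix_mul_algebraMap {k E M m : Type} [Fintype m] [Field k] [Field E] [Field M]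
    [Differential E] [Differential M] [Algebra E M] [DifferentialAlgebra E M] [Algebra k E]
    (hk : ∀ a : k, (algebraMap k E a)′ = 0) {A : Matrix m m M} {G : Matrix m m M}
    (hG : ∀ i j, (G i j)′ = (A * G) i j) (c : Matrix m m k) (i j : m) :
    ((G * (c.map (algebraMap k E)).map (algebraMap E M)) i j)′ =
      (A * (G * (c.map (algebraMap k E)).map (algebraMap E M))) i j := by
  rw [← Matrix.mul_assoc, Matrix.mul_apply, Matrix.mul_apply, map_sum]
  refine Finset.sum_congr rfl fun l _ => ?_
  rw [Derivation.leibniz, Matrix.map_apply, deriv_algebraMap, Matrix.map_apply, hk, map_zero,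
    smul_zero, zero_add, hG, smul_eq_mul, mul_comm]

theorem deriv_mem_adjoin_matrix {E M m : Type} [Fintype m] [Field E] [Field M] [Differential M]
    [Algebra E M] {A : Matrix m m E} {F : Matrix m m M}
    (hFA : ∀ i j, (F i j)′ = (A.map (algebraMap E M) * F) i j) :
    ∀ x ∈ Set.range (fun q : m × m => F q.1 q.2),
      x′ ∈ IntermediateField.adjoin E (Set.range fun q : m × m => F q.1 q.2) := by
  rintro _ ⟨q, rfl⟩
  rw [hFA, Matrix.mul_apply]
  exact sum_mem fun l _ => mul_mem (IntermediateField.algebraMap_mem _ _)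
    (IntermediateField.subset_adjoin _ _ ⟨(l, q.2), rfl⟩)

theorem AlgHom.map_deriv_adjoin_matrix {E M N m : Type} [Fintype m] [Field E] [Field M] [Field N]
    [Differential E] [Differential M] [Differential N] [Algebra E M] [Algebra E N]
    [DifferentialAlgebra E M] [DifferentialAlgebra E N] {A : Matrix m m E} {F : Matrix m m M}
    (hFA : ∀ i j, (F i j)′ = (A.map (algebraMap E M) * F) i j) {H : Matrix m m N}
    (hHA : ∀ i j, (H i j)′ = (A.map (algebraMap E N) * H) i j)
    (φ : IntermediateField.adjoin E (Set.range fun q : m × m => F q.1 q.2) →ₐ[E] N)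
    (hφ : ∀ q : m × m, ∀ hq, φ ⟨F q.1 q.2, hq⟩ = H q.1 q.2)
    (x y : IntermediateField.adjoin E (Set.range fun q : m × m => F q.1 q.2))
    (hxy : (x : M)′ = y) : (φ x)′ = φ y := by
  refine (IntermediateField.map_deriv_adjoin (deriv_mem_adjoin_matrix hFA) φ ?_ x.2).symm.trans
    (congrArg φ (Subtype.ext hxy))
  rintro _ ⟨q, rfl⟩
  dsimp only
  have hm (q : m × m) : F q.1 q.2 ∈
      IntermediateField.adjoin E (Set.range fun q : m × m => F q.1 q.2) :=
    IntermediateField.subset_adjoin _ _ ⟨q, rfl⟩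
  rw [hφ, hHA, Matrix.mul_apply]
  have hsum : (⟨(F q.1 q.2)′, deriv_mem_adjoin_matrix hFA _ ⟨q, rfl⟩⟩ :
      IntermediateField.adjoin E (Set.range fun q : m × m => F q.1 q.2)) =
      ∑ l, algebraMap E _ (A q.1 l) * ⟨F l q.2, hm (l, q.2)⟩ := by
    refine Subtype.ext ?_
    refine Eq.trans ?_ (IntermediateField.coe_sum _ _).symm
    exact (hFA _ _).trans (Matrix.mul_apply ..)
  rw [hsum, map_sum]
  refine Finset.sum_congr rfl fun l _ => ?_
  rw [map_mul, φ.commutes, hφ (l, q.2)]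
  rfl

theorem exists_aeval_eq_zero_iff {p : ℕ} (hp : p.Prime) {k E M N m : Type} [Fintype m]
    [DecidableEq m] [Field k] [Field E] [Field M] [Field N] [CharZero M] [CharZero N]
    [Differential E] [Differential M] [Differential N] [Algebra k E] [Algebra E M] [Algebra E N]
    [Algebra k M] [Algebra k N] [IsScalarTower k E M] [IsScalarTower k E N]
    [DifferentialAlgebra E M] [DifferentialAlgebra E N] [Differential.ContainConstants k M]
    [Differential.ContainConstants k N]
    {O : ValuationSubring M} (hO : PC p O) {V : ValuationSubring N} (hV : PC p V)
    (hEM : ∀ y : M, IsAlgebraic E y → y ∈ Set.range (algebraMap E M))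
    (hEN : ∀ y : N, IsAlgebraic E y → y ∈ Set.range (algebraMap E N))
    (hkM : ∀ y : M, IsAlgebraic k y → y ∈ Set.range (algebraMap k M))
    (hkN : ∀ y : N, IsAlgebraic k y → y ∈ Set.range (algebraMap k N)) (A : Matrix m m E)
    {F : Matrix m m M} (hF : F.det ≠ 0) (hFA : ∀ i j, (F i j)′ = (A.map (algebraMap E M) * F) i j)
    {G : Matrix m m N} (hG : G.det ≠ 0) (hGA : ∀ i j, (G i j)′ = (A.map (algebraMap E N) * G) i j) :
    ∃ c : Matrix m m k, c.det ≠ 0 ∧ ∀ f : MvPolynomial (m × m) E,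
      MvPolynomial.aeval (fun q : m × m => F q.1 q.2) f = 0 ↔
        MvPolynomial.aeval (fun q : m × m =>
          (G * (c.map (algebraMap k E)).map (algebraMap E N)) q.1 q.2) f = 0 := by
  obtain ⟨c, hc, hFG⟩ := exists_constant_matrix hp hO hEM hV hkN A hF hFA hG hGA
  obtain ⟨c', hc', hGF⟩ := exists_constant_matrix hp hV hEN hO hkM A hG hGA hF hFA
  have hdet {b : Matrix m m k} (hb : b.det ≠ 0) : (b.map (algebraMap k E)).det ≠ 0 := by
    rw [← RingHom.mapMatrix_apply, ← RingHom.map_det]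
    exact (_root_.map_ne_zero _).mpr hb
  have hmap : c.map (algebraMap k N) = (c.map (algebraMap k E)).map (algebraMap E N) := by
    ext i j
    exact IsScalarTower.algebraMap_apply k E N _
  have hmap' : c'.map (algebraMap k M) = (c'.map (algebraMap k E)).map (algebraMap E M) := by
    ext i j
    exact IsScalarTower.algebraMap_apply k E M _
  rw [hmap] at hFG
  rw [hmap'] at hGF
  have hGs (f : MvPolynomial (m × m) E)
      (hf : MvPolynomial.aeval (fun q : m × m =>
        (G * (c.map (algebraMap k E)).map (algebraMap E N)) q.1 q.2) f = 0) :
      MvPolynomial.aeval (fun q : m × m => F q.1 q.2)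
        (((MvPolynomial.mulRight (c'.map (algebraMap k E))).comp
          (MvPolynomial.mulRight (c.map (algebraMap k E)))) f) = 0 := by
    rw [AlgHom.comp_apply, MvPolynomial.aeval_mulRight]
    refine hGF _ ?_
    rw [MvPolynomial.aeval_mulRight]
    exact hf
  have hs : Function.Surjective ((MvPolynomial.mulRight (c'.map (algebraMap k E))).comp
      (MvPolynomial.mulRight (c.map (algebraMap k E)))) := by
    rw [AlgHom.coe_comp]
    exact (MvPolynomial.mulRight_surjective (hdet hc')).comp
      (MvPolynomial.mulRight_surjective (hdet hc))
  exact ⟨c, hc, fun f => ⟨hFG f, fun hf =>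
    AlgHom.eq_zero_of_apply_eq_zero _ _ hs (fun g hg => hGs g (hFG g hg)) (hGs f hf)⟩⟩

theorem exists_differential_algEquiv_adjoin {p : ℕ} (hp : p.Prime) {k E M N m : Type} [Fintype m]
    [DecidableEq m] [Field k] [Field E] [Field M] [Field N] [CharZero M] [CharZero N]
    [Differential E] [Differential M] [Differential N] [Algebra k E] [Algebra E M] [Algebra E N]
    [Algebra k M] [Algebra k N] [IsScalarTower k E M] [IsScalarTower k E N]
    [DifferentialAlgebra E M] [DifferentialAlgebra E N] [Differential.ContainConstants k M]
    [Differential.ContainConstants k N] (hkE : ∀ a : k, (algebraMap k E a)′ = 0)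
    {O : ValuationSubring M} (hO : PC p O) {V : ValuationSubring N} (hV : PC p V)
    (hEM : ∀ y : M, IsAlgebraic E y → y ∈ Set.range (algebraMap E M))
    (hEN : ∀ y : N, IsAlgebraic E y → y ∈ Set.range (algebraMap E N))
    (hkM : ∀ y : M, IsAlgebraic k y → y ∈ Set.range (algebraMap k M))
    (hkN : ∀ y : N, IsAlgebraic k y → y ∈ Set.range (algebraMap k N)) (A : Matrix m m E)
    {F : Matrix m m M} (hF : F.det ≠ 0) (hFA : ∀ i j, (F i j)′ = (A.map (algebraMap E M) * F) i j)
    {G : Matrix m m N} (hG : G.det ≠ 0) (hGA : ∀ i j, (G i j)′ = (A.map (algebraMap E N) * G) i j) :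
    ∃ e : IntermediateField.adjoin E (Set.range fun q : m × m => F q.1 q.2) ≃ₐ[E]
        IntermediateField.adjoin E (Set.range fun q : m × m => G q.1 q.2),
      ∀ x y : IntermediateField.adjoin E (Set.range fun q : m × m => F q.1 q.2),
        (x : M)′ = y → (e x : N)′ = e y := by
  obtain ⟨c, hc, hiff⟩ := exists_aeval_eq_zero_iff hp hO hV hEM hEN hkM hkN A hF hFA hG hGA
  have hdet : (c.map (algebraMap k E)).det ≠ 0 := by
    rw [← RingHom.mapMatrix_apply, ← RingHom.map_det]
    exact (_root_.map_ne_zero _).mpr hc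
  have hHA := deriv_matrix_mul_algebraMap hkE hGA c
  rw [← IntermediateField.adjoin_matrix_mul G hdet]
  obtain ⟨e, he⟩ := MvPolynomial.exists_algEquiv_adjoin hiff
  exact ⟨e, AlgHom.map_deriv_adjoin_matrix hFA hHA ((IntermediateField.val _).comp e.toAlgHom) he⟩
end

section
open scoped Differential

theorem deriv_nonsing_inv_mul {M m : Type} [Fintype m] [DecidableEq m] [Field M] [Differential M]
    {A F G : Matrix m m M} (hG : G.det ≠ 0) (hGA : ∀ i j, (G i j)′ = (A * G) i j)
    (hFA : ∀ i j, (F i j)′ = (A * F) i j) (i j : m) : ((G⁻¹ * F) i j)′ = 0 := by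
  have hGC : G * (G⁻¹ * F) = F :=
    Matrix.mul_nonsing_inv_cancel_left _ _ (isUnit_iff_ne_zero.mpr hG)
  generalize G⁻¹ * F = C at hGC ⊢
  have h : G * C.map (·′) = 0 := by
    ext i j
    have h₁ := hFA i j
    rw [← hGC, ← Matrix.mul_assoc, Matrix.mul_apply, Matrix.mul_apply, map_sum] at h₁
    simp only [Derivation.leibniz, hGA, smul_eq_mul, Finset.sum_add_distrib] at h₁
    simp only [mul_comm (C _ _) _, add_eq_right] at h₁
    exact h₁
  have h₂ : C.map (·′) = 0 := by
    rw [← Matrix.nonsing_inv_mul_cancel_left G (C.map (·′)) (isUnit_iff_ne_zero.mpr hG), h,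
      Matrix.mul_zero]
  exact congrFun (congrFun h₂ i) j

theorem AlgHom.fieldRange_eq_adjoin_matrix {K L M m : Type} [Field K] [Field L] [Field M]
    [Algebra K L] [Algebra K M] (φ : L →ₐ[K] M) {F : Matrix m m L}
    (hF : IntermediateField.adjoin K (Set.range fun q : m × m => F q.1 q.2) = ⊤) :
    φ.fieldRange =
      IntermediateField.adjoin K (Set.range fun q : m × m => F.map φ q.1 q.2) := by
  rw [AlgHom.fieldRange_eq_map, ← hF, IntermediateField.adjoin_map, ← Set.range_comp]
  rfl

theorem deriv_matrix_map {K L M m : Type} [Fintype m] [Field K] [Field L] [Field M]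
    [Differential L] [Differential M] [Algebra K L] [Algebra K M] (φ : L →ₐ[K] M)
    (hφ : ∀ x, φ (x′) = (φ x)′) {A : Matrix m m K} {F : Matrix m m L}
    (hFA : ∀ i j, (F i j)′ = (A.map (algebraMap K L) * F) i j) (i j : m) :
    (F.map φ i j)′ = (A.map (algebraMap K M) * F.map φ) i j := by
  rw [Matrix.map_apply, ← hφ, hFA, Matrix.mul_apply, Matrix.mul_apply, map_sum]
  refine Finset.sum_congr rfl fun l _ => ?_
  rw [map_mul]
  exact congrArg (· * _) (φ.commutes _)

theorem exists_differential_algEquiv_of_algHom {K L₁ L₂ M m : Type} [Fintype m] [DecidableEq m]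
    [Field K] [Field L₁] [Field L₂] [Field M] [Differential L₁] [Differential L₂] [Differential M]
    [Algebra K L₁] [Algebra K L₂] [Algebra K M] (φ : L₁ →ₐ[K] M) (ι : L₂ →ₐ[K] M)
    (hφ : ∀ x, φ (x′) = (φ x)′) (hι : ∀ x, ι (x′) = (ι x)′)
    (hM : ∀ x : M, x′ = 0 → x ∈ Set.range (algebraMap K M)) {A : Matrix m m K}
    {F : Matrix m m L₁} (hF : F.det ≠ 0)
    (hFA : ∀ i j, (F i j)′ = (A.map (algebraMap K L₁) * F) i j)
    (hFt : IntermediateField.adjoin K (Set.range fun q : m × m => F q.1 q.2) = ⊤)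
    {G : Matrix m m L₂} (hG : G.det ≠ 0)
    (hGA : ∀ i j, (G i j)′ = (A.map (algebraMap K L₂) * G) i j)
    (hGt : IntermediateField.adjoin K (Set.range fun q : m × m => G q.1 q.2) = ⊤) :
    ∃ e : L₁ ≃ₐ[K] L₂, ∀ x, e (x′) = (e x)′ := by
  have hdet {L : Type} [Field L] [Algebra K L] (φ : L →ₐ[K] M) {F : Matrix m m L}
      (hF : F.det ≠ 0) : (F.map φ).det ≠ 0 := by
    rw [← AlgHom.mapMatrix_apply, ← AlgHom.map_det]
    exact (_root_.map_ne_zero _).mpr hF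
  have hC := deriv_nonsing_inv_mul (hdet ι hG) (deriv_matrix_map ι hι hGA)
    (deriv_matrix_map φ hφ hFA)
  choose c hc using fun i j => hM _ (hC i j)
  have hFG : G.map ι * (Matrix.of c).map (algebraMap K M) = F.map φ := by
    rw [show (Matrix.of c).map (algebraMap K M) = (G.map ι)⁻¹ * F.map φ from Matrix.ext hc]
    exact Matrix.mul_nonsing_inv_cancel_left _ _ (isUnit_iff_ne_zero.mpr (hdet ι hG))
  have hcd : (Matrix.of c).det ≠ 0 := by
    intro h0
    refine hdet φ hF ?_
    rw [← hFG, Matrix.det_mul, ← RingHom.mapMatrix_apply, ← RingHom.map_det, h0, map_zero,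
      mul_zero]
  have hr : φ.fieldRange = ι.fieldRange := by
    rw [φ.fieldRange_eq_adjoin_matrix hFt, ι.fieldRange_eq_adjoin_matrix hGt, ← hFG,
      IntermediateField.adjoin_matrix_mul _ hcd]
  let e : L₁ ≃ₐ[K] L₂ := (AlgEquiv.ofInjectiveField φ).trans
    ((IntermediateField.equivOfEq hr).trans (AlgEquiv.ofInjectiveField ι).symm)
  have he (x : L₁) : ι (e x) = φ x :=
    congrArg Subtype.val ((AlgEquiv.ofInjectiveField ι).apply_symm_apply
      (IntermediateField.equivOfEq hr (AlgEquiv.ofInjectiveField φ x)))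
  refine ⟨e, fun x => ι.injective ?_⟩
  exact (he _).trans ((hφ x).trans ((congrArg (·′) (he x)).symm.trans (hι _).symm))
end

theorem IntermediateField.adjoin_range_algebraMap {K L E M : Type} [Field K] [Field L] [Field E]
    [Field M] [Algebra K L] [Algebra K E] [Algebra K M] [Algebra L M] [Algebra E M]
    [IsScalarTower K L M] [IsScalarTower K E M] {S : Set L}
    (hS : IntermediateField.adjoin K S = ⊤) :
    IntermediateField.adjoin E (Set.range (algebraMap L M)) =
      IntermediateField.adjoin E (algebraMap L M '' S) := by
  refine le_antisymm (IntermediateField.adjoin_le_iff.mpr ?_)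
    (IntermediateField.adjoin.mono _ _ _ (Set.image_subset_range _ _))
  rintro _ ⟨x, rfl⟩
  have hx : x ∈ IntermediateField.adjoin K S := hS ▸ IntermediateField.mem_top
  have hle : IntermediateField.adjoin K S ≤
      ((IntermediateField.adjoin E (algebraMap L M '' S)).restrictScalars K).comap
        (IsScalarTower.toAlgHom K L M) :=
    IntermediateField.adjoin_le_iff.mpr fun y hy =>
      IntermediateField.subset_adjoin E _ ⟨y, hy, rfl⟩
  exact hle hx

theorem IntermediateField.mem_adjoin_iff_of_algEquiv {K E E' N : Type} [Field K] [Field E]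
    [Field E'] [Field N] [Algebra K E] [Algebra K E'] [Algebra E N] [Algebra E' N] (ψ : E ≃ₐ[K] E')
    (h : ∀ a, algebraMap E' N (ψ a) = algebraMap E N a) (S : Set N) (x : N) :
    x ∈ IntermediateField.adjoin E S ↔ x ∈ IntermediateField.adjoin E' S := by
  have hr : Set.range (algebraMap E N) = Set.range (algebraMap E' N) := by
    rw [← ψ.surjective.range_comp (algebraMap E' N)]
    exact congrArg Set.range (funext fun a => (h a).symm)
  change x ∈ Subfield.closure (Set.range (algebraMap E N) ∪ S) ↔
    x ∈ Subfield.closure (Set.range (algebraMap E' N) ∪ S)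
  rw [hr]

theorem PC.comap_of_relatively_closed {p : ℕ} {K E M : Type} [Field K] [CharZero K]
    [Field E] [Field M] [Algebra K E] [Algebra E M] [Algebra K M] [IsScalarTower K E M]
    {O : ValuationSubring M} (hO : PC p O)
    (hE : ∀ x : M, x ∈ Set.range (algebraMap E M) ↔ IsAlgebraic K x) :
    Algebra.IsAlgebraic K E ∧ PC p (O.comap (algebraMap E M)) := by
  have : CharZero E := charZero_of_injective_algebraMap (algebraMap K E).injective
  have halg : Algebra.IsAlgebraic K E := ⟨fun x =>
    (isAlgebraic_algebraMap_iff (algebraMap E M).injective).mp ((hE _).mp ⟨x, rfl⟩)⟩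
  exact ⟨halg, PC.descend (V := O) (fun _ => Iff.rfl)
    (fun x hx => (hE x).mpr (hx.restrictScalars K)) hO⟩

theorem PC.isPAdicClosure {p : ℕ} (hp : p.Prime) {K E : Type} [Field K] [CharZero K] [Field E]
    [Algebra K E] (halg : Algebra.IsAlgebraic K E) {O : ValuationSubring E} (hO : PC p O) :
    IsPAdicallyClosed p E ∧ Algebra.IsAlgebraic K E ∧ ∃ O : ValuationSubring E,
      PAdicWitness p O ∧ PAdicWitness p (O.comap (algebraMap K E)) := by
  have : CharZero E := charZero_of_injective_algebraMap (algebraMap K E).injective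
  have hK : PVal p (O.comap (algebraMap K E)) :=
    PVal.comap (Z := E) (V := O) (fun _ => Iff.rfl) hO.pval
  exact ⟨hO.isPAdicallyClosed hp, halg, O, hO.pval.witness hp, hK.witness hp⟩

theorem exists_algEquiv_of_pow {p : ℕ} (hp : p.Prime) {K E₁ E₂ M₁ M₂ : Type} [Field K] [CharZero K]
    [Field E₁] [Field E₂] [Field M₁] [Field M₂] [Algebra K E₁] [Algebra K E₂] [Algebra K M₁]
    [Algebra K M₂] [Algebra E₁ M₁] [Algebra E₂ M₂] [IsScalarTower K E₁ M₁]
    [IsScalarTower K E₂ M₂] [Algebra.IsAlgebraic K E₁] [Algebra.IsAlgebraic K E₂]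
    {O₁ : ValuationSubring E₁} {O₂ : ValuationSubring E₂} (h₁ : PC p O₁) (h₂ : PC p O₂)
    (hE₁ : ∀ x : M₁, IsAlgebraic K x → x ∈ Set.range (algebraMap E₁ M₁))
    (hE₂ : ∀ x : M₂, IsAlgebraic K x → x ∈ Set.range (algebraMap E₂ M₂))
    (hpow : ∀ m : ℕ, 2 ≤ m → ∀ a : K,
      (∃ f : M₁, f ^ m = algebraMap K M₁ a) ↔ (∃ f : M₂, f ^ m = algebraMap K M₂ a)) :
    Nonempty (E₁ ≃ₐ[K] E₂) := by
  have hroot {E M : Type} [Field E] [Field M] [Algebra K E] [Algebra K M] [Algebra E M]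
      [IsScalarTower K E M] (hE : ∀ x : M, IsAlgebraic K x → x ∈ Set.range (algebraMap E M))
      {m : ℕ} (hm : m ≠ 0) (a : K) :
      (∃ f : E, f ^ m = algebraMap K E a) ↔ ∃ f : M, f ^ m = algebraMap K M a := by
    constructor
    · rintro ⟨f, hf⟩
      exact ⟨algebraMap E M f, by
        rw [← map_pow, hf, ← IsScalarTower.algebraMap_apply]⟩
    · rintro ⟨f, hf⟩
      obtain ⟨g, rfl⟩ := hE f <|
        IsAlgebraic.of_pow (Nat.pos_of_ne_zero hm) (hf ▸ isAlgebraic_algebraMap a)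
      refine ⟨g, (algebraMap E M).injective ?_⟩
      rw [map_pow, hf, ← IsScalarTower.algebraMap_apply]
  have hiff (m : ℕ) (hm : m ≠ 0) (a : K) :
      (∃ f : E₁, f ^ m = algebraMap K E₁ a) ↔ ∃ f : E₂, f ^ m = algebraMap K E₂ a := by
    rcases (Nat.one_le_iff_ne_zero.mpr hm).eq_or_lt with rfl | h2
    · exact ⟨fun _ => ⟨_, pow_one _⟩, fun _ => ⟨_, pow_one _⟩⟩
    · rw [hroot hE₁ hm, hroot hE₂ hm, hpow m h2]
  obtain ⟨f⟩ := exists_algHom_of_pow hp h₁ h₂ fun m hm a => (hiff m hm a).mp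
  obtain ⟨g⟩ := exists_algHom_of_pow hp h₂ h₁ fun m hm a => (hiff m hm a).mpr
  have hb : Function.Bijective (f.comp g) := Algebra.IsAlgebraic.algHom_bijective _
  refine ⟨AlgEquiv.ofBijective f ⟨f.injective, ?_⟩⟩
  have hs := hb.2
  rw [AlgHom.coe_comp] at hs
  exact hs.of_comp

section
open scoped Differential

theorem exists_differential_of_relatively_closed {K E M : Type} [Field K] [CharZero K]
    [Field E] [Field M] [Differential K] [Differential M] [Algebra K E] [Algebra E M] [Algebra K M]
    [IsScalarTower K E M] [DifferentialAlgebra K M]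
    (hE : ∀ x : M, x ∈ Set.range (algebraMap E M) ↔ IsAlgebraic K x) :
    ∃ _ : Differential E, DifferentialAlgebra K E ∧ DifferentialAlgebra E M := by
  obtain ⟨D, hD⟩ := exists_differentialAlgebra (F := E) (M := M) fun a =>
    (hE _).mpr ((hE _).mp ⟨a, rfl⟩).deriv
  refine ⟨D, ⟨fun a => (algebraMap E M).injective ?_⟩, hD⟩
  rw [← deriv_algebraMap, ← IsScalarTower.algebraMap_apply, ← IsScalarTower.algebraMap_apply,
    deriv_algebraMap]

theorem exists_ringEquiv_adjoin_of_algEquiv {p : ℕ} (hp : p.Prime) {k K E₁ E₂ M N m : Type}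
    [Fintype m] [DecidableEq m] [Field k] [Field K] [Field E₁] [Field E₂] [Field M] [Field N]
    [CharZero K] [CharZero M] [CharZero N] [Differential K] [Differential M]
    [Differential N] [Algebra k K] [Algebra K E₁] [Algebra K E₂] [Algebra E₁ M] [Algebra E₂ N]
    [Algebra K M] [Algebra K N] [Algebra k M] [Algebra k N] [IsScalarTower k K M]
    [IsScalarTower k K N] [IsScalarTower K E₁ M] [IsScalarTower K E₂ N]
    [DifferentialAlgebra K M] [DifferentialAlgebra K N]
    [Differential.ContainConstants k M] [Differential.ContainConstants k N]
    (hkK : ∀ a : k, (algebraMap k K a)′ = 0)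
    {O : ValuationSubring M} (hO : PC p O) {V : ValuationSubring N} (hV : PC p V)
    (hE₁ : ∀ x : M, x ∈ Set.range (algebraMap E₁ M) ↔ IsAlgebraic K x)
    (hE₂ : ∀ x : N, x ∈ Set.range (algebraMap E₂ N) ↔ IsAlgebraic K x)
    (hkM : ∀ y : M, IsAlgebraic k y → y ∈ Set.range (algebraMap k M))
    (hkN : ∀ y : N, IsAlgebraic k y → y ∈ Set.range (algebraMap k N)) (A : Matrix m m K)
    {F : Matrix m m M} (hF : F.det ≠ 0) (hFA : ∀ i j, (F i j)′ = (A.map (algebraMap K M) * F) i j)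
    {G : Matrix m m N} (hG : G.det ≠ 0) (hGA : ∀ i j, (G i j)′ = (A.map (algebraMap K N) * G) i j)
    (ψ : E₁ ≃ₐ[K] E₂) :
    ∃ φ : IntermediateField.adjoin E₁ (Set.range fun q : m × m => F q.1 q.2) ≃+*
        IntermediateField.adjoin E₂ (Set.range fun q : m × m => G q.1 q.2),
      (∀ a, φ (algebraMap E₁ _ a) = algebraMap E₂ _ (ψ a)) ∧
      ∀ x y : IntermediateField.adjoin E₁ (Set.range fun q : m × m => F q.1 q.2),
        (x : M)′ = y → (φ x : N)′ = φ y := by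
  obtain ⟨_, _, _⟩ := exists_differential_of_relatively_closed hE₁
  have halg : Algebra.IsAlgebraic K E₁ := (hO.comap_of_relatively_closed hE₁).1
  let φ₁ : E₁ →ₐ[K] N := (IsScalarTower.toAlgHom K E₂ N).comp ψ
  let _ : Algebra E₁ N := φ₁.toRingHom.toAlgebra
  have hψ (a : E₁) : algebraMap E₂ N (ψ a) = algebraMap E₁ N a := rfl
  have : IsScalarTower K E₁ N := IsScalarTower.of_algebraMap_eq fun a => (φ₁.commutes a).symm
  have : DifferentialAlgebra E₁ N := ⟨fun a => (φ₁.map_deriv_of_isAlgebraic a).symm⟩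
  let _ : Algebra k E₁ := ((algebraMap K E₁).comp (algebraMap k K)).toAlgebra
  have : IsScalarTower k E₁ M := IsScalarTower.of_algebraMap_eq fun a =>
    (IsScalarTower.algebraMap_apply k K M a).trans (IsScalarTower.algebraMap_apply K E₁ M _)
  have : IsScalarTower k E₁ N := IsScalarTower.of_algebraMap_eq fun a =>
    (IsScalarTower.algebraMap_apply k K N a).trans (IsScalarTower.algebraMap_apply K E₁ N _)
  have hmap (Z : Type) [Field Z] [Algebra K Z] [Algebra E₁ Z] [IsScalarTower K E₁ Z] :
      (A.map (algebraMap K E₁)).map (algebraMap E₁ Z) = A.map (algebraMap K Z) := by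
    ext i j
    exact (IsScalarTower.algebraMap_apply K E₁ Z _).symm
  rw [← hmap M] at hFA
  rw [← hmap N] at hGA
  obtain ⟨e, he⟩ := exists_differential_algEquiv_adjoin hp (k := k) (E := E₁) (fun a =>
      (deriv_algebraMap (algebraMap k K a)).trans (by rw [hkK, map_zero])) hO hV
    (fun y hy => (hE₁ y).mpr (hy.restrictScalars K)) (fun y hy => by
      obtain ⟨a, ha⟩ := (hE₂ y).mpr (hy.restrictScalars K)
      exact ⟨ψ.symm a, by rw [← hψ, AlgEquiv.apply_symm_apply, ha]⟩)
    hkM hkN (A.map (algebraMap K E₁)) hF hFA hG hGA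
  have hmem := IntermediateField.mem_adjoin_iff_of_algEquiv ψ hψ
    (Set.range fun q : m × m => G q.1 q.2)
  let e' : IntermediateField.adjoin E₁ (Set.range fun q : m × m => G q.1 q.2) ≃+*
      IntermediateField.adjoin E₂ (Set.range fun q : m × m => G q.1 q.2) :=
    { toFun x := ⟨x, (hmem x).mp x.2⟩
      invFun x := ⟨x, (hmem x).mpr x.2⟩
      left_inv _ := rfl
      right_inv _ := rfl
      map_mul' _ _ := rfl
      map_add' _ _ := rfl }
  refine ⟨e.toRingEquiv.trans e', fun a => Subtype.ext ?_, he⟩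
  exact (congrArg Subtype.val (e.commutes a)).trans (hψ a).symm

end

section
open scoped Differential

theorem containConstants_of_isAlgebraic {p : ℕ} (hp : p.Prime) {k L M : Type} [Field k] [Field L]
    [Field M] [CharZero M] [Differential L] [Differential M] [Algebra L M]
    [DifferentialAlgebra L M] [Algebra k L] [Algebra k M] [IsScalarTower k L M]
    [Differential.ContainConstants k L] (hk : IsPAdicallyClosed p k) (halg : Algebra.IsAlgebraic L M)
    {O : ValuationSubring M} (hO : PVal p O) : Differential.ContainConstants k M :=
  ⟨fun {x} h => hk.mem_range hp hO
    (isAlgebraic_of_deriv_eq_zero (k := k) (halg.isAlgebraic x) h)⟩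

theorem isPicardVessiot_adjoin {p : ℕ} (hp : p.Prime) {k K E M m : Type}
    [Fintype m] [Field k] [Field K] [Field E] [Field M] [CharZero K] [CharZero M]
    [Differential K] [Differential M] [Algebra k K] [Algebra K E] [Algebra E M] [Algebra K M]
    [Algebra k M] [IsScalarTower k K M] [IsScalarTower K E M] [DifferentialAlgebra K M]
    [Differential.ContainConstants k M] [DecidableEq m] (hkK : ∀ a : k, (algebraMap k K a)′ = 0)
    {O : ValuationSubring M} (hO : PVal p O)
    (hE : ∀ x : M, x ∈ Set.range (algebraMap E M) ↔ IsAlgebraic K x) (A : Matrix m m K)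
    {F : Matrix m m M} (hF : F.det ≠ 0) (hFA : ∀ i j, (F i j)′ = (A.map (algebraMap K M) * F) i j)
    {T : IntermediateField E M}
    (hT : T = IntermediateField.adjoin E (Set.range fun q : m × m => F q.1 q.2)) :
    (∀ x : M, x ∈ T → x′ ∈ T) ∧ IsPAdicField p T ∧
      ∃ F : Matrix m m M, (∀ i j, F i j ∈ T) ∧ IsUnit F.det ∧
        (∀ i j, (F i j)′ = (A.map (algebraMap K M) * F) i j) ∧
        IntermediateField.adjoin E (Set.range fun q : m × m => F q.1 q.2) = T ∧
        ∀ x : M, x ∈ T → x′ = 0 → ∃ a : K, a′ = 0 ∧ algebraMap K M a = x := by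
  obtain ⟨_, _, _⟩ := exists_differential_of_relatively_closed hE
  have hmap : (A.map (algebraMap K E)).map (algebraMap E M) = A.map (algebraMap K M) := by
    ext i j
    exact (IsScalarTower.algebraMap_apply K E M _).symm
  have hval : PVal p (O.comap (algebraMap T M)) :=
    PVal.comap (Z := M) (V := O) (fun _ => Iff.rfl) hO
  refine ⟨fun x hx => ?_, ⟨_, hval.witness hp⟩, F, fun i j => ?_,
    isUnit_iff_ne_zero.mpr hF, hFA, hT.symm, fun x _ h => ?_⟩
  · subst hT
    exact IntermediateField.deriv_mem_adjoin
      (deriv_mem_adjoin_matrix (A := A.map (algebraMap K E)) (hmap ▸ hFA)) hx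
  · subst hT
    exact IntermediateField.subset_adjoin _ _ ⟨(i, j), rfl⟩
  · obtain ⟨a, rfl⟩ := mem_range_of_deriv_eq_zero k h
    exact ⟨algebraMap k K a, hkK a, (IsScalarTower.algebraMap_apply k K M a).symm⟩

theorem exists_differential_algEquiv_of_ringEquiv {K E₁ E₂ L₁ L₂ M N m : Type} [Fintype m]
    [DecidableEq m] [Field K] [Field E₁] [Field E₂] [Field L₁] [Field L₂] [Field M] [Field N]
    [Differential L₁] [Differential L₂] [Differential M] [Differential N]
    [Algebra K L₁] [Algebra K L₂] [Algebra K E₁] [Algebra K E₂] [Algebra K M] [Algebra K N]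
    [Algebra L₁ M] [Algebra L₂ N] [Algebra E₁ M] [Algebra E₂ N] [IsScalarTower K L₁ M]
    [IsScalarTower K L₂ N] [IsScalarTower K E₁ M] [IsScalarTower K E₂ N]
    [DifferentialAlgebra L₁ M] [DifferentialAlgebra L₂ N]
    (hN : ∀ x : N, x′ = 0 → x ∈ Set.range (algebraMap K N)) {A : Matrix m m K}
    {F : Matrix m m L₁} (hF : F.det ≠ 0)
    (hFA : ∀ i j, (F i j)′ = (A.map (algebraMap K L₁) * F) i j)
    (hFt : IntermediateField.adjoin K (Set.range fun q : m × m => F q.1 q.2) = ⊤)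
    {G : Matrix m m L₂} (hG : G.det ≠ 0)
    (hGA : ∀ i j, (G i j)′ = (A.map (algebraMap K L₂) * G) i j)
    (hGt : IntermediateField.adjoin K (Set.range fun q : m × m => G q.1 q.2) = ⊤)
    {T₁ : IntermediateField E₁ M} {T₂ : IntermediateField E₂ N}
    (hT : ∀ x : L₁, algebraMap L₁ M x ∈ T₁) (ψ : E₁ ≃ₐ[K] E₂) (φ : T₁ ≃+* T₂)
    (hψ : ∀ a, φ (algebraMap E₁ T₁ a) = algebraMap E₂ T₂ (ψ a))
    (hφ : ∀ x y : T₁, (x : M)′ = y → (φ x : N)′ = φ y) :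
    ∃ e : L₁ ≃ₐ[K] L₂, ∀ x, e (x′) = (e x)′ := by
  let j : L₁ →+* T₁ := (algebraMap L₁ M).codRestrict T₁ hT
  let f : L₁ →ₐ[K] N :=
    { ((algebraMap T₂ N).comp φ.toRingHom).comp j with
      commutes' := fun a => by
        have hj : j (algebraMap K L₁ a) = algebraMap E₁ T₁ (algebraMap K E₁ a) := by
          refine Subtype.ext ?_
          exact (IsScalarTower.algebraMap_apply K L₁ M a).symm.trans
            (IsScalarTower.algebraMap_apply K E₁ M a)
        have h₁ : φ (j (algebraMap K L₁ a)) = algebraMap E₂ T₂ (algebraMap K E₂ a) := by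
          rw [hj, hψ, ψ.commutes]
        exact (congrArg Subtype.val h₁).trans (IsScalarTower.algebraMap_apply K E₂ N a).symm }
  exact exists_differential_algEquiv_of_algHom f (IsScalarTower.toAlgHom K L₂ N)
    (fun x => (hφ (j x) (j (x′)) (deriv_algebraMap x)).symm)
    (fun x => (deriv_algebraMap x).symm) hN hF hFA hFt hG hGA hGt

end

section
open scoped Differential
theorem DifferentialAlgebra.tower (K L M : Type) [Field K] [Field L] [Field M] [Differential K]
    [Differential L] [Differential M] [Algebra K L] [Algebra L M] [Algebra K M]
    [IsScalarTower K L M] [DifferentialAlgebra K L] [DifferentialAlgebra L M] :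
    DifferentialAlgebra K M :=
  ⟨fun a => by rw [IsScalarTower.algebraMap_apply K L M, IsScalarTower.algebraMap_apply K L M,
    deriv_algebraMap, deriv_algebraMap]⟩

theorem IntermediateField.adjoin_range_algebraMap_matrix {K L E M m : Type} [Field K] [Field L]
    [Field E] [Field M] [Algebra K L] [Algebra K E] [Algebra K M] [Algebra L M] [Algebra E M]
    [IsScalarTower K L M] [IsScalarTower K E M] {F : Matrix m m L}
    (hF : IntermediateField.adjoin K (Set.range fun q : m × m => F q.1 q.2) = ⊤) :
    IntermediateField.adjoin E (Set.range (algebraMap L M)) = IntermediateField.adjoin E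
      (Set.range fun q : m × m => F.map (IsScalarTower.toAlgHom K L M) q.1 q.2) := by
  rw [IntermediateField.adjoin_range_algebraMap hF, ← Set.range_comp]
  rfl

theorem AlgHom.det_map_ne_zero {K L M m : Type} [Fintype m] [DecidableEq m] [Field K] [Field L]
    [Field M] [Algebra K L] [Algebra K M] (φ : L →ₐ[K] M) {F : Matrix m m L} (hF : F.det ≠ 0) :
    (F.map φ).det ≠ 0 := by
  rw [← AlgHom.mapMatrix_apply, ← AlgHom.map_det]
  exact (_root_.map_ne_zero _).mpr hF
end

end

/-- Reduction of p-adic unicity to the p-adically closed case: `L₁, L₂`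
are p-adic Picard--Vessiot fields for `y' = A y` over `K` with p-adic closures `L₁⁺, L₂⁺`
inducing the same valuation on `K` and with `K ∩ (L₁⁺)ᵐ = K ∩ (L₂⁺)ᵐ` for all `m ≥ 2`;
`Kⱼ` is the relative algebraic closure of `K` in `Lⱼ⁺`.  Then (a) each `Kⱼ` is a p-adic
closure of `K`; (b) `K₁ ≅ K₂` over `K` and the composita `L̃ⱼ = Kⱼ·Lⱼ` are p-adic
Picard--Vessiot fields over the common field `K̃`; (c) `L̃₁ ≅ L̃₂` as differential
extensions of `K̃` iff `L₁ ≅ L₂` as differential extensions of `K`. -/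
theorem padic_picard_vessiot_reduction_to_padically_closed
    (p : ℕ) (hp : p.Prime)
    (K : Type) [Field K] [CharZero K] (dK : FieldDeriv K)
    (hKpadic : IsPAdicField p K)
    (k : Type) [Field k] [Algebra k K]
    (hconst : ∀ a : K, dK.d a = 0 ↔ a ∈ Set.range (algebraMap k K))
    (hkpc : IsPAdicallyClosed p k)
    (n : ℕ) (A : Matrix (Fin n) (Fin n) K)
    -- the two p-adic Picard--Vessiot fields
    (L₁ L₂ : Type) [Field L₁] [Field L₂] [Algebra K L₁] [Algebra K L₂]
    (d₁ : FieldDeriv L₁) (d₂ : FieldDeriv L₂)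
    (hPV₁ : IsPicardVessiot dK d₁ A) (hpadic₁ : IsPAdicField p L₁)
    (hPV₂ : IsPicardVessiot dK d₂ A) (hpadic₂ : IsPAdicField p L₂)
    -- the p-adic closures `L₁⁺` and `L₂⁺`
    (L₁p L₂p : Type) [Field L₁p] [Field L₂p]
    [Algebra L₁ L₁p] [Algebra L₂ L₂p] [Algebra K L₁p] [Algebra K L₂p]
    [IsScalarTower K L₁ L₁p] [IsScalarTower K L₂ L₂p]
    (halg₁ : Algebra.IsAlgebraic L₁ L₁p) (halg₂ : Algebra.IsAlgebraic L₂ L₂p)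
    (hclosed₁ : IsPAdicallyClosed p L₁p) (hclosed₂ : IsPAdicallyClosed p L₂p)
    (O₁ : ValuationSubring L₁p) (O₂ : ValuationSubring L₂p)
    (hw₁ : PAdicWitness p O₁) (hw₂ : PAdicWitness p O₂)
    (hres₁ : PAdicWitness p (O₁.comap (algebraMap L₁ L₁p)))
    (hres₂ : PAdicWitness p (O₂.comap (algebraMap L₂ L₂p)))
    -- the valuations of `L₁⁺` and `L₂⁺` induce the same valuation on `K`
    (hsameval : ∀ a : K, algebraMap K L₁p a ∈ O₁ ↔ algebraMap K L₂p a ∈ O₂)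
    -- `K ∩ (L₁⁺)ᵐ = K ∩ (L₂⁺)ᵐ` for all `m ≥ 2`
    (hpow : ∀ m : ℕ, 2 ≤ m → ∀ a : K,
      (∃ f : L₁p, f ^ m = algebraMap K L₁p a) ↔ (∃ f : L₂p, f ^ m = algebraMap K L₂p a))
    -- the unique derivations of `Lⱼ⁺` extending those of `Lⱼ`
    (d₁p : FieldDeriv L₁p) (d₂p : FieldDeriv L₂p)
    (hd₁p : ∀ x : L₁, d₁p.d (algebraMap L₁ L₁p x) = algebraMap L₁ L₁p (d₁.d x))
    (hd₂p : ∀ x : L₂, d₂p.d (algebraMap L₂ L₂p x) = algebraMap L₂ L₂p (d₂.d x))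
    -- `Kⱼ`: the relative algebraic closure of `K` in `Lⱼ⁺`
    (K₁ K₂ : Type) [Field K₁] [Field K₂]
    [Algebra K K₁] [Algebra K K₂] [Algebra K₁ L₁p] [Algebra K₂ L₂p]
    [IsScalarTower K K₁ L₁p] [IsScalarTower K K₂ L₂p]
    (hK₁ : ∀ x : L₁p, x ∈ Set.range (algebraMap K₁ L₁p) ↔ IsAlgebraic K x)
    (hK₂ : ∀ x : L₂p, x ∈ Set.range (algebraMap K₂ L₂p) ↔ IsAlgebraic K x)
    -- the composita `L̃ⱼ = Kⱼ · Lⱼ` inside `Lⱼ⁺`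
    (Lt₁ : IntermediateField K₁ L₁p)
    (hLt₁ : Lt₁ = IntermediateField.adjoin K₁ (Set.range (algebraMap L₁ L₁p)))
    (Lt₂ : IntermediateField K₂ L₂p)
    (hLt₂ : Lt₂ = IntermediateField.adjoin K₂ (Set.range (algebraMap L₂ L₂p))) :
    -- (a) each `Kⱼ` is a p-adic closure of `K`
    (IsPAdicallyClosed p K₁ ∧ Algebra.IsAlgebraic K K₁ ∧
      ∃ O : ValuationSubring K₁, PAdicWitness p O ∧
        PAdicWitness p (O.comap (algebraMap K K₁))) ∧
    (IsPAdicallyClosed p K₂ ∧ Algebra.IsAlgebraic K K₂ ∧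
      ∃ O : ValuationSubring K₂, PAdicWitness p O ∧
        PAdicWitness p (O.comap (algebraMap K K₂))) ∧
    -- (b) `K₁ ≅ K₂` over `K`, and each compositum `L̃ⱼ` is a p-adic Picard--Vessiot
    -- field for `y' = A y` over `Kⱼ` (i.e. over the common field `K̃`)
    Nonempty (K₁ ≃ₐ[K] K₂) ∧
    ((∀ x : L₁p, x ∈ Lt₁ → d₁p.d x ∈ Lt₁) ∧ IsPAdicField p Lt₁ ∧
      ∃ F : Matrix (Fin n) (Fin n) L₁p, (∀ i j, F i j ∈ Lt₁) ∧ IsUnit F.det ∧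
        (∀ i j, d₁p.d (F i j) = (A.map (algebraMap K L₁p) * F) i j) ∧
        IntermediateField.adjoin K₁ (Set.range fun q : Fin n × Fin n => F q.1 q.2) = Lt₁ ∧
        ∀ x : L₁p, x ∈ Lt₁ → d₁p.d x = 0 →
          ∃ a : K, dK.d a = 0 ∧ algebraMap K L₁p a = x) ∧
    ((∀ x : L₂p, x ∈ Lt₂ → d₂p.d x ∈ Lt₂) ∧ IsPAdicField p Lt₂ ∧
      ∃ F : Matrix (Fin n) (Fin n) L₂p, (∀ i j, F i j ∈ Lt₂) ∧ IsUnit F.det ∧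
        (∀ i j, d₂p.d (F i j) = (A.map (algebraMap K L₂p) * F) i j) ∧
        IntermediateField.adjoin K₂ (Set.range fun q : Fin n × Fin n => F q.1 q.2) = Lt₂ ∧
        ∀ x : L₂p, x ∈ Lt₂ → d₂p.d x = 0 →
          ∃ a : K, dK.d a = 0 ∧ algebraMap K L₂p a = x) ∧
    -- (c) after identifying `K₁` and `K₂` via such a `K`-isomorphism
    (∀ ψ : K₁ ≃ₐ[K] K₂,
      ((∃ φ : Lt₁ ≃+* Lt₂,
          (∀ a : K₁, φ (algebraMap K₁ Lt₁ a) = algebraMap K₂ Lt₂ (ψ a)) ∧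
          ∀ x y : Lt₁, d₁p.d (x : L₁p) = (y : L₁p) →
            d₂p.d ((φ x : L₂p)) = ((φ y : L₂p))) ↔
        (∃ φ : L₁ ≃ₐ[K] L₂, ∀ x : L₁, φ (d₁.d x) = d₂.d (φ x)))) := by
  let _ : Differential K := dK.differential
  let _ : Differential L₁ := d₁.differential
  let _ : Differential L₂ := d₂.differential
  let _ : Differential L₁p := d₁p.differential
  let _ : Differential L₂p := d₂p.differential
  obtain ⟨hKL₁, F, hF, hFA, hFt, hL₁⟩ := hPV₁
  obtain ⟨hKL₂, G, hG, hGA, hGt, hL₂⟩ := hPV₂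
  have : DifferentialAlgebra K L₁ := ⟨hKL₁⟩
  have : DifferentialAlgebra K L₂ := ⟨hKL₂⟩
  have : DifferentialAlgebra L₁ L₁p := ⟨hd₁p⟩
  have : DifferentialAlgebra L₂ L₂p := ⟨hd₂p⟩
  have : DifferentialAlgebra K L₁p := DifferentialAlgebra.tower K L₁ L₁p
  have : DifferentialAlgebra K L₂p := DifferentialAlgebra.tower K L₂ L₂p
  have : CharZero L₁p := charZero_of_injective_algebraMap (algebraMap K L₁p).injective
  have : CharZero L₂p := charZero_of_injective_algebraMap (algebraMap K L₂p).injective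
  let _ : Algebra k L₁ := ((algebraMap K L₁).comp (algebraMap k K)).toAlgebra
  let _ : Algebra k L₂ := ((algebraMap K L₂).comp (algebraMap k K)).toAlgebra
  let _ : Algebra k L₁p := ((algebraMap K L₁p).comp (algebraMap k K)).toAlgebra
  let _ : Algebra k L₂p := ((algebraMap K L₂p).comp (algebraMap k K)).toAlgebra
  have : IsScalarTower k K L₁p := IsScalarTower.of_algebraMap_eq fun _ => rfl
  have : IsScalarTower k K L₂p := IsScalarTower.of_algebraMap_eq fun _ => rfl
  have : IsScalarTower k L₁ L₁p :=
    IsScalarTower.of_algebraMap_eq fun a => IsScalarTower.algebraMap_apply K L₁ L₁p _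
  have : IsScalarTower k L₂ L₂p :=
    IsScalarTower.of_algebraMap_eq fun a => IsScalarTower.algebraMap_apply K L₂ L₂p _
  have hkK (a : k) : dK.d (algebraMap k K a) = 0 := (hconst _).mpr ⟨a, rfl⟩
  have : Differential.ContainConstants k L₁ := ⟨fun {x} h => by
    obtain ⟨a, ha, rfl⟩ := hL₁ x h
    obtain ⟨b, rfl⟩ := (hconst a).mp ha
    exact ⟨b, rfl⟩⟩
  have : Differential.ContainConstants k L₂ := ⟨fun {x} h => by
    obtain ⟨a, ha, rfl⟩ := hL₂ x h
    obtain ⟨b, rfl⟩ := (hconst a).mp ha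
    exact ⟨b, rfl⟩⟩
  have hO₁ := hw₁.pval hp
  have hO₂ := hw₂.pval hp
  have hP₁ := hclosed₁.pc hp hO₁
  have hP₂ := hclosed₂.pc hp hO₂
  have : Differential.ContainConstants k L₁p :=
    containConstants_of_isAlgebraic hp hkpc halg₁ hO₁
  have : Differential.ContainConstants k L₂p :=
    containConstants_of_isAlgebraic hp hkpc halg₂ hO₂
  obtain ⟨hKK₁, hQ₁⟩ := hP₁.comap_of_relatively_closed hK₁
  obtain ⟨hKK₂, hQ₂⟩ := hP₂.comap_of_relatively_closed hK₂
  let ι₁ := IsScalarTower.toAlgHom K L₁ L₁p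
  let ι₂ := IsScalarTower.toAlgHom K L₂ L₂p
  have hF' := ι₁.det_map_ne_zero hF.ne_zero
  have hG' := ι₂.det_map_ne_zero hG.ne_zero
  have hFA' := deriv_matrix_map ι₁ (fun x => (hd₁p x).symm) hFA
  have hGA' := deriv_matrix_map ι₂ (fun x => (hd₂p x).symm) hGA
  have hT₁ := hLt₁.trans (IntermediateField.adjoin_range_algebraMap_matrix hFt)
  have hT₂ := hLt₂.trans (IntermediateField.adjoin_range_algebraMap_matrix hGt)
  refine ⟨hQ₁.isPAdicClosure hp hKK₁, hQ₂.isPAdicClosure hp hKK₂,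
    exists_algEquiv_of_pow hp hQ₁ hQ₂ (fun x => (hK₁ x).mpr) (fun x => (hK₂ x).mpr) hpow,
    isPicardVessiot_adjoin hp hkK hO₁ hK₁ A hF' hFA' hT₁,
    isPicardVessiot_adjoin hp hkK hO₂ hK₂ A hG' hGA' hT₂, fun ψ => ⟨?_, fun _ => ?_⟩⟩
  · rintro ⟨φ, hψ, hφ⟩
    refine exists_differential_algEquiv_of_ringEquiv (fun x h => ?_) hF.ne_zero hFA hFt hG.ne_zero
      hGA hGt (fun x => hLt₁ ▸ IntermediateField.subset_adjoin _ _ ⟨x, rfl⟩) ψ φ hψ hφ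
    obtain ⟨a, rfl⟩ := mem_range_of_deriv_eq_zero k h
    exact ⟨algebraMap k K a, rfl⟩
  · subst hT₁ hT₂
    exact exists_ringEquiv_adjoin_of_algEquiv hp hkK hP₁ hP₂ hK₁ hK₂
      (fun _ => hkpc.mem_range hp hO₁) (fun _ => hkpc.mem_range hp hO₂) A hF' hFA' hG' hGA' ψ
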